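/- Let n ≥ 2, 0 < λ ≤ Λ, and let the exponents satisfy 0 ≤ p⁺ ≤ q and 0 ≤ p⁻ ≤ s. There exist σ ∈ (0,1) depending only on n, λ, Λ and ε₀ ∈ (0,1) depending only on (n, λ, Λ, p⁺, p⁻, q, s) such that the following holds: let 𝔉 : 𝒮(n) → ℝ be (λ,Λ)-elliptic with 𝔉(0) = 0, let 𝔞, 𝔟 ∈ C(B₁(0)) be nonnegative, let ξ̄ ∈ ℝⁿ, let 0 ≤ 𝔠 ≤ ε₀, and set ℌ_q(x,z;ξ̄) = |ξ̄+z|^{p⁺} + 𝔞(x)|ξ̄+z|^q and ℌ_s(x,z;ξ̄) = |ξ̄+z|^{p⁻} + 𝔟(x)|ξ̄+z|^s. If 𝔲 ∈ C(B₁(0)) satisfies ‖𝔲‖_{L∞(B₁(0))} ≤ 1 and osc_{B₁(0)} 𝔲 ≤ 1, and 𝔲 is a viscosity subsolution of min{𝔉(D²𝔲), ℌ_q(x,D𝔲;ξ̄)𝔉(D²𝔲), ℌ_s(x,D𝔲;ξ̄)𝔉(D²𝔲)} = 𝔠 in B₁(0) and a viscosity supersolution of max{𝔉(D²𝔲), ℌ_q(x,D𝔲;ξ̄)𝔉(D²𝔲),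 ℌ_s(x,D𝔲;ξ̄)𝔉(D²𝔲)} = −𝔠 in B₁(0), then there exists ξ_σ ∈ ℝⁿ such that osc_{B_σ(0)}(𝔲(x) − ξ_σ·x) < σ/2. -/

import Mathlib

open Metric Set MeasureTheory Topology

noncomputable section

abbrev En (n : ℕ) : Type := EuclideanSpace ℝ (Fin n)
abbrev Mat (n : ℕ) : Type := Matrix (Fin n) (Fin n) ℝ

/-- `F : 𝒮(n) → ℝ` is uniformly `(λ,Λ)`-elliptic:
for all symmetric `A, B` with `B` positive semidefinite,
`λ·tr B ≤ F A − F (A + B) ≤ Λ·tr B`. -/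
def UniformlyElliptic {n : ℕ} (lam Lam : ℝ) (F : Mat n → ℝ) : Prop :=
  Continuous F ∧
    ∀ A B : Mat n, A.IsSymm → B.IsSymm → B.PosSemidef →
      lam * B.trace ≤ F A - F (A + B) ∧ F A - F (A + B) ≤ Lam * B.trace

/-- The Hessian matrix of `φ` at `x`, in the standard basis of `ℝⁿ`. -/
def hessianMatrix {n : ℕ} (φ : En n → ℝ) (x : En n) : Mat n :=
  Matrix.of fun i j =>
    iteratedFDeriv ℝ 2 φ x ![EuclideanSpace.single i (1 : ℝ), EuclideanSpace.single j (1 : ℝ)]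

/-- `w` is a viscosity subsolution of `G(x, u(x), Du, D²u) = 0` on `Ω`:
whenever a `C²` function `φ` is such that `w − φ` has a local maximum (on `Ω`) at `x₀ ∈ Ω`,
then `G x₀ (w x₀) (Dφ x₀) (D²φ x₀) ≤ 0`. -/
def ViscSubOn {n : ℕ} (Ω : Set (En n)) (G : En n → ℝ → En n → Mat n → ℝ)
    (w : En n → ℝ) : Prop :=
  ∀ φ : En n → ℝ, ContDiff ℝ 2 φ → ∀ x₀ ∈ Ω,
    IsLocalMaxOn (fun x => w x - φ x) Ω x₀ →
      G x₀ (w x₀) (gradient φ x₀) (hessianMatrix φ x₀) ≤ 0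

/-- `w` is a viscosity supersolution of `G(x, u(x), Du, D²u) = 0` on `Ω`. -/
def ViscSupOn {n : ℕ} (Ω : Set (En n)) (G : En n → ℝ → En n → Mat n → ℝ)
    (w : En n → ℝ) : Prop :=
  ∀ φ : En n → ℝ, ContDiff ℝ 2 φ → ∀ x₀ ∈ Ω,
    IsLocalMinOn (fun x => w x - φ x) Ω x₀ →
      0 ≤ G x₀ (w x₀) (gradient φ x₀) (hessianMatrix φ x₀)

/-- viscosity solution: both a subsolution and a supersolution. -/
def ViscSolOn {n : ℕ} (Ω : Set (En n)) (G : En n → ℝ → En n → Mat n → ℝ)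
    (u : En n → ℝ) : Prop :=
  ViscSubOn Ω G u ∧ ViscSupOn Ω G u

/-- `H(x, z; ξ) = |ξ+z|^p + coef(x)·|ξ+z|^e`. -/
def Hfun {n : ℕ} (p e : ℝ) (coef : En n → ℝ) (ξ x z : En n) : ℝ :=
  ‖ξ + z‖ ^ p + coef x * ‖ξ + z‖ ^ e

/-- The switched exponent `p_v(x) = p⁺·1_{v>0}(x) + p⁻·1_{v<0}(x)`. -/
def pSwitch {n : ℕ} (pp pm : ℝ) (v : En n → ℝ) (x : En n) : ℝ :=
  pp * Set.indicator {y | 0 < v y} (fun _ => (1 : ℝ)) x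
    + pm * Set.indicator {y | v y < 0} (fun _ => (1 : ℝ)) x

/-- The transmission operator
`[|ξ+z|^{p_v(x)} + a(x)1_{v>0}|ξ+z|^q + b(x)1_{v<0}|ξ+z|^s]·F(X) − f(x)`. -/
def transOp {n : ℕ} (F : Mat n → ℝ) (pp pm q s : ℝ) (a b f v : En n → ℝ) (ξ : En n) :
    En n → ℝ → En n → Mat n → ℝ :=
  fun x _ z X =>
    (‖ξ + z‖ ^ pSwitch pp pm v x
        + a x * Set.indicator {y | 0 < v y} (fun _ => (1 : ℝ)) x * ‖ξ + z‖ ^ q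
        + b x * Set.indicator {y | v y < 0} (fun _ => (1 : ℝ)) x * ‖ξ + z‖ ^ s) * F X - f x

/-- `min{F(X), H_q(x,z;ξ)F(X), H_s(x,z;ξ)F(X)} − rhs(x)`. -/
def minOp {n : ℕ} (F : Mat n → ℝ) (pp pm q s : ℝ) (a b : En n → ℝ) (ξ : En n)
    (rhs : En n → ℝ) : En n → ℝ → En n → Mat n → ℝ :=
  fun x _ z X =>
    min (F X) (min (Hfun pp q a ξ x z * F X) (Hfun pm s b ξ x z * F X)) - rhs x

/-- `max{F(X), H_q(x,z;ξ)F(X), H_s(x,z;ξ)F(X)} − rhs(x)`. -/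
def maxOp {n : ℕ} (F : Mat n → ℝ) (pp pm q s : ℝ) (a b : En n → ℝ) (ξ : En n)
    (rhs : En n → ℝ) : En n → ℝ → En n → Mat n → ℝ :=
  fun x _ z X =>
    max (F X) (max (Hfun pp q a ξ x z * F X) (Hfun pm s b ξ x z * F X)) - rhs x

/-- Definition D: `u` is a viscosity solution of the free transmission equation
relative to the sign of `v`, with translation vector `ξ`. -/
def DefDSolution {n : ℕ} (Ω : Set (En n)) (F : Mat n → ℝ) (pp pm q s : ℝ)
    (a b f : En n → ℝ) (v : En n → ℝ) (ξ : En n) (u : En n → ℝ) : Prop :=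
  ViscSolOn ({x ∈ Ω | 0 < v x} ∪ {x ∈ Ω | v x < 0}) (transOp F pp pm q s a b f v ξ) u ∧
  ViscSubOn {x ∈ Ω | v x = 0} (minOp F pp pm q s a b ξ f) u ∧
  ViscSupOn {x ∈ Ω | v x = 0} (maxOp F pp pm q s a b ξ f) u

/-- Uniform exterior sphere condition for `Ω`. -/
def UnifExtSphere {n : ℕ} (Ω : Set (En n)) : Prop :=
  ∃ r : ℝ, 0 < r ∧ ∀ y ∈ frontier Ω, ∃ x : En n,
    dist y x = r ∧ Metric.closedBall x r ∩ closure Ω = {y}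

/-- `φ` is a smooth, nonnegative, radially symmetric mollifier supported in `B_ε(0)`
with unit mass. -/
def IsMollifier {n : ℕ} (ε : ℝ) (φ : En n → ℝ) : Prop :=
  ContDiff ℝ (⊤ : ℕ∞) φ ∧ (∀ x, 0 ≤ φ x) ∧ (∀ x y : En n, ‖x‖ = ‖y‖ → φ x = φ y) ∧
    (∫ x, φ x) = 1 ∧ ∀ x : En n, ε ≤ ‖x‖ → φ x = 0

/-- The mollified indicator `(φε * 1_S)(x)`. -/
def smoothedChi {n : ℕ} (φε : En n → ℝ) (S : Set (En n)) (x : En n) : ℝ :=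
  ∫ y, φε y * S.indicator (fun _ => (1 : ℝ)) (x - y)

/-- `ℓ_μ(z) = √(μ² + |z|²)`. -/
def ellReg {n : ℕ} (μ : ℝ) (z : En n) : ℝ := Real.sqrt (μ ^ 2 + ‖z‖ ^ 2)

/-- The regularized operator
`G_ε(x, z)·(ε·r + F(X)) − f(x)`, where
`G_ε(x,z) = ℓ_ε(z)^{p_{ε;v}(x)} + a_{ε;v}(x) ℓ_ε(z)^q + b_{ε;v}(x) ℓ_ε(z)^s`. -/
def regOp {n : ℕ} (F : Mat n → ℝ) (ε pp pm q s : ℝ) (a b v f φε : En n → ℝ) :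
    En n → ℝ → En n → Mat n → ℝ :=
  fun x r z X =>
    (ellReg ε z ^ (ε + pp * smoothedChi φε {y | 0 < v y} x + pm * smoothedChi φε {y | v y < 0} x)
        + (ε + a x * smoothedChi φε {y | 0 < v y} x) * ellReg ε z ^ q
        + (ε + b x * smoothedChi φε {y | v y < 0} x) * ellReg ε z ^ s) * (ε * r + F X) - f x

/-- The Multi-Phase operator with variable exponents:
`[ℓ_μ(z)^{p(x)} + a(x)ℓ_μ(z)^{q(x)} + b(x)ℓ_μ(z)^{s(x)}]·(μ·r + F(X)) − f(x)`. -/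
def mpOp {n : ℕ} (F : Mat n → ℝ) (μ : ℝ) (p q s a b f : En n → ℝ) :
    En n → ℝ → En n → Mat n → ℝ :=
  fun x r z X =>
    (ellReg μ z ^ p x + a x * ellReg μ z ^ q x + b x * ellReg μ z ^ s x) * (μ * r + F X) - f x

/-- Pucci maximal operator `M⁺_{λ,Λ}(A) = −Λ·tr(A⁻) − λ·tr(A⁺)`. -/
def pucciPlus {n : ℕ} (lam Lam : ℝ) (A : Mat n) : ℝ :=
  if h : A.IsHermitian then
    -(Lam * ∑ i, min (h.eigenvalues i) 0) - lam * ∑ i, max (h.eigenvalues i) 0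
  else 0

/-- Pucci minimal operator `M⁻_{λ,Λ}(A) = −Λ·tr(A⁺) − λ·tr(A⁻)`. -/
def pucciMinus {n : ℕ} (lam Lam : ℝ) (A : Mat n) : ℝ :=
  if h : A.IsHermitian then
    -(Lam * ∑ i, max (h.eigenvalues i) 0) - lam * ∑ i, min (h.eigenvalues i) 0
  else 0

/-- `u` is locally `β`-Hölder continuous on `Ω`. -/
def LocallyHolderOn {n : ℕ} (Ω : Set (En n)) (β : ℝ) (u : En n → ℝ) : Prop :=
  ∀ x ∈ Ω, ∃ ε > 0, ∃ C : ℝ, ∀ y ∈ ball x ε ∩ Ω, ∀ z ∈ ball x ε ∩ Ω,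
    |u y - u z| ≤ C * ‖y - z‖ ^ β

/-- `u ∈ C^{1,α}_loc(Ω)`: `u` is differentiable on `Ω` with locally
`α`-Hölder continuous gradient. -/
def C1HolderLocOn {n : ℕ} (Ω : Set (En n)) (α : ℝ) (u : En n → ℝ) : Prop :=
  (∀ x ∈ Ω, DifferentiableAt ℝ u x) ∧
  ∀ x ∈ Ω, ∃ ε > 0, ∃ C : ℝ, ∀ y ∈ ball x ε ∩ Ω, ∀ z ∈ ball x ε ∩ Ω,
    ‖gradient u y - gradient u z‖ ≤ C * ‖y - z‖ ^ α

section KS1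
open Filter

variable {E : Type*} [NormedAddCommGroup E] [InnerProductSpace ℝ E]

/-- symmetric operator -/
def SymOp (A : E →L[ℝ] E) : Prop := ∀ x y, inner ℝ (A x) y = inner ℝ x (A y)

/-- second order Taylor expansion at a point -/
def HasT2 (f : E → ℝ) (x p : E) (A : E →L[ℝ] E) : Prop :=
  ∀ ε > 0, ∀ᶠ y in 𝓝 x,
    |f y - f x - inner ℝ p (y - x) - (1/2) * inner ℝ (A (y - x)) (y - x)| ≤ ε * ‖y - x‖ ^ 2

/-- two-sided touching by paraboloids of opening `K` -/
def TwoSided (f : E → ℝ) (U : Set E) (K : ℝ) (x p : E) : Prop :=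
  ∀ y ∈ U, |f y - f x - inner ℝ p (y - x)| ≤ K * ‖y - x‖ ^ 2

lemma TwoSided.slope_lip {f : E → ℝ} {U : Set E} {K : ℝ} {x x' p p' : E}
    (h : TwoSided f U K x p) (h' : TwoSided f U K x' p') (hxx : x ≠ x')
    (hU : closedBall x' ‖x - x'‖ ⊆ U) : ‖p - p'‖ ≤ 6 * K * ‖x - x'‖ := by
  set d := ‖x - x'‖ with hd
  have hd0 : 0 < d := norm_pos_iff.2 (sub_ne_zero.2 hxx)
  have hx' : x' ∈ U := hU (by simp [hd0.le])
  have h1 := h x' hx'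
  rw [norm_sub_rev x' x, ← hd] at h1
  have hK : 0 ≤ K := by
    have := (abs_nonneg _).trans h1
    by_contra hneg
    push Not at hneg
    nlinarith [sq_nonneg d, mul_pos hd0 hd0]
  by_cases hpp : p = p'
  · subst hpp; simp; positivity
  have hn : 0 < ‖p - p'‖ := norm_pos_iff.2 (sub_ne_zero.2 hpp)
  set y : E := x' + (d / ‖p - p'‖) • (p - p') with hy
  have hyx : ‖y - x'‖ = d := by
    rw [hy, add_sub_cancel_left, norm_smul, Real.norm_of_nonneg (by positivity)]
    field_simp
  have hyU : y ∈ U := hU (by rw [mem_closedBall, dist_eq_norm, hyx])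
  have h2 := h y hyU
  have h3 := h' y hyU
  rw [hyx] at h3
  have h4 : ‖y - x‖ ≤ 2 * d := by
    calc ‖y - x‖ = ‖(y - x') - (x - x')‖ := by congr 1; abel
      _ ≤ ‖y - x'‖ + ‖x - x'‖ := norm_sub_le _ _
      _ = 2 * d := by rw [hyx]; ring
  have h5 : K * ‖y - x‖ ^ 2 ≤ K * (4 * d ^ 2) := by
    apply mul_le_mul_of_nonneg_left _ hK
    nlinarith [norm_nonneg (y - x)]
  have e1 : inner ℝ (p - p') (y - x') = d * ‖p - p'‖ := by
    rw [hy, add_sub_cancel_left, inner_smul_right, real_inner_self_eq_norm_sq]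
    field_simp
  have e2 : inner ℝ (p - p') (y - x') = inner ℝ p (y - x) - inner ℝ p (x' - x)
      - inner ℝ p' (y - x') := by
    have e3 : y - x' = (y - x) - (x' - x) := by abel
    have e4 : inner ℝ p (y - x') = inner ℝ p (y - x) - inner ℝ p (x' - x) := by
      rw [← inner_sub_right, ← e3]
    rw [inner_sub_left, e4]
  rw [abs_le] at h1 h2 h3
  have : d * ‖p - p'‖ ≤ d * (6 * K * d) := by nlinarith
  exact le_of_mul_le_mul_left this hd0

lemma HasT2.congr_symm {f : E → ℝ} {x p : E} {A B : E →L[ℝ] E} (h : HasT2 f x p A)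
    (hB : ∀ d, inner ℝ (B d) d = inner ℝ (A d) d) : HasT2 f x p B := by
  intro ε hε
  filter_upwards [h ε hε] with y hy
  rw [hB]; exact hy

lemma abs_inner_op_le (A : E →L[ℝ] E) (x y : E) : |inner ℝ (A x) y| ≤ ‖A‖ * ‖x‖ * ‖y‖ :=
  (abs_real_inner_le_norm _ _).trans (mul_le_mul_of_nonneg_right (A.le_opNorm x) (norm_nonneg _))

set_option maxHeartbeats 3200000 in
/-- Key chaining lemma. -/
lemma hasT2_of_dense {f : E → ℝ} {U T : Set E} {K : ℝ} {p : E → E} {x : E} {A : E →L[ℝ] E}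
    (hU : U ∈ 𝓝 x) (hxT : x ∈ T)
    (hT : ∀ t ∈ T, TwoSided f U K t (p t))
    (hA : HasFDerivWithinAt p A T x)
    (hd : ∀ δ > 0, ∀ᶠ y in 𝓝 x, ∃ t ∈ T, ‖t - y‖ ≤ δ * ‖y - x‖) :
    HasT2 f x (p x) A := by
  intro ε hε
  have hKa : 0 ≤ |K| := abs_nonneg K
  have hAn : 0 ≤ ‖A‖ := norm_nonneg A
  obtain ⟨N, hN⟩ := exists_nat_gt ((9 * |K| + 12 * ‖A‖ + 1) * 2 / ε)
  have hN0 : (0:ℝ) < N := lt_of_le_of_lt (by positivity) hN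
  have hN1 : (1:ℝ) ≤ N := by
    have : 0 < N := by exact_mod_cast hN0
    exact_mod_cast this
  set δ : ℝ := 1 / (N:ℝ) ^ 2 with hδ
  have hδ0 : 0 < δ := by positivity
  set η : ℝ := ε / 12 with hη
  have hη0 : 0 < η := by positivity
  have hlin : ∀ᶠ t in 𝓝 x, t ∈ T → ‖p t - p x - A (t - x)‖ ≤ η * ‖t - x‖ := by
    have := hA.isLittleO.def hη0
    exact eventually_nhdsWithin_iff.1 this
  obtain ⟨r0, hr0, hr⟩ := Metric.eventually_nhds_iff_ball.1 (hlin.and ((hd δ hδ0).and hU))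
  refine Metric.eventually_nhds_iff_ball.2 ⟨r0 / 2, by positivity, fun y hy => ?_⟩
  set d := y - x with hdd
  set r := ‖d‖ with hrr
  have hrr0 : r < r0 / 2 := by rwa [mem_ball, dist_eq_norm] at hy
  have hrn : 0 ≤ r := norm_nonneg _
  set g : E → ℝ := fun y => f y - f x - inner ℝ (p x) (y - x)
    - (1/2) * inner ℝ (A (y - x)) (y - x) with hg
  set e : ℝ := r ^ 2 * ((9 * |K| + 12 * ‖A‖) / (N:ℝ) ^ 2 + 6 * η / N) with he
  have he0 : 0 ≤ e := by positivity
  -- induction along the chain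
  have key : ∀ i : ℕ, i ≤ N → ∀ t' ∈ ball x r0, ‖t' - (x + ((i:ℝ) / N) • d)‖ ≤ δ * (r * (i / N)) →
      |g t'| ≤ i * e := by
    intro i
    induction i with
    | zero =>
      intro _ t' _ h
      have : t' = x := by simpa [sub_eq_zero] using h
      simp [hg, this]
    | succ i ih =>
      intro hi t' ht' h
      have hiN : (i:ℝ) + 1 ≤ N := by exact_mod_cast hi
      have hi0 : (0:ℝ) ≤ i := Nat.cast_nonneg i
      set c : ℝ := (i:ℝ) / N with hc
      have hc0 : 0 ≤ c := by positivity
      have hc1 : c ≤ 1 := by rw [hc, div_le_one hN0]; linarith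
      have hyi : x + c • d ∈ ball x r0 := by
        rw [mem_ball, dist_eq_norm, add_sub_cancel_left, norm_smul, Real.norm_of_nonneg hc0]
        nlinarith
      obtain ⟨t, htT, ht⟩ := (hr _ hyi).2.1
      rw [add_sub_cancel_left, norm_smul, Real.norm_of_nonneg hc0, ← hrr] at ht
      have hδ1 : δ ≤ 1 := by
        rw [hδ, div_le_one (by positivity)]; nlinarith
      have hδN : δ ≤ 1 / N := by
        rw [hδ]; apply one_div_le_one_div_of_le hN0; nlinarith
      have htb : t ∈ ball x r0 := by
        rw [mem_ball, dist_eq_norm]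
        calc ‖t - x‖ = ‖(t - (x + c • d)) + c • d‖ := by congr 1; abel
          _ ≤ δ * (c * r) + c * r := by
            refine (norm_add_le _ _).trans (add_le_add ht ?_)
            rw [norm_smul, Real.norm_of_nonneg hc0]
          _ ≤ 1 * r + 1 * r := by
            have : c * r ≤ r := by nlinarith
            have : 0 ≤ c * r := by positivity
            nlinarith
          _ < r0 := by linarith
      have ih' := ih (by omega) t htb (by rw [mul_comm r]; exact ht)
      set s := t - x with hs
      set k := t' - t with hk
      have hs' : ‖s - c • d‖ ≤ δ * r := by
        have : s - c • d = t - (x + c • d) := by rw [hs]; abel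
        rw [this]; refine ht.trans ?_
        have : c * r ≤ r := by nlinarith
        nlinarith
      have hk' : ‖k - (1 / (N:ℝ)) • d‖ ≤ 2 * δ * r := by
        have e1 : k - (1 / (N:ℝ)) • d = (t' - (x + (((i+1:ℕ):ℝ) / N) • d)) - (s - c • d) := by
          have : (((i+1:ℕ):ℝ) / N) = c + 1 / N := by rw [hc]; push_cast; ring
          rw [this, add_smul, hk, hs]; abel
        rw [e1]
        refine (norm_sub_le _ _).trans ?_
        have h6 : δ * (r * (((i+1:ℕ):ℝ) / N)) ≤ δ * r := by
          apply mul_le_mul_of_nonneg_left _ hδ0.le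
          have : (((i+1:ℕ):ℝ) / N) ≤ 1 := by rw [div_le_one hN0]; push_cast; linarith
          nlinarith
        linarith
      have hkn : ‖k‖ ≤ 3 * r / N := by
        calc ‖k‖ = ‖(k - (1 / (N:ℝ)) • d) + (1 / (N:ℝ)) • d‖ := by congr 1; abel
          _ ≤ 2 * δ * r + 1 / N * r := by
            refine (norm_add_le _ _).trans (add_le_add hk' ?_)
            rw [norm_smul, Real.norm_of_nonneg (by positivity)]
          _ ≤ 2 * (1 / N) * r + 1 / N * r := by gcongr
          _ = 3 * r / N := by ring
      have hsn : ‖s‖ ≤ 2 * r := by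
        calc ‖s‖ = ‖(s - c • d) + c • d‖ := by congr 1; abel
          _ ≤ δ * r + c * r := by
            refine (norm_add_le _ _).trans (add_le_add hs' ?_)
            rw [norm_smul, Real.norm_of_nonneg hc0]
          _ ≤ 2 * r := by nlinarith
      have b1 : |f t' - f t - inner ℝ (p t) k| ≤ |K| * (3 * r / N) ^ 2 := by
        refine (hT t htT t' (hr _ ht').2.2).trans ?_
        refine (mul_le_mul_of_nonneg_right (le_abs_self K) (sq_nonneg _)).trans ?_
        gcongr
      have b2 : |inner ℝ (p t - p x - A s) k| ≤ η * (2 * r) * (3 * r / N) := by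
        refine (abs_real_inner_le_norm _ _).trans ?_
        apply mul_le_mul _ hkn (norm_nonneg _) (by positivity)
        refine ((hr _ htb).1 htT).trans ?_
        gcongr
      have b3 : |inner ℝ (A k) k| ≤ ‖A‖ * (3 * r / N) * (3 * r / N) := by
        refine (abs_inner_op_le A k k).trans ?_
        gcongr
      have b4 : |inner ℝ (A s) k - inner ℝ (A k) s| ≤ ‖A‖ * (10 * δ * r ^ 2) := by
        have q1 := abs_inner_op_le A (s - c • d) k
        have q2 := abs_inner_op_le A k (s - c • d)
        have q3 := abs_inner_op_le A (c • d) (k - (1 / (N:ℝ)) • d)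
        have q4 := abs_inner_op_le A (k - (1 / (N:ℝ)) • d) (c • d)
        have hcd : ‖c • d‖ ≤ r := by
          rw [norm_smul, Real.norm_of_nonneg hc0]; nlinarith
        have hk3 : ‖k‖ ≤ 3 * r := hkn.trans (by rw [div_le_iff₀ hN0]; nlinarith)
        have q1' : ‖A‖ * ‖s - c • d‖ * ‖k‖ ≤ ‖A‖ * (δ * r) * (3 * r) := by gcongr
        have q2' : ‖A‖ * ‖k‖ * ‖s - c • d‖ ≤ ‖A‖ * (3 * r) * (δ * r) := by gcongr
        have q3' : ‖A‖ * ‖c • d‖ * ‖k - (1 / (N:ℝ)) • d‖ ≤ ‖A‖ * r * (2 * δ * r) := by gcongr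
        have q4' : ‖A‖ * ‖k - (1 / (N:ℝ)) • d‖ * ‖c • d‖ ≤ ‖A‖ * (2 * δ * r) * r := by gcongr
        have id1 : inner ℝ (A s) k - inner ℝ (A k) s =
            inner ℝ (A (s - c • d)) k - inner ℝ (A k) (s - c • d)
            + inner ℝ (A (c • d)) (k - (1 / (N:ℝ)) • d)
            - inner ℝ (A (k - (1 / (N:ℝ)) • d)) (c • d) := by
          simp only [map_sub, map_smul, inner_sub_left, inner_sub_right, inner_smul_left,
            inner_smul_right, RCLike.conj_to_real]
          ring
        rw [id1]
        rw [abs_le] at q1 q2 q3 q4 ⊢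
        constructor <;> linarith
      have id2 : g t' - g t = (f t' - f t - inner ℝ (p t) k) + inner ℝ (p t - p x - A s) k
          + (1/2) * (inner ℝ (A s) k - inner ℝ (A k) s) - (1/2) * inner ℝ (A k) k := by
        have e1 : t' - x = s + k := by rw [hs, hk]; abel
        have e2 : t - x = s := rfl
        simp only [hg, e1, e2, map_add, inner_add_left, inner_add_right, inner_sub_left]
        ring
      have hfin : |g t' - g t| ≤ e := by
        have : |K| * (3 * r / N) ^ 2 + η * (2 * r) * (3 * r / N) + ‖A‖ * (10 * δ * r ^ 2) * (1/2)
            + (1/2) * (‖A‖ * (3 * r / N) * (3 * r / N)) ≤ e := by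
          rw [he, hδ]
          have : ‖A‖ * r ^ 2 / (N:ℝ)^2 ≥ 0 := by positivity
          have id3 : r ^ 2 * ((9 * |K| + 12 * ‖A‖) / (N:ℝ) ^ 2 + 6 * η / N) -
            (|K| * (3 * r / N) ^ 2 + η * (2 * r) * (3 * r / N) + ‖A‖ * (10 * (1 / (N:ℝ) ^ 2) * r ^ 2) * (1/2)
            + (1/2) * (‖A‖ * (3 * r / N) * (3 * r / N))) = (5/2) * (‖A‖ * r ^ 2 / (N:ℝ)^2) := by
            field_simp; ring
          linarith
        rw [id2]
        rw [abs_le] at b1 b2 b3 b4 ⊢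
        constructor <;> linarith
      have : |g t'| ≤ |g t| + |g t' - g t| := by
        have := abs_add_le (g t) (g t' - g t)
        simpa using this
      push_cast
      linarith
  have hyb : y ∈ ball x r0 := by rw [mem_ball, dist_eq_norm]; linarith
  have hfin := key N le_rfl y hyb (by
    rw [div_self hN0.ne', one_smul, hdd]; simp; positivity)
  refine hfin.trans ?_
  rw [he]
  have h1 : (9 * |K| + 12 * ‖A‖) / N ≤ ε / 2 := by
    rw [div_lt_iff₀ hε] at hN
    rw [div_le_iff₀ hN0]; linarith
  have id4 : (N:ℝ) * (r ^ 2 * ((9 * |K| + 12 * ‖A‖) / (N:ℝ) ^ 2 + 6 * η / N))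
    = ((9 * |K| + 12 * ‖A‖) / N + ε / 2) * r ^ 2 := by
    rw [hη]; field_simp; ring
  rw [id4]
  gcongr
  linarith

end KS1

section KS2
open Filter

variable {E : Type*} [NormedAddCommGroup E] [InnerProductSpace ℝ E]

lemma HasT2.slope_deriv {f : E → ℝ} {U T : Set E} {K : ℝ} {p : E → E} {x : E} {A : E →L[ℝ] E}
    (hU : U ∈ 𝓝 x) (hT : ∀ t ∈ T, TwoSided f U K t (p t)) (hS : SymOp A)
    (h2 : HasT2 f x (p x) A) : HasFDerivWithinAt p A T x := by
  rw [hasFDerivWithinAt_iff_isLittleO, Asymptotics.isLittleO_iff]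
  intro η hη
  have hC : 0 < |K| + ‖A‖ + 8 := by positivity
  obtain ⟨κ, hκ0, hκ1, hκ⟩ : ∃ κ : ℝ, 0 < κ ∧ κ ≤ 1 ∧ (|K| + ‖A‖ + 8) * κ ≤ η := by
    refine ⟨min 1 (η / (|K| + ‖A‖ + 8)), by positivity, min_le_left _ _, ?_⟩
    calc (|K| + ‖A‖ + 8) * min 1 (η / (|K| + ‖A‖ + 8))
        ≤ (|K| + ‖A‖ + 8) * (η / (|K| + ‖A‖ + 8)) := by gcongr; exact min_le_right _ _
      _ = η := by field_simp
  obtain ⟨r0, hr0, hr⟩ := Metric.eventually_nhds_iff_ball.1 ((h2 (κ ^ 2) (by positivity)).and hU)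
  rw [eventually_nhdsWithin_iff]
  refine Metric.eventually_nhds_iff_ball.2 ⟨r0 / 2, by positivity, fun t ht htT => ?_⟩
  have htr : ‖t - x‖ < r0 / 2 := by rwa [mem_ball, dist_eq_norm] at ht
  by_cases hq : p t - p x - A (t - x) = 0
  · rw [hq]; simp; positivity
  have hqn : 0 < ‖p t - p x - A (t - x)‖ := norm_pos_iff.2 hq
  generalize hqd : p t - p x - A (t - x) = q at *
  generalize hrd : ‖t - x‖ = r at *
  have hrn : 0 ≤ r := by rw [← hrd]; exact norm_nonneg _
  rcases hrn.eq_or_lt with h0 | hrpos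
  · rw [← h0] at hrd
    have : t = x := by simpa [sub_eq_zero] using hrd
    subst this
    simp at hqd
    exact absurd hqd.symm hq
  obtain ⟨z, hz⟩ : ∃ z : E, z = (κ * r / ‖q‖) • q := ⟨_, rfl⟩
  have hzn : ‖z‖ = κ * r := by
    rw [hz, norm_smul, Real.norm_of_nonneg (by positivity)]; field_simp
  have hqz : inner ℝ q z = κ * r * ‖q‖ := by
    rw [hz, inner_smul_right, real_inner_self_eq_norm_sq]; field_simp
  have hκr : κ * r ≤ r := by nlinarith
  have htz : ‖t + z - x‖ ≤ 2 * r := by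
    calc ‖t + z - x‖ = ‖(t - x) + z‖ := by congr 1; abel
      _ ≤ ‖t - x‖ + ‖z‖ := norm_add_le _ _
      _ ≤ 2 * r := by rw [hrd, hzn]; linarith
  have hb : t + z ∈ ball x r0 := by rw [mem_ball, dist_eq_norm]; linarith
  have b1 := (hr _ hb).1
  have b2 := (hr t (by rw [mem_ball, dist_eq_norm, hrd]; linarith)).1
  have b3 := hT t htT (t + z) (hr _ hb).2
  rw [add_sub_cancel_left, hzn] at b3
  rw [hrd] at b2
  have b1' : κ ^ 2 * ‖t + z - x‖ ^ 2 ≤ κ ^ 2 * (2 * r) ^ 2 := by gcongr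
  have b4 := abs_inner_op_le A z z
  rw [hzn] at b4
  have b3' : K * (κ * r) ^ 2 ≤ |K| * (κ * r) ^ 2 := by gcongr; exact le_abs_self K
  have e1 : t + z - x = (t - x) + z := by abel
  have e2 : inner ℝ q z = inner ℝ (p t) z - inner ℝ (p x) z - inner ℝ (A (t - x)) z := by
    rw [← hqd, inner_sub_left, inner_sub_left]
  have e3 : inner ℝ (A z) (t - x) = inner ℝ (A (t - x)) z := by
    rw [hS, real_inner_comm]
  rw [e1] at b1
  simp only [map_add, inner_add_left, inner_add_right] at b1
  rw [e3] at b1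
  have hn2 : ‖t - x + z‖ = ‖t + z - x‖ := by rw [e1]
  rw [hn2] at b1
  rw [abs_le] at b1 b2 b3 b4
  have : κ * r * ‖q‖ ≤ κ * r * ((|K| + ‖A‖ + 8) * κ * r) := by
    rw [← hqz, e2]
    nlinarith [norm_nonneg A, sq_nonneg (κ * r)]
  have h3 := le_of_mul_le_mul_left this (by positivity)
  refine h3.trans ?_
  gcongr

variable [FiniteDimensional ℝ E] [MeasurableSpace E] [BorelSpace E]

lemma dense_of_density (μ : Measure E) [μ.IsAddHaarMeasure] {T : Set E} {x : E} (hx : x ∈ T)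
    (h : Tendsto (fun r => μ (T ∩ closedBall x r) / μ (closedBall x r)) (𝓝[>] 0) (𝓝 1)) :
    ∀ δ > 0, ∀ᶠ y in 𝓝 x, ∃ t ∈ T, ‖t - y‖ ≤ δ * ‖y - x‖ := by
  intro δ hδ
  set n := Module.finrank ℝ E
  set κ : ℝ := (δ / (1 + δ)) ^ n with hκ
  have hκ0 : 0 < κ := by positivity
  have h1 : ENNReal.ofReal (1 - κ) < 1 := by
    rw [ENNReal.ofReal_lt_one]; linarith
  have h2 := h.eventually_const_lt h1
  obtain ⟨r0, hr0, hr⟩ := (mem_nhdsGT_iff_exists_Ioo_subset).1 h2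
  have hr0' : (0:ℝ) < r0 := hr0
  refine Metric.eventually_nhds_iff_ball.2 ⟨r0 / (1 + δ), by positivity, fun y hy => ?_⟩
  rw [mem_ball, dist_eq_norm, lt_div_iff₀ (by positivity)] at hy
  by_cases hyx : y = x
  · exact ⟨x, hx, by simp [hyx]⟩
  have hyn : 0 < ‖y - x‖ := norm_pos_iff.2 (sub_ne_zero.2 hyx)
  by_contra hcon
  push Not at hcon
  have hR := hr (show ‖y - x‖ * (1 + δ) ∈ Ioo 0 r0 from ⟨by positivity, hy⟩)
  simp only [mem_setOf_eq] at hR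
  revert hR
  rw [imp_false, not_lt]
  have hball : μ (ball (0:E) 1) ≠ 0 := (measure_ball_pos μ 0 one_pos).ne'
  have hballt : μ (ball (0:E) 1) ≠ ⊤ := measure_ball_lt_top.ne
  have hsub : closedBall y (δ * ‖y - x‖) ⊆ closedBall x (‖y - x‖ * (1 + δ)) := by
    apply closedBall_subset_closedBall'
    rw [dist_eq_norm]; nlinarith
  have hle : μ (T ∩ closedBall x (‖y - x‖ * (1 + δ))) ≤
      μ (closedBall x (‖y - x‖ * (1 + δ))) - μ (closedBall y (δ * ‖y - x‖)) := by
    rw [← measure_diff hsub measurableSet_closedBall.nullMeasurableSet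
      measure_closedBall_lt_top.ne]
    apply measure_mono
    rintro z ⟨hz1, hz2⟩
    refine ⟨hz2, fun hz3 => ?_⟩
    rw [mem_closedBall, dist_eq_norm] at hz3
    exact absurd (hcon z hz1) (not_lt.2 hz3)
  have e1 : ENNReal.ofReal (1 - κ) * μ (closedBall x (‖y - x‖ * (1 + δ))) =
      μ (closedBall x (‖y - x‖ * (1 + δ))) - μ (closedBall y (δ * ‖y - x‖)) := by
    rw [Measure.addHaar_closedBall μ x (by positivity), Measure.addHaar_closedBall μ y (by positivity)]
    rw [← ENNReal.sub_mul (fun _ _ => hballt), ← ENNReal.ofReal_sub _ (by positivity), ← mul_assoc,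
      ← ENNReal.ofReal_mul']
    · congr 2
      rw [sub_mul, hκ, one_mul, ← mul_pow]
      congr 2
      field_simp
    · positivity
  rw [← e1] at hle
  exact ENNReal.div_le_of_le_mul hle

lemma SymOp_half (A : E →L[ℝ] E) : SymOp ((1/2 : ℝ) • (A + A.adjoint)) := by
  intro x y
  simp only [ContinuousLinearMap.smul_apply, ContinuousLinearMap.add_apply, inner_smul_left,
    inner_smul_right, inner_add_left, inner_add_right, ContinuousLinearMap.adjoint_inner_left,
    ContinuousLinearMap.adjoint_inner_right, RCLike.conj_to_real]
  ring

lemma d2_local (μ : Measure E) [μ.IsAddHaarMeasure] {f : E → ℝ} {U T : Set E} {K : ℝ} {p : E → E}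
    (hT : ∀ t ∈ T, TwoSided f U K t (p t)) {z : E} {r : ℝ} (hUr : ball z (4 * r) ⊆ U)
    (hTr : T ⊆ ball z r) :
    μ {x ∈ T | ¬ ∃ A, SymOp A ∧ HasT2 f x (p x) A ∧ HasFDerivWithinAt p A T x} = 0 := by
  by_cases hK : T = ∅
  · simp [hK]
  have hLip : LipschitzOnWith (6 * |K|).toNNReal p T := by
    apply LipschitzOnWith.of_dist_le_mul
    intro x hx y hy
    by_cases hxy : x = y
    · simp [hxy]
    rw [dist_eq_norm, dist_eq_norm, Real.coe_toNNReal _ (by positivity)]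
    have hx' := hTr hx
    have hy' := hTr hy
    rw [mem_ball, dist_eq_norm] at hx' hy'
    have := (hT x hx).slope_lip (hT y hy) hxy (by
      refine Subset.trans (fun w hw => ?_) hUr
      rw [mem_closedBall, dist_eq_norm] at hw
      rw [mem_ball, dist_eq_norm]
      have e : ‖x - y‖ < 2 * r := by
        calc ‖x - y‖ = ‖(x - z) - (y - z)‖ := by congr 1; abel
          _ ≤ ‖x - z‖ + ‖y - z‖ := norm_sub_le _ _
          _ < 2 * r := by linarith
      calc ‖w - z‖ = ‖(w - y) + (y - z)‖ := by congr 1; abel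
          _ ≤ ‖w - y‖ + ‖y - z‖ := norm_add_le _ _
          _ < 4 * r := by linarith [norm_nonneg (x - z)])
    refine this.trans ?_
    gcongr
    exact le_abs_self K
  obtain ⟨g, hg, hgp⟩ := hLip.extend_finite_dimension
  have h1 : ∀ᵐ x ∂μ, DifferentiableAt ℝ g x := hg.ae_differentiableAt
  have h2 : ∀ᵐ x ∂(μ.restrict T), Tendsto (fun r => μ (T ∩ closedBall x r) / μ (closedBall x r))
    (𝓝[>] 0) (𝓝 1) := Besicovitch.ae_tendsto_measure_inter_div μ T
  have h3 := (ae_restrict_of_ae (s := T) h1).and h2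
  rw [ae_iff] at h3
  have h4 : μ (T ∩ {x | ¬ (DifferentiableAt ℝ g x ∧
    Tendsto (fun r => μ (T ∩ closedBall x r) / μ (closedBall x r)) (𝓝[>] 0) (𝓝 1))}) = 0 := by
    have := Measure.le_restrict_apply (μ := μ) T {x | ¬ (DifferentiableAt ℝ g x ∧
      Tendsto (fun r => μ (T ∩ closedBall x r) / μ (closedBall x r)) (𝓝[>] 0) (𝓝 1))}
    rw [inter_comm]
    exact le_antisymm (this.trans h3.le) bot_le
  refine measure_mono_null ?_ h4
  rintro x ⟨hxT, hx⟩
  refine ⟨hxT, fun hcon => hx ?_⟩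
  obtain ⟨hd, hdens⟩ := hcon
  have hr0 : 0 < r := by
    have := hTr hxT
    rw [mem_ball] at this
    exact lt_of_le_of_lt dist_nonneg this
  have hUx : U ∈ 𝓝 x := mem_of_superset
    (isOpen_ball.mem_nhds (ball_subset_ball (by linarith) (hTr hxT))) hUr
  have hA : HasFDerivWithinAt p (fderiv ℝ g x) T x :=
    (hd.hasFDerivAt.hasFDerivWithinAt (s := T)).congr hgp (hgp hxT)
  have h2 := hasT2_of_dense hUx hxT hT hA (dense_of_density μ hxT hdens)
  have h2' := h2.congr_symm (B := (1/2 : ℝ) • (fderiv ℝ g x + (fderiv ℝ g x).adjoint)) (by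
    intro d
    simp only [ContinuousLinearMap.smul_apply, ContinuousLinearMap.add_apply, inner_smul_left,
      inner_add_left, ContinuousLinearMap.adjoint_inner_left, RCLike.conj_to_real]
    rw [real_inner_comm]; ring)
  exact ⟨_, SymOp_half _, h2', h2'.slope_deriv hUx hT (SymOp_half _)⟩

/-- Almost everywhere second order differentiability on a two-sided touching set. -/
lemma d2_ae (μ : Measure E) [μ.IsAddHaarMeasure] {f : E → ℝ} {U T : Set E} {K : ℝ} {p : E → E}
    (hU : IsOpen U) (hTU : T ⊆ U) (hT : ∀ t ∈ T, TwoSided f U K t (p t)) :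
    μ {x ∈ T | ¬ ∃ A, SymOp A ∧ HasT2 f x (p x) A ∧ HasFDerivWithinAt p A T x} = 0 := by
  apply measure_null_of_locally_null
  rintro z ⟨hz, -⟩
  obtain ⟨r, hr, hrU⟩ := Metric.isOpen_iff.1 hU z (hTU hz)
  refine ⟨_, inter_mem_nhdsWithin _ (ball_mem_nhds z (show 0 < r / 4 by positivity)), ?_⟩
  have := d2_local μ (T := T ∩ ball z (r / 4)) (U := U) (f := f) (K := K) (p := p)
    (fun t ht => hT t ht.1) (z := z) (r := r / 4) (by rwa [mul_div_cancel₀ _ (by norm_num)])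
    inter_subset_right
  refine measure_mono_null ?_ this
  rintro x ⟨⟨hx1, hx2⟩, hx3⟩
  refine ⟨⟨hx1, hx3⟩, fun ⟨A, h1, h2, h3⟩ => hx2 ⟨A, h1, h2, ?_⟩⟩
  exact (hasFDerivWithinAt_inter (isOpen_ball.mem_nhds hx3)).1 h3

end KS2

section KS3
open Filter

variable {E : Type*} [NormedAddCommGroup E] [InnerProductSpace ℝ E]

/-- `p` is a small slope supporting `f` from below on `C` at `x`. -/
def Contact (f : E → ℝ) (C : Set E) (δ : ℝ) (x p : E) : Prop :=
  x ∈ C ∧ ‖p‖ ≤ δ ∧ ∀ y ∈ C, f x + inner ℝ p (y - x) ≤ f y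

/-- The contact set. -/
def CSet (f : E → ℝ) (C : Set E) (δ : ℝ) : Set E := {x | ∃ p, Contact f C δ x p}

lemma slope_unique {f : E → ℝ} {x p q : E} {K : ℝ}
    (h1 : ∀ᶠ y in 𝓝 x, f x + inner ℝ p (y - x) - K * ‖y - x‖ ^ 2 ≤ f y)
    (h2 : ∀ᶠ y in 𝓝 x, f y ≤ f x + inner ℝ q (y - x) + K * ‖y - x‖ ^ 2) : p = q := by
  by_contra hne
  have hn : 0 < ‖p - q‖ := norm_pos_iff.2 (sub_ne_zero.2 hne)
  have h3 : Tendsto (fun t : ℝ => x + t • (p - q)) (𝓝[>] 0) (𝓝 x) := by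
    have : Continuous (fun t : ℝ => x + t • (p - q)) := by fun_prop
    have := this.tendsto 0
    simp only [zero_smul, add_zero] at this
    exact this.mono_left nhdsWithin_le_nhds
  have h4 : ∀ᶠ t : ℝ in 𝓝[>] 0, t < 1 / (2 * |K| + 1) :=
    (Iio_mem_nhds (by positivity)) |> mem_nhdsWithin_of_mem_nhds
  obtain ⟨t, ⟨⟨ha, hb⟩, ht1⟩, ht0⟩ := ((((h3.eventually h1).and (h3.eventually h2)).and h4).and
    self_mem_nhdsWithin).exists
  have ht0 : 0 < t := ht0
  have hc := ha.trans hb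
  simp only [add_sub_cancel_left, inner_smul_right, norm_smul, Real.norm_of_nonneg ht0.le] at hc
  have e : inner ℝ p (p - q) - inner ℝ q (p - q) = ‖p - q‖ ^ 2 := by
    rw [← inner_sub_left, real_inner_self_eq_norm_sq]
  rw [lt_div_iff₀ (by positivity)] at ht1
  have h5 : t * ‖p - q‖ ^ 2 ≤ t * ‖p - q‖ ^ 2 * (t * (2 * |K|)) := by
    rw [← e]
    have : K * (t * ‖p - q‖) ^ 2 ≤ |K| * (t * ‖p - q‖) ^ 2 := by gcongr; exact le_abs_self K
    rw [e]
    have e' : t * inner ℝ p (p - q) - t * inner ℝ q (p - q) = t * ‖p - q‖ ^ 2 := by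
      rw [← mul_sub, e]
    nlinarith
  have h6 : 0 < t * ‖p - q‖ ^ 2 := by positivity
  nlinarith

lemma HasT2.lower {f : E → ℝ} {x p : E} {A : E →L[ℝ] E} (h : HasT2 f x p A) :
    ∀ᶠ y in 𝓝 x, f x + inner ℝ p (y - x) - (‖A‖ + 1) * ‖y - x‖ ^ 2 ≤ f y := by
  filter_upwards [h 1 one_pos] with y hy
  have := abs_inner_op_le A (y - x) (y - x)
  rw [abs_le] at this hy
  nlinarith [norm_nonneg A, sq_nonneg ‖y - x‖]

lemma HasT2.upper {f : E → ℝ} {x p : E} {A : E →L[ℝ] E} (h : HasT2 f x p A) :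
    ∀ᶠ y in 𝓝 x, f y ≤ f x + inner ℝ p (y - x) + (‖A‖ + 1) * ‖y - x‖ ^ 2 := by
  filter_upwards [h 1 one_pos] with y hy
  have := abs_inner_op_le A (y - x) (y - x)
  rw [abs_le] at this hy
  nlinarith [norm_nonneg A, sq_nonneg ‖y - x‖]

lemma Contact.mem_ball {f : E → ℝ} {z0 : E} {R δ : ℝ} {x1 : E} (hx1 : x1 ∈ closedBall z0 R)
    (hgap : ∀ y ∈ sphere z0 R, f x1 + 2 * R * δ < f y) {x p : E} (hδ : 0 < δ)
    (h : Contact f (closedBall z0 R) δ x p) : x ∈ ball z0 R := by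
  rcases (mem_closedBall.1 h.1).lt_or_eq with h' | h'
  · exact h'
  exfalso
  have h1 := hgap x h'
  have h2 := h.2.2 x1 hx1
  have h3 := abs_real_inner_le_norm p (x1 - x)
  have h4 : ‖x1 - x‖ ≤ 2 * R := by
    rw [← dist_eq_norm]
    refine (dist_triangle_right x1 x z0).trans ?_
    have := mem_closedBall.1 hx1
    linarith
  have h5 : ‖p‖ * ‖x1 - x‖ ≤ δ * (2 * R) := by
    apply mul_le_mul h.2.1 h4 (norm_nonneg _) hδ.le
  rw [abs_le] at h3
  linarith

variable [FiniteDimensional ℝ E]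

lemma CSet_compact {f : E → ℝ} {z0 : E} {R δ : ℝ} (hf : ContinuousOn f (closedBall z0 R)) :
    IsCompact (CSet f (closedBall z0 R) δ) := by
  have : ProperSpace E := FiniteDimensional.proper_real E
  set D : Set (E × E) := closedBall z0 R ×ˢ closedBall 0 δ with hD
  have hDc : IsCompact D := (isCompact_closedBall z0 R).prod (isCompact_closedBall 0 δ)
  set S : Set (E × E) := {w | w ∈ D ∧ ∀ y ∈ closedBall z0 R, f w.1 + inner ℝ w.2 (y - w.1) ≤ f y}
    with hS
  have hSc : IsCompact S := by
    refine hDc.of_isClosed_subset ?_ (fun w hw => hw.1)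
    have : S = D ∩ ⋂ y ∈ closedBall z0 R, (D ∩ (fun w : E × E => f w.1 + inner ℝ w.2 (y - w.1)) ⁻¹'
        Iic (f y)) := by
      ext w
      simp only [hS, mem_inter_iff, mem_iInter, mem_preimage, mem_Iic]
      constructor
      · rintro ⟨h1, h2⟩; exact ⟨h1, fun y hy => ⟨h1, h2 y hy⟩⟩
      · rintro ⟨h1, h2⟩; exact ⟨h1, fun y hy => (h2 y hy).2⟩
    rw [this]
    refine hDc.isClosed.inter (isClosed_biInter fun y hy => ?_)
    refine ContinuousOn.preimage_isClosed_of_isClosed ?_ hDc.isClosed isClosed_Iic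
    refine ContinuousOn.add (hf.comp continuousOn_fst (fun w hw => hw.1)) ?_
    fun_prop
  have : CSet f (closedBall z0 R) δ = Prod.fst '' S := by
    ext x
    constructor
    · rintro ⟨p, h1, h2, h3⟩
      exact ⟨(x, p), ⟨⟨h1, by simpa using h2⟩, h3⟩, rfl⟩
    · rintro ⟨⟨x', p⟩, ⟨⟨h1, h2⟩, h3⟩, rfl⟩
      exact ⟨p, h1, by simpa using h2, h3⟩
  rw [this]
  exact hSc.image continuous_fst

variable [MeasurableSpace E] [BorelSpace E]

lemma lipschitzOn_null (μ : Measure E) [μ.IsAddHaarMeasure] {T N : Set E} {p : E → E} {k : NNReal}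
    (h : LipschitzOnWith k p T) (hN : N ⊆ T) (h0 : μ N = 0) : μ (p '' N) = 0 := by
  have h1 : (Measure.hausdorffMeasure (Module.finrank ℝ E) : Measure E) N = 0 :=
    Measure.absolutelyContinuous_isAddHaarMeasure _ μ h0
  have h2 := (h.mono hN).hausdorffMeasure_image_le (d := (Module.finrank ℝ E : ℝ)) (by positivity)
  rw [h1, mul_zero] at h2
  exact Measure.absolutelyContinuous_isAddHaarMeasure μ
    (Measure.hausdorffMeasure (Module.finrank ℝ E) : Measure E) (le_antisymm h2 bot_le)

/-- The Aleksandrov--Bakelman--Pucci covering argument. -/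
lemma abp_main (μ : Measure E) [μ.IsAddHaarMeasure] {f : E → ℝ} {z0 : E} {R δ K : ℝ}
    (hδ : 0 < δ) (hK : 0 ≤ K) (hf : ContinuousOn f (closedBall z0 R))
    {x1 : E} (hx1 : x1 ∈ closedBall z0 R)
    (hgap : ∀ y ∈ sphere z0 R, f x1 + 2 * R * δ < f y)
    (hup : ∀ x q, Contact f (closedBall z0 R) δ x q → ∃ p', ∀ y ∈ closedBall z0 R,
      f y ≤ f x + inner ℝ p' (y - x) + K * ‖y - x‖ ^ 2) :
    μ (CSet f (closedBall z0 R) δ) ≠ 0 ∧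
    ∀ D : ℝ, μ {x ∈ CSet f (closedBall z0 R) δ | ¬ ∃ p A, SymOp A ∧ HasT2 f x p A ∧
      |A.det| ≤ D} = 0 →
      μ (ball 0 δ) ≤ ENNReal.ofReal D * μ (CSet f (closedBall z0 R) δ) := by
  have : ProperSpace E := FiniteDimensional.proper_real E
  set C := closedBall z0 R with hC
  set T := CSet f C δ with hT
  have hTc : IsCompact T := CSet_compact hf
  have hTb : T ⊆ ball z0 R := fun x ⟨p, hp⟩ => hp.mem_ball hx1 hgap hδ
  choose! p hp using (fun x (hx : x ∈ T) => hx : ∀ x ∈ T, ∃ p, Contact f C δ x p)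
  have hnhds : ∀ x ∈ T, C ∈ 𝓝 x := fun x hx =>
    mem_of_superset (isOpen_ball.mem_nhds (hTb hx)) ball_subset_closedBall
  have huniq : ∀ x q, Contact f C δ x q → ∀ y ∈ C, f y ≤ f x + inner ℝ q (y - x)
      + K * ‖y - x‖ ^ 2 := by
    intro x q hq
    obtain ⟨p', hp'⟩ := hup x q hq
    have : q = p' := by
      apply slope_unique (f := f) (x := x) (K := K)
      · filter_upwards [hnhds x ⟨q, hq⟩] with y hy
        have := hq.2.2 y hy
        have : 0 ≤ K * ‖y - x‖ ^ 2 := by positivity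
        linarith
      · filter_upwards [hnhds x ⟨q, hq⟩] with y hy using hp' y hy
    rw [this]; exact hp'
  have hpu : ∀ x q, Contact f C δ x q → q = p x := by
    intro x q hq
    have hx : x ∈ T := ⟨q, hq⟩
    apply slope_unique (f := f) (x := x) (K := K)
    · filter_upwards [hnhds x hx] with y hy
      have := hq.2.2 y hy
      have : 0 ≤ K * ‖y - x‖ ^ 2 := by positivity
      linarith
    · filter_upwards [hnhds x hx] with y hy using huniq x (p x) (hp x hx) y hy
  have hts : ∀ x ∈ T, TwoSided f C K x (p x) := by
    intro x hx y hy
    have h1 := (hp x hx).2.2 y hy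
    have h2 := huniq x (p x) (hp x hx) y hy
    have : 0 ≤ K * ‖y - x‖ ^ 2 := by positivity
    rw [abs_le]; constructor <;> linarith
  obtain ⟨R', hR', hTR'⟩ := exists_lt_subset_ball hTc.isClosed hTb
  have hρ : 0 < R - R' := by linarith
  have hLip : LipschitzOnWith (6 * K + 2 * δ / (R - R')).toNNReal p T := by
    apply LipschitzOnWith.of_dist_le_mul
    intro x hx y hy
    rw [dist_eq_norm, dist_eq_norm, Real.coe_toNNReal _ (by positivity)]
    by_cases hxy : x = y
    · simp [hxy]
    by_cases hfar : ‖x - y‖ ≤ R - R'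
    · have := (hts x hx).slope_lip (hts y hy) hxy (by
        apply closedBall_subset_closedBall'
        have := mem_ball.1 (hTR' hy)
        linarith)
      refine this.trans ?_
      gcongr
      have : 0 ≤ 2 * δ / (R - R') := by positivity
      linarith
    · push Not at hfar
      have h1 : ‖p x - p y‖ ≤ 2 * δ := by
        refine (norm_sub_le _ _).trans ?_
        linarith [(hp x hx).2.1, (hp y hy).2.1]
      have h2 : 2 * δ ≤ 2 * δ / (R - R') * ‖x - y‖ := by
        rw [div_mul_eq_mul_div, le_div_iff₀ hρ]
        gcongr
      have : 0 ≤ 6 * K * ‖x - y‖ := by positivity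
      linarith
  have hcover : ball (0:E) δ ⊆ p '' T := by
    intro q hq
    rw [mem_ball_zero_iff] at hq
    obtain ⟨x, hx, hmin⟩ := (isCompact_closedBall z0 R).exists_isMinOn ⟨x1, hx1⟩
      (f := fun y => f y - inner ℝ q y) (hf.sub (by fun_prop))
    have hcon : Contact f C δ x q := by
      refine ⟨hx, hq.le, fun y hy => ?_⟩
      have := hmin hy
      simp only [mem_ofPred_eq] at this
      rw [inner_sub_right]; linarith
    exact ⟨x, ⟨q, hcon⟩, (hpu x q hcon).symm⟩
  have hbpos : 0 < μ (ball (0:E) δ) := measure_ball_pos μ 0 hδ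
  refine ⟨fun h0 => ?_, fun D hD => ?_⟩
  · have := lipschitzOn_null μ hLip Subset.rfl h0
    exact absurd (measure_mono_null hcover this) hbpos.ne'
  set N := {x ∈ T | ¬ ∃ p A, SymOp A ∧ HasT2 f x p A ∧ |A.det| ≤ D} with hN
  set T' := T \ toMeasurable μ N with hT'
  have hT'm : MeasurableSet T' := hTc.isClosed.measurableSet.diff (measurableSet_toMeasurable _ _)
  have hgood : ∀ x ∈ T', ∃ A : E →L[ℝ] E, |A.det| ≤ D ∧ HasFDerivWithinAt p A T x := by
    rintro x ⟨hx1, hx2⟩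
    have hx3 : x ∉ N := fun h => hx2 (subset_toMeasurable _ _ h)
    have hx4 : ∃ p A, SymOp A ∧ HasT2 f x p A ∧ |A.det| ≤ D := by
      by_contra hcon; exact hx3 ⟨hx1, hcon⟩
    obtain ⟨q, A, hA, h2, hdet⟩ := hx4
    have : p x = q := by
      apply slope_unique (f := f) (x := x) (K := ‖A‖ + 1)
      · filter_upwards [hnhds x hx1] with y hy
        have := (hp x hx1).2.2 y hy
        have : 0 ≤ (‖A‖ + 1) * ‖y - x‖ ^ 2 := by positivity
        linarith
      · exact h2.upper
    rw [← this] at h2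
    exact ⟨A, hdet, h2.slope_deriv (hnhds x hx1) hts hA⟩
  choose! A hA1 hA2 using hgood
  have h1 := addHaar_image_le_lintegral_abs_det_fderiv μ hT'm
    (fun x hx => (hA2 x hx).mono diff_subset)
  have h2 : ∫⁻ x in T', ENNReal.ofReal |(A x).det| ∂μ ≤ ENNReal.ofReal D * μ T' := by
    rw [← setLIntegral_const]
    apply setLIntegral_mono' hT'm
    intro x hx
    exact ENNReal.ofReal_le_ofReal (hA1 x hx)
  have h3 : μ (p '' (T ∩ toMeasurable μ N)) = 0 := by
    apply lipschitzOn_null μ hLip inter_subset_left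
    exact measure_mono_null inter_subset_right (by rw [measure_toMeasurable, hD])
  calc μ (ball 0 δ) ≤ μ (p '' T' ∪ p '' (T ∩ toMeasurable μ N)) := by
        apply measure_mono
        rw [← image_union, hT', diff_union_inter]
        exact hcover
    _ ≤ μ (p '' T') + μ (p '' (T ∩ toMeasurable μ N)) := measure_union_le _ _
    _ ≤ ENNReal.ofReal D * μ T' := by rw [h3, add_zero]; exact h1.trans h2
    _ ≤ ENNReal.ofReal D * μ T := by gcongr; exact diff_subset

/-- trace -/
def trO (A : E →L[ℝ] E) : ℝ := LinearMap.trace ℝ E (A : E →ₗ[ℝ] E)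

lemma abs_det_le {A : E →L[ℝ] E} (hA : SymOp A) (hpos : ∀ x, 0 ≤ inner ℝ (A x) x) {c : ℝ}
    (hc : trO A ≤ c) : |A.det| ≤ c ^ (Module.finrank ℝ E) := by
  have hs : (A : E →ₗ[ℝ] E).IsSymmetric := fun x y => hA x y
  have h1 := hs.det_eq_prod_eigenvalues rfl
  have h2 := hs.trace_eq_sum_eigenvalues rfl
  have h3 : ∀ i, 0 ≤ hs.eigenvalues rfl i := by
    intro i
    have := hpos (hs.eigenvectorBasis rfl i)
    have h4 := hs.apply_eigenvectorBasis rfl i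
    simp only [ContinuousLinearMap.coe_coe] at h4
    rw [h4, inner_smul_left, real_inner_self_eq_norm_sq, (hs.eigenvectorBasis rfl).orthonormal.1 i]
      at this
    simpa using this
  have h5 : ∀ i, hs.eigenvalues rfl i ≤ c := by
    intro i
    refine le_trans ?_ hc
    rw [trO, h2]
    exact Finset.single_le_sum (f := hs.eigenvalues rfl) (fun j _ => h3 j) (Finset.mem_univ i)
  change |LinearMap.det (A : E →ₗ[ℝ] E)| ≤ _
  rw [h1]
  simp only [RCLike.ofReal_real_eq_id, id]
  rw [Finset.abs_prod]
  calc ∏ i, |hs.eigenvalues rfl i| ≤ ∏ i : Fin (Module.finrank ℝ E), c := by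
        apply Finset.prod_le_prod
        · intro i _; positivity
        · intro i _; rw [abs_of_nonneg (h3 i)]; exact h5 i
    _ = _ := by simp

end KS3

section KS4
open Filter
set_option linter.unusedSectionVars false

variable {E : Type*} [NormedAddCommGroup E] [InnerProductSpace ℝ E]

/-- internal notion of viscosity subsolution of the differential constraint `G` -/
def SubV (G : E → (E →L[ℝ] E) → Prop) (U : Set E) (u : E → ℝ) : Prop :=
  ∀ x ∈ U, ∀ p A, SymOp A →
    (∀ᶠ z in 𝓝 x, u z ≤ u x + inner ℝ p (z - x) + (1/2) * inner ℝ (A (z - x)) (z - x)) → G p A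

/-- sup-convolution over a compact set -/
def supConv (a : E → ℝ) (C : Set E) (ε : ℝ) (x : E) : ℝ :=
  sSup ((fun y => a y - ‖x - y‖ ^ 2 / (2 * ε)) '' C)

lemma supConv_exists {a : E → ℝ} {C : Set E} (hC : IsCompact C) (hne : C.Nonempty)
    (ha : ContinuousOn a C) (ε : ℝ) (x : E) :
    ∃ y ∈ C, supConv a C ε x = a y - ‖x - y‖ ^ 2 / (2 * ε) := by
  obtain ⟨y, hy, h1, h2⟩ := hC.exists_sSup_image_eq_and_ge hne
    (f := fun y => a y - ‖x - y‖ ^ 2 / (2 * ε)) (ha.sub (by fun_prop))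
  exact ⟨y, hy, h1⟩

lemma le_supConv {a : E → ℝ} {C : Set E} (hC : IsCompact C)
    (ha : ContinuousOn a C) (ε : ℝ) (x : E) {y : E} (hy : y ∈ C) :
    a y - ‖x - y‖ ^ 2 / (2 * ε) ≤ supConv a C ε x := by
  apply le_csSup
  · exact (hC.image_of_continuousOn (f := fun y => a y - ‖x - y‖ ^ 2 / (2 * ε))
      (ha.sub (by fun_prop))).bddAbove
  · exact ⟨y, hy, rfl⟩

lemma self_le_supConv {a : E → ℝ} {C : Set E} (hC : IsCompact C)
    (ha : ContinuousOn a C) (ε : ℝ) {x : E} (hx : x ∈ C) : a x ≤ supConv a C ε x := by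
  have := le_supConv hC ha ε x hx
  simpa using this

lemma supConv_lower {a : E → ℝ} {C : Set E} (hC : IsCompact C)
    (ha : ContinuousOn a C) {ε : ℝ} (hε : 0 < ε) {x y : E} (hy : y ∈ C)
    (hxy : supConv a C ε x = a y - ‖x - y‖ ^ 2 / (2 * ε)) (z : E) :
    supConv a C ε x + inner ℝ ((1 / ε) • (y - x)) (z - x) - 1 / (2 * ε) * ‖z - x‖ ^ 2
      ≤ supConv a C ε z := by
  refine le_trans (le_of_eq ?_) (le_supConv hC ha ε z hy)
  rw [hxy]
  have e : ‖z - y‖ ^ 2 = ‖z - x‖ ^ 2 - 2 * inner ℝ (y - x) (z - x) + ‖x - y‖ ^ 2 := by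
    have : z - y = (z - x) - (y - x) := by abel
    rw [this, norm_sub_sq_real, norm_sub_rev x y, real_inner_comm]
  rw [e, inner_smul_left]
  simp only [RCLike.conj_to_real]
  field_simp
  ring

lemma supConv_continuous {a : E → ℝ} {C : Set E} (hC : IsCompact C) (hne : C.Nonempty)
    (ha : ContinuousOn a C) {ε : ℝ} (hε : 0 < ε) : Continuous (supConv a C ε) := by
  obtain ⟨ρ, hρ⟩ := hC.isBounded.exists_norm_le
  have key : ∀ x z, supConv a C ε x - supConv a C ε z ≤
      (1 / ε) * (ρ + ‖x‖) * ‖z - x‖ + 1 / (2 * ε) * ‖z - x‖ ^ 2 := by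
    intro x z
    obtain ⟨y, hy, hxy⟩ := supConv_exists hC hne ha ε x
    have h1 := supConv_lower hC ha hε hy hxy z
    have h2 := abs_real_inner_le_norm ((1 / ε) • (y - x)) (z - x)
    rw [norm_smul, Real.norm_of_nonneg (by positivity)] at h2
    have h3 : ‖y - x‖ ≤ ρ + ‖x‖ := (norm_sub_le _ _).trans (by linarith [hρ y hy])
    have h4 : 1 / ε * ‖y - x‖ * ‖z - x‖ ≤ 1 / ε * (ρ + ‖x‖) * ‖z - x‖ := by gcongr
    rw [abs_le] at h2
    linarith
  rw [continuous_iff_continuousAt]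
  intro x
  rw [ContinuousAt, tendsto_iff_dist_tendsto_zero]
  have hlim : Tendsto (fun z => (1 / ε) * (|ρ| + ‖x‖ + ‖z‖) * ‖z - x‖ + 1 / (2 * ε) * ‖z - x‖ ^ 2)
      (𝓝 x) (𝓝 0) := by
    have : Continuous (fun z => (1 / ε) * (|ρ| + ‖x‖ + ‖z‖) * ‖z - x‖
      + 1 / (2 * ε) * ‖z - x‖ ^ 2) := by fun_prop
    have := this.tendsto x
    simpa using this
  refine squeeze_zero (fun _ => dist_nonneg) (fun z => ?_) hlim
  rw [Real.dist_eq, abs_le]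
  have k1 := key x z
  have k2 := key z x
  rw [norm_sub_rev x z] at k2
  have g1 : 1 / ε * (ρ + ‖x‖) * ‖z - x‖ ≤ 1 / ε * (|ρ| + ‖x‖ + ‖z‖) * ‖z - x‖ := by
    have : ρ + ‖x‖ ≤ |ρ| + ‖x‖ + ‖z‖ := by linarith [le_abs_self ρ, norm_nonneg z]
    gcongr 1 / ε * ?_ * _
  have g2 : 1 / ε * (ρ + ‖z‖) * ‖z - x‖ ≤ 1 / ε * (|ρ| + ‖x‖ + ‖z‖) * ‖z - x‖ := by
    have : ρ + ‖z‖ ≤ |ρ| + ‖x‖ + ‖z‖ := by linarith [le_abs_self ρ, norm_nonneg x]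
    gcongr 1 / ε * ?_ * _
  constructor <;> linarith

lemma supConv_close {a : E → ℝ} {C : Set E} (hC : IsCompact C)
    (ha : ContinuousOn a C) {τ : ℝ} (hτ : 0 < τ) :
    ∃ ε0 > 0, ∀ ε, 0 < ε → ε < ε0 → ∀ x ∈ C, ∀ y ∈ C, a x ≤ a y - ‖x - y‖ ^ 2 / (2 * ε) →
      ‖x - y‖ < τ ∧ a y < a x + τ := by
  obtain ⟨M, hM⟩ := (hC.image_of_continuousOn ha).isBounded.exists_norm_le
  have hu := hC.uniformContinuousOn_of_continuous ha
  rw [Metric.uniformContinuousOn_iff] at hu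
  obtain ⟨d, hd, hu⟩ := hu τ hτ
  have hm : 0 < min d τ := lt_min hd hτ
  refine ⟨(min d τ) ^ 2 / (4 * |M| + 4), by positivity, fun ε hε hε0 x hx y hy h => ?_⟩
  have h1 : |a x| ≤ M := hM _ ⟨x, hx, rfl⟩
  have h2 : |a y| ≤ M := hM _ ⟨y, hy, rfl⟩
  have hM0 : 0 ≤ M := (abs_nonneg _).trans h1
  rw [abs_le] at h1 h2
  rw [abs_of_nonneg hM0, lt_div_iff₀ (by positivity)] at hε0
  have h3 : ‖x - y‖ ^ 2 / (2 * ε) ≤ 2 * M := by linarith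
  rw [div_le_iff₀ (by positivity)] at h3
  have h4 : ‖x - y‖ ^ 2 < (min d τ) ^ 2 := by nlinarith
  have h5 : ‖x - y‖ < min d τ := lt_of_pow_lt_pow_left₀ 2 hm.le h4
  refine ⟨h5.trans_le (min_le_right _ _), ?_⟩
  have := hu x hx y hy (by rw [dist_eq_norm]; exact h5.trans_le (min_le_left _ _))
  rw [Real.dist_eq, abs_lt] at this
  linarith

lemma supConv_transfer {a : E → ℝ} {C : Set E} (hC : IsCompact C)
    (ha : ContinuousOn a C) {ε : ℝ} {x y : E}
    (hxy : supConv a C ε x = a y - ‖x - y‖ ^ 2 / (2 * ε)) (hCy : C ∈ 𝓝 y) {p : E} {A : E →L[ℝ] E}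
    (h : ∀ᶠ z in 𝓝 x, supConv a C ε z ≤ supConv a C ε x + inner ℝ p (z - x)
      + (1/2) * inner ℝ (A (z - x)) (z - x)) :
    ∀ᶠ z in 𝓝 y, a z ≤ a y + inner ℝ p (z - y) + (1/2) * inner ℝ (A (z - y)) (z - y) := by
  have ht : Tendsto (fun w => w + (x - y)) (𝓝 y) (𝓝 x) := by
    have : Continuous (fun w => w + (x - y)) := by fun_prop
    have := this.tendsto y
    simpa using this
  filter_upwards [ht.eventually h, hCy] with w hw hwC
  have h1 := le_supConv hC ha ε (w + (x - y)) hwC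
  have e1 : w + (x - y) - w = x - y := by abel
  have e2 : w + (x - y) - x = w - y := by abel
  rw [e1] at h1
  rw [e2, hxy] at hw
  linarith

lemma HasT2.touch_above {f : E → ℝ} {x p : E} {A : E →L[ℝ] E} (h : HasT2 f x p A) {δ : ℝ}
    (hδ : 0 < δ) : ∀ᶠ z in 𝓝 x, f z ≤ f x + inner ℝ p (z - x)
      + (1/2) * inner ℝ ((A + δ • ContinuousLinearMap.id ℝ E) (z - x)) (z - x) := by
  filter_upwards [h (δ / 2) (by positivity)] with z hz
  rw [abs_le] at hz
  simp only [add_apply, smul_apply, ContinuousLinearMap.id_apply, inner_add_left, inner_smul_left,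
    real_inner_self_eq_norm_sq, RCLike.conj_to_real]
  linarith

lemma SymOp.add {A B : E →L[ℝ] E} (hA : SymOp A) (hB : SymOp B) : SymOp (A + B) := by
  intro x y
  simp only [add_apply, inner_add_left, inner_add_right]
  rw [hA, hB]

lemma SymOp.smul {A : E →L[ℝ] E} (hA : SymOp A) (c : ℝ) : SymOp (c • A) := by
  intro x y
  simp only [smul_apply, inner_smul_left, inner_smul_right, RCLike.conj_to_real]
  rw [hA]

lemma SymOp.id : SymOp (ContinuousLinearMap.id ℝ E) := fun _ _ => rfl

lemma SymOp.zero : SymOp (0 : E →L[ℝ] E) := fun _ _ => by simp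

lemma SymOp.neg {A : E →L[ℝ] E} (hA : SymOp A) : SymOp (-A) := by
  have := hA.smul (-1); simpa using this

lemma SymOp.sub {A B : E →L[ℝ] E} (hA : SymOp A) (hB : SymOp B) : SymOp (A - B) := by
  rw [sub_eq_add_neg]; exact hA.add hB.neg

lemma SubV.supConv {G : E → (E →L[ℝ] E) → Prop} {U : Set E} {a : E → ℝ} (hS : SubV G U a)
    {C : Set E} (hC : IsCompact C) (ha : ContinuousOn a C) {ε : ℝ} {x y : E}
    (hxy : supConv a C ε x = a y - ‖x - y‖ ^ 2 / (2 * ε)) (hCy : C ∈ 𝓝 y) (hy : y ∈ U)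
    {p : E} {A : E →L[ℝ] E} (hA : SymOp A) (h : HasT2 (supConv a C ε) x p A) {δ : ℝ} (hδ : 0 < δ) :
    G p (A + δ • ContinuousLinearMap.id ℝ E) :=
  hS y hy p _ (hA.add (SymOp.id.smul δ)) (supConv_transfer hC ha hxy hCy (h.touch_above hδ))

end KS4

section KS5
open Filter
set_option linter.unusedSectionVars false

variable {E : Type*} [NormedAddCommGroup E] [InnerProductSpace ℝ E] [FiniteDimensional ℝ E]

/-- positive semidefinite -/
def PosO (A : E →L[ℝ] E) : Prop := ∀ x, 0 ≤ inner ℝ (A x) x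

lemma trO_add (A B : E →L[ℝ] E) : trO (A + B) = trO A + trO B := by
  simp [trO]

lemma trO_smul (c : ℝ) (A : E →L[ℝ] E) : trO (c • A) = c * trO A := by
  simp [trO]

lemma trO_id : trO (ContinuousLinearMap.id ℝ E) = Module.finrank ℝ E := by
  simp [trO]

lemma trO_eq_sum (A : E →L[ℝ] E) :
    trO A = ∑ i, inner ℝ (A (stdOrthonormalBasis ℝ E i)) (stdOrthonormalBasis ℝ E i) := by
  rw [trO, LinearMap.trace_eq_sum_inner _ (stdOrthonormalBasis ℝ E)]
  refine Finset.sum_congr rfl fun i _ => ?_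
  rw [real_inner_comm]; rfl

lemma PosO.trO_nonneg {A : E →L[ℝ] E} (h : PosO A) : 0 ≤ trO A := by
  rw [trO_eq_sum]; exact Finset.sum_nonneg fun i _ => h _

/-- rank one operator -/
def rk1 (x : E) : E →L[ℝ] E := (innerSL ℝ x).smulRight x

lemma rk1_apply (x d : E) : rk1 x d = inner ℝ x d • x := by simp [rk1]

lemma rk1_inner (x d : E) : inner ℝ (rk1 x d) d = inner ℝ x d ^ 2 := by
  rw [rk1_apply, inner_smul_left]; simp [sq]

lemma rk1_sym (x : E) : SymOp (rk1 x) := by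
  intro d e
  rw [rk1_apply, rk1_apply, inner_smul_left, inner_smul_right, real_inner_comm d x]; simp [mul_comm]

lemma trO_rk1 (x : E) : trO (rk1 x) = ‖x‖ ^ 2 := by
  rw [trO_eq_sum]
  simp only [rk1_inner]
  have := (stdOrthonormalBasis ℝ E).sum_sq_norm_inner_left x
  simpa [sq_abs] using this

/-- Trace dominates one diagonal entry. -/
lemma PosO.le_trO {A : E →L[ℝ] E} (h : PosO A) {e : E} (he : ‖e‖ = 1) :
    inner ℝ (A e) e ≤ trO A := by
  classical
  have hon : Orthonormal ℝ (Subtype.val : ({e} : Set E) → E) := by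
    refine ⟨fun i => ?_, fun i j hij => ?_⟩
    · have := i.2; simp only [mem_singleton_iff] at this; rw [this, he]
    · exact absurd (Subtype.ext (i.2.trans j.2.symm)) hij
  obtain ⟨u, b, hu, hb⟩ := hon.exists_orthonormalBasis_extension
  have h1 : trO A = ∑ i, inner ℝ (A (b i)) (b i) := by
    rw [trO, LinearMap.trace_eq_sum_inner _ b]
    refine Finset.sum_congr rfl fun i _ => ?_
    rw [real_inner_comm]; rfl
  have hmem : e ∈ u := hu (mem_singleton e)
  rw [h1]
  have h2 := Finset.single_le_sum (f := fun i => inner ℝ (A (b i)) (b i)) (s := Finset.univ)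
    (fun i _ => h _) (Finset.mem_univ (⟨e, hmem⟩ : u))
  simpa [hb] using h2

/-- Ellipticity for operators on `E`. -/
def Ell (lam Lam : ℝ) (F : (E →L[ℝ] E) → ℝ) : Prop :=
  ∀ A B, SymOp A → SymOp B → PosO B →
    lam * trO B ≤ F A - F (A + B) ∧ F A - F (A + B) ≤ Lam * trO B

/-- dual operator -/
def dualF (F : (E →L[ℝ] E) → ℝ) (A : E →L[ℝ] E) : ℝ := - F (-A)

lemma Ell.dual {lam Lam : ℝ} {F : (E →L[ℝ] E) → ℝ} (h : Ell lam Lam F) : Ell lam Lam (dualF F) := by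
  intro A B hA hB hp
  have := h (-(A + B)) B (hA.add hB).neg hB hp
  have e : -(A + B) + B = -A := by abel
  rw [e] at this
  simp only [dualF]
  constructor <;> linarith

lemma dualF_dualF (F : (E →L[ℝ] E) → ℝ) : dualF (dualF F) = F := by
  funext A; simp [dualF]

lemma Ell.lower {lam Lam : ℝ} {F : (E →L[ℝ] E) → ℝ} (h : Ell lam Lam F) {X P N : E →L[ℝ] E}
    (hX : SymOp X) (hP : SymOp P) (hN : SymOp N) (pP : PosO P) (pN : PosO N) :
    lam * trO P - Lam * trO N ≤ F X - F (X + P - N) := by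
  have h1 := h X P hX hP pP
  have h2 := h (X + P - N) N ((hX.add hP).sub hN) hN pN
  rw [sub_add_cancel] at h2
  linarith

lemma PosO.id : PosO (ContinuousLinearMap.id ℝ E) := fun x => by simp

lemma PosO.smul {A : E →L[ℝ] E} (h : PosO A) {c : ℝ} (hc : 0 ≤ c) : PosO (c • A) := by
  intro x
  simp only [smul_apply, inner_smul_left, RCLike.conj_to_real]
  exact mul_nonneg hc (h x)

lemma PosO.add {A B : E →L[ℝ] E} (h : PosO A) (h' : PosO B) : PosO (A + B) := by
  intro x
  simp only [add_apply, inner_add_left]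
  exact add_nonneg (h x) (h' x)

lemma HasT2.add {f g : E → ℝ} {x p q : E} {A B : E →L[ℝ] E} (hf : HasT2 f x p A)
    (hg : HasT2 g x q B) : HasT2 (fun y => f y + g y) x (p + q) (A + B) := by
  intro ε hε
  filter_upwards [hf (ε / 2) (by positivity), hg (ε / 2) (by positivity)] with y h1 h2
  simp only [add_apply, inner_add_left]
  rw [abs_le] at *
  constructor <;> linarith

lemma HasT2.smul {f : E → ℝ} {x p : E} {A : E →L[ℝ] E} (hf : HasT2 f x p A) (c : ℝ) :
    HasT2 (fun y => c * f y) x (c • p) (c • A) := by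
  intro ε hε
  filter_upwards [hf (ε / (|c| + 1)) (by positivity)] with y h1
  simp only [smul_apply, inner_smul_left, RCLike.conj_to_real]
  have e : c * f y - c * f x - c * inner ℝ p (y - x) - 1 / 2 * (c * inner ℝ (A (y - x)) (y - x))
    = c * (f y - f x - inner ℝ p (y - x) - 1 / 2 * inner ℝ (A (y - x)) (y - x)) := by ring
  rw [e, abs_mul]
  have h2 : |c| * (ε / (|c| + 1)) ≤ ε := by
    rw [← mul_div_assoc, div_le_iff₀ (by positivity)]; nlinarith [abs_nonneg c]
  calc _ ≤ |c| * (ε / (|c| + 1) * ‖y - x‖ ^ 2) := by gcongr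
    _ = |c| * (ε / (|c| + 1)) * ‖y - x‖ ^ 2 := by ring
    _ ≤ _ := by gcongr

/-- one-dimensional version of the second order condition -/
lemma HasT2.line {f : E → ℝ} {x p : E} {A : E →L[ℝ] E} (hf : HasT2 f x p A) (d : E) :
    ∀ ε > 0, ∀ᶠ t : ℝ in 𝓝 0, |f (x + t • d) - f x - t * inner ℝ p d
      - (1/2) * t ^ 2 * inner ℝ (A d) d| ≤ ε * t ^ 2 := by
  intro ε hε
  have ht : Tendsto (fun t : ℝ => x + t • d) (𝓝 0) (𝓝 x) := by
    have : Continuous (fun t : ℝ => x + t • d) := by fun_prop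
    simpa using this.tendsto 0
  filter_upwards [ht.eventually (hf (ε / (‖d‖ ^ 2 + 1)) (by positivity))] with t h
  simp only [add_sub_cancel_left, map_smul, inner_smul_left, inner_smul_right,
    RCLike.conj_to_real, norm_smul, Real.norm_eq_abs, mul_pow, sq_abs] at h
  have e : f (x + t • d) - f x - t * inner ℝ p d - (1/2) * t ^ 2 * inner ℝ (A d) d =
    f (x + t • d) - f x - t * inner ℝ p d - 1 / 2 * (t * (t * inner ℝ (A d) d)) := by ring
  rw [e]
  refine h.trans ?_
  have h2 : ε / (‖d‖ ^ 2 + 1) * ‖d‖ ^ 2 ≤ ε := by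
    rw [div_mul_eq_mul_div, div_le_iff₀ (by positivity)]; nlinarith [sq_nonneg ‖d‖]
  calc _ = ε / (‖d‖ ^ 2 + 1) * ‖d‖ ^ 2 * t ^ 2 := by ring
    _ ≤ _ := by gcongr

/-- If a function with even second-order behaviour `t*m + t^2*s/2` is nonnegative near zero then
`s ≥ 0`. -/
lemma nonneg_of_quad {m s : ℝ} (h : ∀ ε > 0, ∀ᶠ t : ℝ in 𝓝 0, -(ε * t ^ 2) ≤ t * m + t ^ 2 * s) :
    0 ≤ s := by
  by_contra hs
  push Not at hs
  have h1 := h (-s / 2) (by linarith)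
  have h2 : ∀ᶠ t : ℝ in 𝓝 0, -(-s / 2 * (-t) ^ 2) ≤ (-t) * m + (-t) ^ 2 * s := by
    have : Tendsto (fun t : ℝ => -t) (𝓝 0) (𝓝 0) := by
      simpa using (continuous_neg (G := ℝ)).tendsto 0
    exact this.eventually h1
  obtain ⟨t, ⟨ha, hb⟩, ht⟩ := (((h1.and h2).filter_mono nhdsWithin_le_nhds).and
    (self_mem_nhdsWithin : Ioi (0:ℝ) ∈ 𝓝[>] 0)).exists
  have ht : 0 < t := ht
  have : 0 < t ^ 2 * (-s) := by nlinarith [mul_pos ht ht]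
  nlinarith

lemma HasT2.pos_of_contact {f : E → ℝ} {x p q : E} {A : E →L[ℝ] E} (hf : HasT2 f x p A)
    (h : ∀ᶠ y in 𝓝 x, f x + inner ℝ q (y - x) ≤ f y) : PosO A := by
  intro d
  suffices 0 ≤ (1/2) * inner ℝ (A d) d by linarith
  apply nonneg_of_quad (m := inner ℝ p d - inner ℝ q d)
  intro ε hε
  have ht : Tendsto (fun t : ℝ => x + t • d) (𝓝 0) (𝓝 x) := by
    have : Continuous (fun t : ℝ => x + t • d) := by fun_prop
    simpa using this.tendsto 0
  filter_upwards [hf.line d ε hε, ht.eventually h] with t h1 h2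
  rw [add_sub_cancel_left, inner_smul_right] at h2
  rw [abs_le] at h1
  linarith

variable [MeasurableSpace E] [BorelSpace E]

/-- ABP for `f = g - α - β` with `α, β` semiconvex. -/
lemma abp_two (μ : Measure E) [μ.IsAddHaarMeasure] {g α β : E → ℝ} {p1 p2 : E → E} {z0 : E}
    {R δ k : ℝ} (hδ : 0 < δ) (hk : 0 ≤ k) (hg : ContinuousOn g (closedBall z0 R))
    (hα : Continuous α) (hβ : Continuous β)
    (h1 : ∀ x z, α x + inner ℝ (p1 x) (z - x) - k * ‖z - x‖ ^ 2 ≤ α z)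
    (h2 : ∀ x z, β x + inner ℝ (p2 x) (z - x) - k * ‖z - x‖ ^ 2 ≤ β z)
    {f : E → ℝ} (hf : f = fun x => g x - α x - β x)
    {x1 : E} (hx1 : x1 ∈ closedBall z0 R)
    (hgap : ∀ y ∈ sphere z0 R, f x1 + 2 * R * δ < f y)
    (hup : ∀ x q, Contact f (closedBall z0 R) δ x q → ∃ p', ∀ y ∈ closedBall z0 R,
      g y ≤ g x + inner ℝ p' (y - x) + k * ‖y - x‖ ^ 2) :
    (CSet f (closedBall z0 R) δ ⊆ ball z0 R) ∧
    μ (CSet f (closedBall z0 R) δ) ≠ 0 ∧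
    μ {x ∈ CSet f (closedBall z0 R) δ | ¬ ∃ A1 A2, SymOp A1 ∧ SymOp A2 ∧ HasT2 α x (p1 x) A1 ∧
      HasT2 β x (p2 x) A2} = 0 ∧
    ∀ D : ℝ, μ {x ∈ CSet f (closedBall z0 R) δ | ¬ ∃ p A, SymOp A ∧ HasT2 f x p A ∧
      |A.det| ≤ D} = 0 →
      μ (ball 0 δ) ≤ ENNReal.ofReal D * μ (CSet f (closedBall z0 R) δ) := by
  have hTb : CSet f (closedBall z0 R) δ ⊆ ball z0 R := fun x ⟨p, hp⟩ => hp.mem_ball hx1 hgap hδ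
  have hfc : ContinuousOn f (closedBall z0 R) := by
    rw [hf]; exact (hg.sub hα.continuousOn).sub hβ.continuousOn
  have hmain := abp_main μ (K := 3 * k) hδ (by positivity) hfc hx1 hgap (by
    intro x q hq
    obtain ⟨p', hp'⟩ := hup x q hq
    refine ⟨p' - p1 x - p2 x, fun y hy => ?_⟩
    have a1 := hp' y hy
    have a2 := h1 x y
    have a3 := h2 x y
    simp only [hf, inner_sub_left]
    linarith)
  -- upper estimates on contact set
  have hsub : ∀ x ∈ CSet f (closedBall z0 R) δ, ball z0 R ∈ 𝓝 x :=
    fun x hx => isOpen_ball.mem_nhds (hTb hx)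
  have two : ∀ (α' β' : E → ℝ) (p1' p2' : E → E),
      (∀ x z, α' x + inner ℝ (p1' x) (z - x) - k * ‖z - x‖ ^ 2 ≤ α' z) →
      (∀ x z, β' x + inner ℝ (p2' x) (z - x) - k * ‖z - x‖ ^ 2 ≤ β' z) →
      (∀ x, α' x + β' x = α x + β x) →
      ∀ x ∈ CSet f (closedBall z0 R) δ, TwoSided α' (ball z0 R) (2 * k) x (p1' x) := by
    intro α' β' p1' p2' ha hb hsum x hx
    obtain ⟨q, hq⟩ := hx
    obtain ⟨p', hp'⟩ := hup x q hq
    have hu : ∀ y ∈ ball z0 R, α' y ≤ α' x + inner ℝ (p' - p2' x - q) (y - x)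
        + (2 * k) * ‖y - x‖ ^ 2 := by
      intro y hy
      have hy' := ball_subset_closedBall hy
      have b1 := hp' y hy'
      have b2 := hb x y
      have b3 := hq.2.2 y hy'
      have b4 := hsum x
      have b5 := hsum y
      simp only [hf] at b3
      simp only [inner_sub_left]
      linarith
    have heq : p1' x = p' - p2' x - q := by
      apply slope_unique (f := α') (x := x) (K := 2 * k)
      · refine Filter.Eventually.of_forall fun y => ?_
        have := ha x y
        have : 0 ≤ k * ‖y - x‖ ^ 2 := by positivity
        linarith
      · filter_upwards [hsub x ⟨q, hq⟩] with y hy using hu y hy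
    intro y hy
    have c1 := hu y hy
    rw [← heq] at c1
    have c2 := ha x y
    have : 0 ≤ k * ‖y - x‖ ^ 2 := by positivity
    rw [abs_le]; constructor <;> linarith
  have d1 := d2_ae μ isOpen_ball hTb (two α β p1 p2 h1 h2 (fun _ => rfl))
  have d2 := d2_ae μ isOpen_ball hTb (two β α p2 p1 h2 h1 (fun _ => add_comm _ _))
  refine ⟨hTb, hmain.1, ?_, hmain.2⟩
  refine measure_mono_null ?_ (measure_union_null d1 d2)
  rintro x ⟨hx, hn⟩
  by_contra hcon
  simp only [mem_union, mem_ofPred_eq, not_or, not_and, not_not] at hcon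
  obtain ⟨A1, s1, t1, -⟩ := hcon.1 hx
  obtain ⟨A2, s2, t2, -⟩ := hcon.2 hx
  exact hn ⟨A1, A2, s1, s2, t1, t2⟩

end KS5

section KS6
open Filter
set_option linter.unusedSectionVars false

variable {E : Type*} [NormedAddCommGroup E] [InnerProductSpace ℝ E]

/-- Gaussian barrier -/
def psi (β : ℝ) (x : E) : ℝ := Real.exp (-(β * ‖x‖ ^ 2))

lemma psi_eq (β : ℝ) (x z : E) : psi β z = psi β x *
    Real.exp (-(2 * β * inner ℝ x (z - x) + β * ‖z - x‖ ^ 2)) := by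
  rw [psi, psi, ← Real.exp_add]
  congr 1
  have e : ‖z‖ ^ 2 = ‖x‖ ^ 2 + 2 * inner ℝ x (z - x) + ‖z - x‖ ^ 2 := by
    have : z = x + (z - x) := by abel
    conv_lhs => rw [this]
    rw [norm_add_sq_real]
  rw [e]; ring

lemma psi_pos (β : ℝ) (x : E) : 0 < psi β x := Real.exp_pos _

lemma psi_le_one {β : ℝ} (hβ : 0 ≤ β) (x : E) : psi β x ≤ 1 := by
  rw [psi]; apply Real.exp_le_one_iff.2
  have : 0 ≤ β * ‖x‖ ^ 2 := by positivity
  linarith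

lemma psi_lower {β : ℝ} (hβ : 0 ≤ β) (x z : E) :
    psi β x - 2 * β * psi β x * inner ℝ x (z - x) - β * ‖z - x‖ ^ 2 ≤ psi β z := by
  rw [psi_eq β x z]
  have h1 := Real.add_one_le_exp (-(2 * β * inner ℝ x (z - x) + β * ‖z - x‖ ^ 2))
  have h2 := psi_pos β x
  have h3 := psi_le_one hβ x
  have h4 : 0 ≤ β * ‖z - x‖ ^ 2 := by positivity
  have h5 := mul_le_mul_of_nonneg_left h1 h2.le
  nlinarith

lemma psi_hasT2 [FiniteDimensional ℝ E] {β : ℝ} (hβ : 0 ≤ β) (x : E) : HasT2 (psi β) x (-(2 * β * psi β x) • x)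
    ((4 * β ^ 2 * psi β x) • rk1 x - (2 * β * psi β x) • ContinuousLinearMap.id ℝ E) := by
  intro ε hε
  obtain ⟨C0, hC0d⟩ : ∃ C0, C0 = 2 * β * ‖x‖ + β := ⟨_, rfl⟩
  have hC0 : 0 ≤ C0 := by rw [hC0d]; positivity
  obtain ⟨C1, hC1d⟩ : ∃ C1, C1 = C0 ^ 3 + 2 * β ^ 2 * ‖x‖ + β ^ 2 + 1 := ⟨_, rfl⟩
  have hC1 : 0 < C1 := by rw [hC1d]; positivity
  refine Metric.eventually_nhds_iff_ball.2 ⟨min 1 (min (1 / (C0 + 1)) (ε / C1)), by positivity,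
    fun z hz => ?_⟩
  rw [mem_ball, dist_eq_norm, lt_min_iff, lt_min_iff, lt_div_iff₀ (by positivity),
    lt_div_iff₀ (by positivity)] at hz
  obtain ⟨hz1, hz2, hz3⟩ := hz
  rw [psi_eq β x z]
  have hin := abs_real_inner_le_norm x (z - x)
  have hp0 := psi_pos β x
  have hp1 := psi_le_one hβ x
  generalize z - x = w at *
  simp only [sub_apply, smul_apply, ContinuousLinearMap.id_apply, inner_sub_left, inner_smul_left,
    rk1_inner, real_inner_self_eq_norm_sq, RCLike.conj_to_real]
  have hd0 := norm_nonneg w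
  generalize ‖w‖ = d at *
  generalize inner ℝ x w = i at *
  generalize psi β x = P at *
  obtain ⟨s, hs⟩ : ∃ s, s = 2 * β * i + β * d ^ 2 := ⟨_, rfl⟩
  have hsabs : |s| ≤ C0 * d := by
    rw [hs]
    refine (abs_add_le _ _).trans ?_
    rw [abs_mul, abs_of_nonneg (by positivity : 0 ≤ 2 * β), abs_of_nonneg (by positivity : 0 ≤ β * d ^ 2)]
    have : 2 * β * |i| ≤ 2 * β * (‖x‖ * d) := by gcongr
    have : β * d ^ 2 ≤ β * d := by
      have : d ^ 2 ≤ d := by nlinarith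
      gcongr
    rw [hC0d]; nlinarith
  have hs1 : |-s| ≤ 1 := by rw [abs_neg]; nlinarith
  have hexp := Real.exp_bound hs1 (n := 3) (by norm_num)
  have hsum : ∑ m ∈ Finset.range 3, (-s) ^ m / (m.factorial : ℝ) = 1 - s + s ^ 2 / 2 := by
    simp [Finset.sum_range_succ, Nat.factorial]; ring
  rw [hsum, abs_neg] at hexp
  have hexp2 : |Real.exp (-s) - (1 - s + s ^ 2 / 2)| ≤ C0 ^ 3 * d ^ 3 := by
    refine hexp.trans ?_
    have h1 : |s| ^ 3 ≤ (C0 * d) ^ 3 := by gcongr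
    have h2 : ((3:ℕ).succ / ((3:ℕ).factorial * (3:ℕ)) : ℝ) ≤ 1 := by norm_num [Nat.factorial]
    have h3 : 0 ≤ |s| ^ 3 := by positivity
    calc _ ≤ |s| ^ 3 * 1 := by gcongr
      _ ≤ _ := by rw [mul_one, ← mul_pow]; exact h1
  rw [← hs]
  have e : P * Real.exp (-s) - P - -(2 * β * P) * i -
      1 / 2 * (4 * β ^ 2 * P * i ^ 2 - 2 * β * P * d ^ 2) =
      P * ((Real.exp (-s) - (1 - s + s ^ 2 / 2)) + (2 * β ^ 2 * i * d ^ 2 + β ^ 2 * d ^ 4 / 2)) := by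
    rw [hs]; ring
  rw [e, abs_mul, abs_of_pos hp0]
  have h3 : |2 * β ^ 2 * i * d ^ 2 + β ^ 2 * d ^ 4 / 2| ≤ (2 * β ^ 2 * ‖x‖ + β ^ 2) * d ^ 3 := by
    refine (abs_add_le _ _).trans ?_
    rw [abs_of_nonneg (by positivity : 0 ≤ β ^ 2 * d ^ 4 / 2)]
    have e1 : |2 * β ^ 2 * i * d ^ 2| = 2 * β ^ 2 * |i| * d ^ 2 := by
      rw [abs_mul, abs_mul, abs_of_nonneg (by positivity : 0 ≤ 2 * β ^ 2),
        abs_of_nonneg (by positivity : 0 ≤ d ^ 2)]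
    rw [e1]
    have e2 : 2 * β ^ 2 * |i| * d ^ 2 ≤ 2 * β ^ 2 * (‖x‖ * d) * d ^ 2 := by gcongr
    have e3 : β ^ 2 * d ^ 4 / 2 ≤ β ^ 2 * d ^ 3 := by
      have : d ^ 4 ≤ d ^ 3 := by
        have : 0 ≤ d ^ 3 := by positivity
        nlinarith
      have h0 : 0 ≤ β ^ 2 * d ^ 3 := by positivity
      nlinarith [mul_le_mul_of_nonneg_left this (sq_nonneg β)]
    nlinarith
  calc _ ≤ 1 * (C0 ^ 3 * d ^ 3 + (2 * β ^ 2 * ‖x‖ + β ^ 2) * d ^ 3) := by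
        refine mul_le_mul hp1 ?_ (abs_nonneg _) zero_le_one
        exact (abs_add_le _ _).trans (add_le_add hexp2 h3)
    _ ≤ (d * C1) * d ^ 2 := by
        have : 0 ≤ d ^ 3 := by positivity
        rw [hC1d]; nlinarith
    _ ≤ ε * d ^ 2 := by gcongr

variable [FiniteDimensional ℝ E] [MeasurableSpace E] [BorelSpace E]

set_option maxHeartbeats 1000000 in
/-- Basic measure estimate at unit scale. -/
lemma meas_est (μ : Measure E) [μ.IsAddHaarMeasure] {lam Lam : ℝ} (hlam : 0 < lam)
    (hlL : lam ≤ Lam) : ∃ M D : ℝ, 1 < M ∧ 0 < D ∧ ∀ F : (E →L[ℝ] E) → ℝ, Ell lam Lam F →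
      ∀ a b : E → ℝ, ContinuousOn a (ball 0 5) → ContinuousOn b (ball 0 5) →
      SubV (fun _ A => dualF F A ≤ 0) (ball 0 5) a → SubV (fun _ A => F A ≤ 0) (ball 0 5) b →
      (∀ x ∈ ball (0:E) 5, a x + b x ≤ 0) → ∀ x1 ∈ closedBall (0:E) 3, -1 ≤ a x1 + b x1 →
      μ (ball 0 (1/16)) ≤ ENNReal.ofReal D * μ {x ∈ ball (0:E) 1 | -(a x + b x) ≤ M} := by
  have hproper : ProperSpace E := FiniteDimensional.proper_real E
  have hLam : 0 < Lam := hlam.trans_le hlL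
  obtain ⟨n, hn⟩ : ∃ n : ℝ, n = (Module.finrank ℝ E : ℝ) := ⟨_, rfl⟩
  have hn0 : 0 ≤ n := by rw [hn]; positivity
  obtain ⟨β, hβd⟩ : ∃ β, β = Lam * (n + 1) / lam := ⟨_, rfl⟩
  have hβ : 0 < β := by rw [hβd]; positivity
  have hβl : β * lam = Lam * (n + 1) := by rw [hβd]; field_simp
  have hdiff : 0 < Real.exp (-(β * 9)) - Real.exp (-(β * 16)) := by
    rw [sub_pos, Real.exp_lt_exp]; linarith
  obtain ⟨c, hcd⟩ : ∃ c, c = 3 / (Real.exp (-(β * 9)) - Real.exp (-(β * 16))) := ⟨_, rfl⟩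
  have hc : 0 < c := by rw [hcd]; positivity
  have hceq : c * (Real.exp (-(β * 9)) - Real.exp (-(β * 16))) = 3 := by rw [hcd]; field_simp
  obtain ⟨Ct, hCtd⟩ : ∃ Ct, Ct = 2 * β * c * Lam * n / lam + 1 := ⟨_, rfl⟩
  have hCt : 0 < Ct := by rw [hCtd]; positivity
  refine ⟨c + 2, Ct ^ (Module.finrank ℝ E), by linarith, by positivity, ?_⟩
  intro F hF a b hac hbc ha hb hab x1 hx1 hx1v
  have hCsub : closedBall (0:E) (9/2) ⊆ ball 0 5 := closedBall_subset_ball (by norm_num)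
  have hCc : IsCompact (closedBall (0:E) (9/2)) := isCompact_closedBall _ _
  have hCne : (closedBall (0:E) (9/2)).Nonempty := ⟨0, mem_closedBall_self (by norm_num)⟩
  have ha' := hac.mono hCsub
  have hb' := hbc.mono hCsub
  obtain ⟨ε1, hε1, hcl1⟩ := supConv_close hCc ha' (τ := 1/4) (by norm_num)
  obtain ⟨ε2, hε2, hcl2⟩ := supConv_close hCc hb' (τ := 1/4) (by norm_num)
  obtain ⟨ε, hε, hεε1, hεε2⟩ : ∃ ε, 0 < ε ∧ ε < ε1 ∧ ε < ε2 :=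
    ⟨min ε1 ε2 / 2, by positivity, by
      have := min_le_left ε1 ε2
      linarith, by
      have := min_le_right ε1 ε2
      linarith⟩
  obtain ⟨α, hα⟩ : ∃ α, α = supConv a (closedBall (0:E) (9/2)) ε := ⟨_, rfl⟩
  obtain ⟨γ, hγ⟩ : ∃ γ, γ = supConv b (closedBall (0:E) (9/2)) ε := ⟨_, rfl⟩
  choose y1 hy1 he1 using supConv_exists hCc hCne ha' ε
  choose y2 hy2 he2 using supConv_exists hCc hCne hb' ε
  have hclose1 : ∀ x ∈ closedBall (0:E) (9/2), ‖x - y1 x‖ < 1/4 ∧ α x ≤ a x + 1/4 := by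
    intro x hx
    have h1 := self_le_supConv hCc ha' ε hx
    rw [he1] at h1
    have h2 := hcl1 ε hε hεε1 x hx (y1 x) (hy1 x) h1
    refine ⟨h2.1, ?_⟩
    rw [hα, he1]
    have : 0 ≤ ‖x - y1 x‖ ^ 2 / (2 * ε) := by positivity
    linarith
  have hclose2 : ∀ x ∈ closedBall (0:E) (9/2), ‖x - y2 x‖ < 1/4 ∧ γ x ≤ b x + 1/4 := by
    intro x hx
    have h1 := self_le_supConv hCc hb' ε hx
    rw [he2] at h1
    have h2 := hcl2 ε hε hεε2 x hx (y2 x) (hy2 x) h1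
    refine ⟨h2.1, ?_⟩
    rw [hγ, he2]
    have : 0 ≤ ‖x - y2 x‖ ^ 2 / (2 * ε) := by positivity
    linarith
  have hαc : Continuous α := by rw [hα]; exact supConv_continuous hCc hCne ha' hε
  have hγc : Continuous γ := by rw [hγ]; exact supConv_continuous hCc hCne hb' hε
  have haα : ∀ x ∈ closedBall (0:E) (9/2), a x ≤ α x := fun x hx => by
    rw [hα]; exact self_le_supConv hCc ha' ε hx
  have hbγ : ∀ x ∈ closedBall (0:E) (9/2), b x ≤ γ x := fun x hx => by
    rw [hγ]; exact self_le_supConv hCc hb' ε hx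
  obtain ⟨f, hf⟩ : ∃ f : E → ℝ, f = fun x => -(c * psi β x) - α x - γ x := ⟨_, rfl⟩
  have h4sub : closedBall (0:E) 4 ⊆ closedBall 0 (9/2) := closedBall_subset_closedBall (by norm_num)
  have hx14 : x1 ∈ closedBall (0:E) 4 := closedBall_subset_closedBall (by norm_num) hx1
  have hfx1 : f x1 ≤ 1 - c * Real.exp (-(β * 9)) := by
    have h1 := haα x1 (h4sub hx14)
    have h2 := hbγ x1 (h4sub hx14)
    have h3 : Real.exp (-(β * 9)) ≤ psi β x1 := by
      rw [psi, Real.exp_le_exp]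
      have h4 : ‖x1‖ ≤ 3 := by simpa using hx1
      have : ‖x1‖ ^ 2 ≤ 9 := by nlinarith [norm_nonneg x1]
      nlinarith
    rw [hf]
    simp only
    nlinarith
  have hgap : ∀ y ∈ sphere (0:E) 4, f x1 + 2 * 4 * (1/16) < f y := by
    intro y hy
    have hy' : y ∈ closedBall (0:E) (9/2) := h4sub (sphere_subset_closedBall hy)
    have h1 := (hclose1 y hy').2
    have h2 := (hclose2 y hy').2
    have h3 := hab y (hCsub hy')
    have h4 : psi β y = Real.exp (-(β * 16)) := by
      have : ‖y‖ = 4 := by simpa using hy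
      rw [psi, this]; norm_num
    have : f y = -(c * psi β y) - α y - γ y := by rw [hf]
    rw [this, h4]
    nlinarith
  have hk : (0:ℝ) ≤ 1 / (2 * ε) + c * β := by positivity
  have habp := abp_two μ (g := fun x => -(c * psi β x)) (α := α) (β := γ)
    (p1 := fun x => (1 / ε) • (y1 x - x)) (p2 := fun x => (1 / ε) • (y2 x - x))
    (z0 := 0) (R := 4) (δ := 1/16) (k := 1 / (2 * ε) + c * β) (by norm_num) hk
    (by
      have : Continuous (fun x : E => -(c * psi β x)) := by
        unfold psi; fun_prop
      exact this.continuousOn) hαc hγc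
    (by
      intro x z
      have := supConv_lower hCc ha' hε (hy1 x) (he1 x) z
      rw [← hα] at this
      have h0 : 0 ≤ c * β * ‖z - x‖ ^ 2 := by positivity
      linarith)
    (by
      intro x z
      have := supConv_lower hCc hb' hε (hy2 x) (he2 x) z
      rw [← hγ] at this
      have h0 : 0 ≤ c * β * ‖z - x‖ ^ 2 := by positivity
      linarith) hf hx14 hgap
    (by
      intro x q _
      refine ⟨(c * (2 * β * psi β x)) • x, fun y _ => ?_⟩
      have h1 := mul_le_mul_of_nonneg_left (psi_lower hβ.le x y) hc.le
      have h0 : 0 ≤ 1 / (2 * ε) * ‖y - x‖ ^ 2 := by positivity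
      rw [inner_smul_left]
      simp only [RCLike.conj_to_real]
      nlinarith)
  obtain ⟨hTb, -, hnull, hD⟩ := habp
  generalize hT : CSet f (closedBall (0:E) 4) (1/16) = T at *
  -- pointwise analysis
  have hpt : ∀ x ∈ T, (∃ A1 A2, SymOp A1 ∧ SymOp A2 ∧ HasT2 α x ((1 / ε) • (y1 x - x)) A1 ∧
      HasT2 γ x ((1 / ε) • (y2 x - x)) A2) →
      x ∈ ball (0:E) 1 ∧ ∃ p A, SymOp A ∧ HasT2 f x p A ∧ |A.det| ≤ Ct ^ (Module.finrank ℝ E) := by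
    rintro x hx ⟨A1, A2, hs1, hs2, ht1, ht2⟩
    have hx4 : x ∈ closedBall (0:E) 4 := ball_subset_closedBall (hTb hx)
    have hx45 := h4sub hx4
    have hnorm : ‖x‖ ≤ 4 := by simpa using hx4
    have hyb : ∀ y : E, ‖x - y‖ < 1/4 → y ∈ ball (0:E) (9/2) := by
      intro y hy
      rw [mem_ball_zero_iff]
      calc ‖y‖ = ‖x - (x - y)‖ := by congr 1; abel
        _ ≤ ‖x‖ + ‖x - y‖ := norm_sub_le _ _
        _ < 9/2 := by linarith
    have hyb1 := hyb _ (hclose1 x hx45).1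
    have hyb2 := hyb _ (hclose2 x hx45).1
    have hψ := psi_hasT2 hβ.le x
    obtain ⟨P, hP⟩ : ∃ P, P = psi β x := ⟨_, rfl⟩
    have hP0 : 0 < P := by rw [hP]; exact psi_pos β x
    have hP1 : P ≤ 1 := by rw [hP]; exact psi_le_one hβ.le x
    rw [← hP] at hψ
    have hft := ((hψ.smul (-c)).add (ht1.smul (-1))).add (ht2.smul (-1))
    have hfe : (fun y => -c * psi β y + -1 * α y + -1 * γ y) = f := by
      rw [hf]; funext y; ring
    rw [hfe] at hft
    generalize hAd : -c • ((4 * β ^ 2 * P) • rk1 x - (2 * β * P) • ContinuousLinearMap.id ℝ E) +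
      (-1:ℝ) • A1 + (-1:ℝ) • A2 = A at hft
    have hAs : SymOp A := by
      rw [← hAd]
      exact (((((rk1_sym x).smul _).sub (SymOp.id.smul _)).smul _).add (hs1.smul _)).add (hs2.smul _)
    have hApos : PosO A := by
      rw [← hT] at hx
      obtain ⟨q, hq⟩ := hx
      apply hft.pos_of_contact (q := q)
      rw [← hT] at hTb
      filter_upwards [isOpen_ball.mem_nhds (hTb ⟨q, hq⟩)] with y hy
      exact hq.2.2 y (ball_subset_closedBall hy)
    have hmain : lam * (trO A + 4 * β ^ 2 * c * P * ‖x‖ ^ 2) ≤ Lam * n * (2 * β * c * P) := by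
      apply le_of_forall_pos_le_add
      intro η hη
      obtain ⟨τ, hτ, hτη⟩ : ∃ τ > 0, Lam * n * (2 * τ) ≤ η := by
        refine ⟨η / (2 * (Lam * n + 1)), by positivity, ?_⟩
        have : 0 ≤ Lam * n := by positivity
        have e : Lam * n * (2 * (η / (2 * (Lam * n + 1)))) = η * (Lam * n / (Lam * n + 1)) := by
          field_simp
        rw [e]
        have : Lam * n / (Lam * n + 1) ≤ 1 := by rw [div_le_one (by positivity)]; linarith
        nlinarith
      have g1 := ha.supConv hCc ha' (he1 x) (mem_of_superset (isOpen_ball.mem_nhds hyb1)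
        ball_subset_closedBall) (hCsub (ball_subset_closedBall hyb1)) hs1 (by rw [← hα]; exact ht1) hτ
      have g2 := hb.supConv hCc hb' (he2 x) (mem_of_superset (isOpen_ball.mem_nhds hyb2)
        ball_subset_closedBall) (hCsub (ball_subset_closedBall hyb2)) hs2 (by rw [← hγ]; exact ht2) hτ
      simp only [dualF] at g1
      have key := hF.lower (X := A2 + τ • ContinuousLinearMap.id ℝ E)
        (P := A + (4 * β ^ 2 * c * P) • rk1 x)
        (N := (2 * β * c * P + 2 * τ) • ContinuousLinearMap.id ℝ E)
        (hs2.add (SymOp.id.smul _)) (hAs.add ((rk1_sym x).smul _)) (SymOp.id.smul _)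
        (hApos.add (PosO.smul (fun d => by rw [rk1_inner]; positivity) (by positivity)))
        (PosO.id.smul (by positivity))
      have e : A2 + τ • ContinuousLinearMap.id ℝ E + (A + (4 * β ^ 2 * c * P) • rk1 x) -
        (2 * β * c * P + 2 * τ) • ContinuousLinearMap.id ℝ E =
        -(A1 + τ • ContinuousLinearMap.id ℝ E) := by
        rw [← hAd]; module
      rw [e, trO_add, trO_smul, trO_smul, trO_rk1, trO_id, ← hn] at key
      nlinarith
    have htr0 := hApos.trO_nonneg
    refine ⟨?_, _, A, hAs, hft, ?_⟩
    · rw [mem_ball_zero_iff]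
      by_contra hcon
      push Not at hcon
      have h1 : 1 ≤ ‖x‖ ^ 2 := by nlinarith
      have hcP : 0 < β * c * P := by positivity
      have h2 : lam * (4 * β ^ 2 * c * P * 1) ≤ lam * (4 * β ^ 2 * c * P * ‖x‖ ^ 2) := by gcongr
      have h3 : lam * (4 * β ^ 2 * c * P * 1) = 4 * (Lam * (n + 1)) * (β * c * P) := by
        rw [← hβl]; ring
      have h4 : 0 ≤ lam * trO A := by positivity
      have h5 : 0 < Lam * (β * c * P) := by positivity
      have h6 : 0 ≤ Lam * n * (β * c * P) := by positivity
      have h7 : lam * (trO A + 4 * β ^ 2 * c * P * ‖x‖ ^ 2) =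
        lam * trO A + lam * (4 * β ^ 2 * c * P * ‖x‖ ^ 2) := by ring
      have h8 : Lam * n * (2 * β * c * P) = 2 * (Lam * n * (β * c * P)) := by ring
      have h9 : 4 * (Lam * (n + 1)) * (β * c * P) =
        4 * (Lam * n * (β * c * P)) + 4 * (Lam * (β * c * P)) := by ring
      linarith
    · apply abs_det_le hAs hApos
      rw [hCtd]
      have h1 : lam * trO A ≤ Lam * n * (2 * β * c) := by
        have h5 : 0 ≤ lam * (4 * β ^ 2 * c * P * ‖x‖ ^ 2) := by positivity
        have h6 : Lam * n * (2 * β * c * P) ≤ Lam * n * (2 * β * c * 1) := by gcongr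
        nlinarith
      have h2 : trO A ≤ 2 * β * c * Lam * n / lam := by
        rw [le_div_iff₀ hlam]; linarith
      linarith
  have hTM : ∀ x ∈ T, -(a x + b x) ≤ c + 2 := by
    intro x hx
    have hx4 : x ∈ closedBall (0:E) 4 := ball_subset_closedBall (hTb hx)
    have hx45 := h4sub hx4
    rw [← hT] at hx
    obtain ⟨q, hq⟩ := hx
    have h1 := hq.2.2 x1 hx14
    have h2 := abs_real_inner_le_norm q (x1 - x)
    have h3 : ‖x1 - x‖ ≤ 8 := by
      refine (norm_sub_le _ _).trans ?_
      have : ‖x1‖ ≤ 4 := by simpa using hx14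
      have : ‖x‖ ≤ 4 := by simpa using hx4
      linarith
    have h4 : ‖q‖ * ‖x1 - x‖ ≤ 1/16 * 8 := mul_le_mul hq.2.1 h3 (norm_nonneg _) (by norm_num)
    rw [abs_le] at h2
    have h5 : f x = -(c * psi β x) - α x - γ x := by rw [hf]
    have h6 := (hclose1 x hx45).2
    have h7 := (hclose2 x hx45).2
    have h8 := psi_le_one hβ.le x
    have h9 : c * psi β x ≤ c * 1 := by gcongr
    have h10 : 0 < c * Real.exp (-(β * 9)) := by positivity
    linarith
  have hres := hD (Ct ^ (Module.finrank ℝ E)) (by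
    refine measure_mono_null ?_ hnull
    rintro x ⟨hx, hn⟩
    exact ⟨hx, fun h => hn (hpt x hx h).2⟩)
  refine hres.trans ?_
  refine mul_le_mul' le_rfl ?_
  have hsplit : T ⊆ {x ∈ ball (0:E) 1 | -(a x + b x) ≤ c + 2} ∪ {x ∈ T | ¬ ∃ A1 A2, SymOp A1 ∧
      SymOp A2 ∧ HasT2 α x ((1 / ε) • (y1 x - x)) A1 ∧ HasT2 γ x ((1 / ε) • (y2 x - x)) A2} := by
    intro x hx
    by_cases h : ∃ A1 A2, SymOp A1 ∧ SymOp A2 ∧ HasT2 α x ((1 / ε) • (y1 x - x)) A1 ∧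
      HasT2 γ x ((1 / ε) • (y2 x - x)) A2
    · left; exact ⟨(hpt x hx h).1, hTM x hx⟩
    · right; exact ⟨hx, h⟩
  calc μ T ≤ _ := measure_mono hsplit
    _ ≤ _ := measure_union_le _ _
    _ = _ := by rw [hnull, add_zero]

end KS6

section KS7
open Filter
variable {E : Type*} [NormedAddCommGroup E] [InnerProductSpace ℝ E]

lemma SubV.mono {G G' : E → (E →L[ℝ] E) → Prop} {U V : Set E} {a : E → ℝ} (h : SubV G U a)
    (hV : V ⊆ U) (hG : ∀ p A, SymOp A → G p A → G' p A) : SubV G' V a :=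
  fun x hx p A hA hz => hG p A hA (h x (hV hx) p A hA hz)

lemma SubV.rescale {G : E → (E →L[ℝ] E) → Prop} {U : Set E} {a : E → ℝ} (h : SubV G U a)
    {r t : ℝ} (hr : 0 < r) (ht : 0 < t) (x0 : E) (k : ℝ) :
    SubV (fun p A => G ((t / r) • p) ((t / r ^ 2) • A)) {x | x0 + r • x ∈ U}
      (fun x => (a (x0 + r • x) + k) / t) := by
  intro x hx p A hA hz
  refine h _ hx _ _ (hA.smul _) ?_
  have hcont : Tendsto (fun z : E => r⁻¹ • (z - x0)) (𝓝 (x0 + r • x)) (𝓝 x) := by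
    have : ContinuousAt (fun z : E => r⁻¹ • (z - x0)) (x0 + r • x) := by fun_prop
    have e : r⁻¹ • (x0 + r • x - x0) = x := by
      rw [add_sub_cancel_left, smul_smul, inv_mul_cancel₀ hr.ne', one_smul]
    rw [ContinuousAt, e] at this
    exact this
  filter_upwards [hcont.eventually hz] with z hz
  have e1 : x0 + r • (r⁻¹ • (z - x0)) = z := by
    rw [smul_smul, mul_inv_cancel₀ hr.ne', one_smul]; abel
  have e2 : r⁻¹ • (z - x0) - x = r⁻¹ • (z - (x0 + r • x)) := by
    rw [← sub_sub, smul_sub _ (z - x0), smul_smul, inv_mul_cancel₀ hr.ne', one_smul]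
  rw [e1, e2] at hz
  generalize z - (x0 + r • x) = d at *
  simp only [map_smul, inner_smul_left, inner_smul_right, RCLike.conj_to_real,
    smul_apply] at hz ⊢
  rw [div_le_iff₀ ht] at hz
  have e3 : ((a (x0 + r • x) + k) / t + r⁻¹ * inner ℝ p d +
    1 / 2 * (r⁻¹ * (r⁻¹ * inner ℝ (A d) d))) * t = a (x0 + r • x) + k + t / r * inner ℝ p d +
    1 / 2 * (t / r ^ 2 * inner ℝ (A d) d) := by
    field_simp
  linarith

lemma Ell.rescale [FiniteDimensional ℝ E] {lam Lam : ℝ} {F : (E →L[ℝ] E) → ℝ} (h : Ell lam Lam F)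
    {s : ℝ} (hs : 0 < s) : Ell lam Lam (fun A => s⁻¹ * F (s • A)) := by
  intro A B hA hB hp
  have h1 := h (s • A) (s • B) (hA.smul _) (hB.smul _) (hp.smul hs.le)
  rw [trO_smul, ← smul_add] at h1
  have h2 : s * s⁻¹ = 1 := mul_inv_cancel₀ hs.ne'
  have h3 : 0 < s⁻¹ := by positivity
  constructor
  · have := mul_le_mul_of_nonneg_left h1.1 h3.le
    have e : s⁻¹ * (lam * (s * trO B)) = lam * trO B := by field_simp
    nlinarith
  · have := mul_le_mul_of_nonneg_left h1.2 h3.le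
    have e : s⁻¹ * (Lam * (s * trO B)) = Lam * trO B := by field_simp
    nlinarith

variable [FiniteDimensional ℝ E] [MeasurableSpace E] [BorelSpace E]

open scoped Pointwise in
lemma addHaar_image_aff (μ : Measure E) [μ.IsAddHaarMeasure] (x0 : E) {r : ℝ} (hr : 0 < r)
    (S : Set E) : μ ((fun x => x0 + r • x) '' S) =
      ENNReal.ofReal (r ^ Module.finrank ℝ E) * μ S := by
  have : (fun x : E => x0 + r • x) '' S = (fun x => x0 + x) '' (r • S) := by
    rw [← image_smul, image_image]
  rw [this, image_add_left, measure_preimage_add, Measure.addHaar_smul,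
    abs_of_nonneg (by positivity)]

lemma image_aff_ball (x0 : E) {r : ℝ} (hr : 0 < r) (ρ : ℝ) :
    (fun x : E => x0 + r • x) '' (ball 0 ρ) = ball x0 (r * ρ) := by
  ext y
  constructor
  · rintro ⟨x, hx, rfl⟩
    rw [mem_ball_zero_iff] at hx
    rw [mem_ball_iff_norm, add_sub_cancel_left, norm_smul, Real.norm_of_nonneg hr.le]
    gcongr
  · intro hy
    rw [mem_ball_iff_norm] at hy
    refine ⟨r⁻¹ • (y - x0), ?_, ?_⟩
    · rw [mem_ball_zero_iff, norm_smul, Real.norm_of_nonneg (by positivity), inv_mul_lt_iff₀ hr]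
      exact hy
    · simp only
      rw [smul_smul, mul_inv_cancel₀ hr.ne', one_smul]; abel

/-- scaled measure estimate -/
lemma meas_est_scaled (μ : Measure E) [μ.IsAddHaarMeasure] {lam Lam : ℝ} (hlam : 0 < lam)
    (hlL : lam ≤ Lam) : ∃ M κ : ℝ, 1 < M ∧ 0 < κ ∧ κ < 1 ∧ ∀ F : (E →L[ℝ] E) → ℝ, Ell lam Lam F →
      ∀ (x0 : E) (r t : ℝ), 0 < r → 0 < t →
      ∀ a b : E → ℝ, ContinuousOn a (ball x0 (5 * r)) → ContinuousOn b (ball x0 (5 * r)) →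
      SubV (fun _ A => dualF F A ≤ 0) (ball x0 (5 * r)) a →
      SubV (fun _ A => F A ≤ 0) (ball x0 (5 * r)) b →
      (∀ x ∈ ball x0 (5 * r), a x + b x ≤ 0) →
      ∀ x1 ∈ closedBall x0 (3 * r), -t ≤ a x1 + b x1 →
      ENNReal.ofReal κ * μ (ball x0 r) ≤ μ {x ∈ ball x0 r | -(a x + b x) ≤ M * t} := by
  obtain ⟨M, D, hM, hD, H⟩ := meas_est μ hlam hlL
  have hκ : 0 < (1/16 : ℝ) ^ Module.finrank ℝ E / (D + 1) := by positivity
  refine ⟨M, (1/16 : ℝ) ^ Module.finrank ℝ E / (D + 1), hM, hκ, ?_, ?_⟩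
  · rw [div_lt_one (by positivity)]
    have : (1/16 : ℝ) ^ Module.finrank ℝ E ≤ 1 := pow_le_one₀ (by norm_num) (by norm_num)
    linarith
  intro F hF x0 r t hr ht a b hac hbc ha hb hab x1 hx1 hx1t
  have hs : 0 < t / r ^ 2 := by positivity
  have hmaps : ∀ x ∈ ball (0:E) 5, x0 + r • x ∈ ball x0 (5 * r) := by
    intro x hx
    rw [mul_comm, ← image_aff_ball x0 hr]
    exact ⟨x, hx, rfl⟩
  have key := H (fun A => (t / r ^ 2)⁻¹ * F ((t / r ^ 2) • A)) (hF.rescale hs)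
    (fun x => (a (x0 + r • x) + 0) / t) (fun x => (b (x0 + r • x) + 0) / t)
    (by
      refine ((hac.comp (by fun_prop) hmaps).add continuousOn_const).div_const t)
    (by
      refine ((hbc.comp (by fun_prop) hmaps).add continuousOn_const).div_const t)
    (by
      refine (ha.rescale hr ht x0 0).mono hmaps fun p A _ h => ?_
      simp only [dualF] at h ⊢
      rw [← smul_neg] at h
      have : 0 ≤ (t / r ^ 2)⁻¹ * (F ((t / r ^ 2) • (-A))) := by
        apply mul_nonneg (by positivity); linarith
      linarith)
    (by
      refine (hb.rescale hr ht x0 0).mono hmaps fun p A _ h => ?_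
      exact mul_nonpos_of_nonneg_of_nonpos (by positivity) h)
    (by
      intro x hx
      have := hab _ (hmaps x hx)
      rw [add_zero, add_zero, ← add_div]
      exact div_nonpos_of_nonpos_of_nonneg this ht.le)
    (r⁻¹ • (x1 - x0))
    (by
      rw [mem_closedBall_iff_norm] at hx1
      rw [mem_closedBall_zero_iff, norm_smul, Real.norm_of_nonneg (by positivity),
        inv_mul_le_iff₀ hr]
      linarith)
    (by
      have e1 : x0 + r • (r⁻¹ • (x1 - x0)) = x1 := by
        rw [smul_smul, mul_inv_cancel₀ hr.ne', one_smul]; abel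
      rw [e1, add_zero, add_zero, ← add_div, le_div_iff₀ ht]
      linarith)
  have hS : (fun x : E => x0 + r • x) '' {x ∈ ball (0:E) 1 |
      -((a (x0 + r • x) + 0) / t + (b (x0 + r • x) + 0) / t) ≤ M} ⊆
      {x ∈ ball x0 r | -(a x + b x) ≤ M * t} := by
    rintro _ ⟨x, ⟨hx, hx2⟩, rfl⟩
    refine ⟨?_, ?_⟩
    · have := image_aff_ball x0 hr 1
      rw [mul_one] at this
      rw [← this]
      exact ⟨x, hx, rfl⟩
    · rw [add_zero, add_zero, ← add_div, ← neg_div, div_le_iff₀ ht] at hx2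
      exact hx2
  have h1 := measure_mono (μ := μ) hS
  rw [addHaar_image_aff μ x0 hr] at h1
  refine le_trans ?_ h1
  have e2 : μ (ball x0 r) = ENNReal.ofReal (r ^ Module.finrank ℝ E) * μ (ball (0:E) 1) :=
    Measure.addHaar_ball_of_pos μ x0 hr
  have e3 : μ (ball (0:E) (1/16)) = ENNReal.ofReal ((1/16) ^ Module.finrank ℝ E) * μ (ball (0:E) 1) :=
    Measure.addHaar_ball_of_pos μ 0 (by norm_num)
  rw [e2, mul_left_comm]
  gcongr
  rw [e3] at key
  generalize μ {x ∈ ball (0:E) 1 |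
      -((a (x0 + r • x) + 0) / t + (b (x0 + r • x) + 0) / t) ≤ M} = Z at *
  rw [ENNReal.ofReal_div_of_pos (by positivity), ENNReal.div_eq_inv_mul, mul_assoc,
    ENNReal.inv_mul_le_iff (by simp; positivity) (by simp)]
  refine key.trans ?_
  gcongr
  linarith

end KS7

section KS8
open Filter
variable {E : Type*} [NormedAddCommGroup E] [InnerProductSpace ℝ E]
  [FiniteDimensional ℝ E] [MeasurableSpace E] [BorelSpace E]

/-- Ink spots lemma. -/
lemma ink_spots (μ : Measure E) [μ.IsAddHaarMeasure] {κ : ℝ} (hκ : 0 < κ) (hκ1 : κ < 1)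
    {S D : Set E} (hS : MeasurableSet S) (hSB : S ⊆ ball 0 1)
    (hS0 : μ S ≤ ENNReal.ofReal (1 - κ) * μ (closedBall (0:E) 1))
    (h : ∀ y : E, ∀ r : ℝ, 0 < r → ‖y‖ + r ≤ 1 →
      ENNReal.ofReal (1 - κ) * μ (closedBall y r) < μ (S ∩ closedBall y r) →
      closedBall y (3 * r) ∩ closedBall 0 1 ⊆ D) :
    ENNReal.ofReal κ * μ S ≤ ENNReal.ofReal (5 ^ Module.finrank ℝ E) * μ (D \ S) := by
  have hdens := IsUnifLocDoublingMeasure.ae_tendsto_measure_inter_div μ S 1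
  -- good points
  obtain ⟨T, hTS, hT0, hT⟩ : ∃ T ⊆ S, μ (S \ T) = 0 ∧ ∀ x ∈ T, ∃ y : E, ∃ r : ℝ, 0 < r ∧ r ≤ 1 ∧
      x ∈ closedBall y r ∧ closedBall y r ⊆ D ∧
      μ (S ∩ closedBall y r) ≤ ENNReal.ofReal (1 - κ) * μ (closedBall y r) := by
    rw [ae_restrict_iff' hS] at hdens
    refine ⟨{x ∈ S | ∃ y : E, ∃ r : ℝ, 0 < r ∧ r ≤ 1 ∧
      x ∈ closedBall y r ∧ closedBall y r ⊆ D ∧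
      μ (S ∩ closedBall y r) ≤ ENNReal.ofReal (1 - κ) * μ (closedBall y r)}, fun x hx => hx.1,
      ?_, fun x hx => hx.2⟩
    refine measure_mono_null ?_ hdens
    rintro x ⟨hx, hx'⟩ hx2
    apply hx'
    refine ⟨hx, ?_⟩
    have hxn : ‖x‖ < 1 := by simpa using hSB hx
    have hlim := hx2 hx (l := atTop) (fun j : ℕ => (1 - (1/2:ℝ) ^ j) • x) (fun j : ℕ => (1/2:ℝ) ^ j)
      (by
        rw [tendsto_nhdsWithin_iff]
        exact ⟨tendsto_pow_atTop_nhds_zero_of_lt_one (by norm_num) (by norm_num),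
          Eventually.of_forall fun j => by simp only [mem_Ioi]; positivity⟩)
      (Eventually.of_forall fun j => by
        rw [mem_closedBall_iff_norm, one_mul]
        have e : x - (1 - (1/2:ℝ) ^ j) • x = ((1/2:ℝ) ^ j) • x := by module
        rw [e, norm_smul, Real.norm_of_nonneg (by positivity)]
        have : 0 < (1/2:ℝ) ^ j := by positivity
        nlinarith)
    have hev := hlim.eventually (lt_mem_nhds (a := ENNReal.ofReal (1 - κ)) (by
      rw [← ENNReal.ofReal_one]
      exact (ENNReal.ofReal_lt_ofReal_iff one_pos).2 (by linarith)))
    obtain ⟨j0, hj0⟩ := hev.exists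
    let Q : ℕ → Prop := fun j => ENNReal.ofReal (1 - κ) * μ (closedBall ((1 - (1/2:ℝ) ^ j) • x) ((1/2:ℝ) ^ j)) <
      μ (S ∩ closedBall ((1 - (1/2:ℝ) ^ j) • x) ((1/2:ℝ) ^ j))
    have hQ : ∃ j, Q j := ⟨j0, by
      have := ENNReal.mul_lt_of_lt_div hj0
      exact this⟩
    classical
    have hfind := Nat.find_spec hQ
    have hmin := fun m => Nat.find_min hQ (m := m)
    generalize Nat.find hQ = j at *
    cases j with
    | zero =>
      exfalso
      simp only [Q, pow_zero, sub_self, zero_smul] at hfind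
      exact absurd (hfind.trans_le (measure_mono inter_subset_left)) (not_lt.2 hS0)
    | succ i =>
      have hi := hmin i (Nat.lt_succ_self i)
      simp only [Q, not_lt] at hi hfind
      obtain ⟨ρ, hρ⟩ : ∃ ρ, ρ = (1/2:ℝ) ^ i := ⟨_, rfl⟩
      have hρ0 : 0 < ρ := by rw [hρ]; positivity
      have hρ1 : ρ ≤ 1 := by rw [hρ]; exact pow_le_one₀ (by norm_num) (by norm_num)
      have hρ2 : (1/2:ℝ) ^ (i+1) = ρ / 2 := by rw [hρ, pow_succ]; ring
      rw [hρ2] at hfind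
      rw [← hρ] at hi
      have hsub := h _ _ (by positivity) (by
        rw [norm_smul, Real.norm_of_nonneg (by linarith)]
        nlinarith) hfind
      refine ⟨_, ρ, hρ0, hρ1, ?_, ?_, hi⟩
      · rw [mem_closedBall_iff_norm]
        have e : x - (1 - ρ) • x = ρ • x := by module
        rw [e, norm_smul, Real.norm_of_nonneg hρ0.le]
        nlinarith
      · refine Subset.trans (subset_inter ?_ ?_) hsub
        · apply closedBall_subset_closedBall'
          rw [dist_eq_norm]
          have e : (1 - ρ) • x - (1 - ρ / 2) • x = (-(ρ/2)) • x := by module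
          rw [e, norm_smul, norm_neg, Real.norm_of_nonneg (by positivity)]
          nlinarith
        · apply closedBall_subset_closedBall'
          rw [dist_zero_right, norm_smul, Real.norm_of_nonneg (by linarith)]
          nlinarith
  choose! y r hr0 hr1 hxy hyD hyS using hT
  obtain ⟨V, hVT, hVd, hVc⟩ := Vitali.exists_disjoint_subfamily_covering_enlargement_closedBall T y r 1
    hr1 5 (by norm_num)
  have hVcount : V.Countable := hVd.countable_of_nonempty_interior (fun i hi => by
    refine ⟨y i, ?_⟩
    apply ball_subset_interior_closedBall
    exact mem_ball_self (hr0 i (hVT hi)))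
  have h1 : μ S ≤ μ (⋃ b ∈ V, closedBall (y b) (5 * r b)) := by
    calc μ S ≤ μ (T ∪ (S \ T)) := measure_mono (by rw [union_sdiff_self]; exact subset_union_right)
      _ ≤ μ T + μ (S \ T) := measure_union_le _ _
      _ = μ T := by rw [hT0, add_zero]
      _ ≤ _ := measure_mono (fun x hx => by
        obtain ⟨b, hb, hb2⟩ := hVc x hx
        exact mem_biUnion hb (hb2 (hxy x hx)))
  have h2 : μ (⋃ b ∈ V, closedBall (y b) (5 * r b)) ≤ ∑' b : V, μ (closedBall (y b) (5 * r b)) :=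
    measure_biUnion_le _ hVcount _
  have hball : ∀ b ∈ T, ENNReal.ofReal κ * μ (closedBall (y b) (5 * r b)) ≤
      ENNReal.ofReal (5 ^ Module.finrank ℝ E) * μ (closedBall (y b) (r b) \ S) := by
    intro b hb
    rw [Measure.addHaar_closedBall_mul_of_pos μ (y b) (by norm_num : (0:ℝ) < 5), mul_left_comm,
      ← Measure.addHaar_closedBall_center μ (y b)]
    gcongr
    have h3 := hyS b hb
    have hfin : μ (closedBall (y b) (r b)) ≠ ⊤ := (isCompact_closedBall _ _).measure_lt_top.ne
    have h4 := measure_inter_add_sdiff (μ := μ) (closedBall (y b) (r b)) hS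
    rw [inter_comm] at h4
    have h5 : ENNReal.ofReal κ * μ (closedBall (y b) (r b)) +
        ENNReal.ofReal (1 - κ) * μ (closedBall (y b) (r b)) = μ (closedBall (y b) (r b)) := by
      rw [← add_mul, ← ENNReal.ofReal_add hκ.le (by linarith)]
      simp
    have h6 : ENNReal.ofReal (1 - κ) * μ (closedBall (y b) (r b)) ≠ ⊤ :=
      ENNReal.mul_ne_top ENNReal.ofReal_ne_top hfin
    rw [← ENNReal.add_le_add_iff_right h6, h5]
    calc _ = _ := h4.symm
      _ = μ (closedBall (y b) (r b) \ S) + μ (S ∩ closedBall (y b) (r b)) := add_comm _ _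
      _ ≤ _ := by gcongr
  calc ENNReal.ofReal κ * μ S ≤ ENNReal.ofReal κ * ∑' b : V, μ (closedBall (y b) (5 * r b)) := by
        gcongr; exact h1.trans h2
    _ = ∑' b : V, ENNReal.ofReal κ * μ (closedBall (y b) (5 * r b)) := ENNReal.tsum_mul_left.symm
    _ ≤ ∑' b : V, ENNReal.ofReal (5 ^ Module.finrank ℝ E) * μ (closedBall (y b) (r b) \ S) :=
        ENNReal.tsum_le_tsum fun b => hball b (hVT b.2)
    _ = ENNReal.ofReal (5 ^ Module.finrank ℝ E) * ∑' b : V, μ (closedBall (y b) (r b) \ S) :=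
        ENNReal.tsum_mul_left
    _ = ENNReal.ofReal (5 ^ Module.finrank ℝ E) * μ (⋃ b ∈ V, (closedBall (y b) (r b) \ S)) := by
        rw [measure_biUnion hVcount]
        · exact hVd.mono fun b => sdiff_subset
        · intro b _; exact measurableSet_closedBall.diff hS
    _ ≤ _ := by
        gcongr
        intro x hx
        simp only [mem_iUnion] at hx
        obtain ⟨b, hb, hx⟩ := hx
        exact ⟨hyD b (hVT hb) hx.1, hx.2⟩

end KS8

section KS9
open Filter
variable {E : Type*} [NormedAddCommGroup E] [InnerProductSpace ℝ E]
  [FiniteDimensional ℝ E] [MeasurableSpace E] [BorelSpace E]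

set_option maxHeartbeats 1000000 in
/-- decay of superlevel sets -/
lemma level_decay (μ : Measure E) [μ.IsAddHaarMeasure] {lam Lam : ℝ} (hlam : 0 < lam)
    (hlL : lam ≤ Lam) : ∃ K : ℝ, 0 < K ∧ ∀ F : (E →L[ℝ] E) → ℝ, Ell lam Lam F →
      ∀ a b : E → ℝ, ContinuousOn a (ball 0 5) → ContinuousOn b (ball 0 5) →
      SubV (fun _ A => dualF F A ≤ 0) (ball 0 5) a → SubV (fun _ A => F A ≤ 0) (ball 0 5) b →
      (∀ x ∈ ball (0:E) 5, a x + b x ≤ 0) → ∀ x1 ∈ closedBall (0:E) 3, -1 ≤ a x1 + b x1 →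
      2 * μ.real {x ∈ ball (0:E) 1 | K < -(a x + b x)} < μ.real (ball (0:E) 1) := by
  obtain ⟨M, κ, hM, hκ, hκ1, H⟩ := meas_est_scaled μ hlam hlL
  have hproper : ProperSpace E := FiniteDimensional.proper_real E
  obtain ⟨N, hN⟩ : ∃ N : ℝ, N = 5 ^ Module.finrank ℝ E := ⟨_, rfl⟩
  have hN0 : 0 < N := by rw [hN]; positivity
  have hγ1 : N / (N + κ) < 1 := by rw [div_lt_one (by positivity)]; linarith
  have hγ0 : 0 < N / (N + κ) := by positivity
  obtain ⟨m, hm⟩ := exists_pow_lt_of_lt_one (by norm_num : (0:ℝ) < 1/2) hγ1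
  refine ⟨M ^ (m + 1), by positivity, ?_⟩
  intro F hF a b hac hbc ha hb hab x1 hx1 hx1v
  have hM0 : 0 < M := by linarith
  obtain ⟨v, hv⟩ : ∃ v : E → ℝ, v = fun x => -(a x + b x) := ⟨_, rfl⟩
  have hvc : ContinuousOn v (ball 0 5) := by rw [hv]; exact (hac.add hbc).neg
  let S : ℕ → Set E := fun k => {x ∈ ball (0:E) 1 | M ^ k < v x}
  have hSm : ∀ k, MeasurableSet (S k) := by
    intro k
    have h1 : IsOpen (ball (0:E) 1 ∩ v ⁻¹' (Ioi (M ^ k))) :=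
      (hvc.mono (ball_subset_ball (by norm_num))).isOpen_inter_preimage isOpen_ball isOpen_Ioi
    exact h1.measurableSet
  have hSB : ∀ k, S k ⊆ ball 0 1 := fun k x hx => hx.1
  have hbe : ∀ (y : E) {r : ℝ}, 0 < r → μ (closedBall y r) = μ (ball y r) := by
    intro y r hr
    rw [Measure.addHaar_closedBall μ y hr.le, Measure.addHaar_ball_of_pos μ y hr]
  have hfinb : ∀ (y : E) (r : ℝ), μ (closedBall y r) ≠ ⊤ :=
    fun y r => (isCompact_closedBall _ _).measure_lt_top.ne
  -- main consequence of the measure estimate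
  have hcons : ∀ k : ℕ, ∀ y : E, ∀ r : ℝ, 0 < r → ‖y‖ + r ≤ 1 → ∀ x2 ∈ closedBall y (3 * r),
      v x2 ≤ M ^ k → μ (S (k+1) ∩ closedBall y r) ≤ ENNReal.ofReal (1 - κ) * μ (closedBall y r) := by
    intro k y r hr hyr x2 hx2 hx2v
    have hsub : ball y (5 * r) ⊆ ball 0 5 := by
      apply ball_subset_ball'
      rw [dist_zero_right]
      have := norm_nonneg y
      linarith
    have h1 := H F hF y r (M ^ k) hr (by positivity) a b (hac.mono hsub) (hbc.mono hsub)
      (ha.mono hsub fun _ _ _ h => h) (hb.mono hsub fun _ _ _ h => h) (fun x hx => hab x (hsub hx))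
      x2 hx2 (by rw [hv] at hx2v; linarith)
    have h2 : μ (S (k+1) ∩ closedBall y r) + μ {x ∈ ball y r | -(a x + b x) ≤ M * M ^ k} ≤
        μ (closedBall y r) := by
      rw [← measure_union']
      · apply measure_mono
        rintro x (hx | hx)
        · exact hx.2
        · exact ball_subset_closedBall hx.1
      · rw [disjoint_left]
        rintro x hx hx'
        have h3 := hx.1.2
        have h4 := hx'.2
        rw [hv, pow_succ] at h3
        simp only at h3
        linarith
      · exact (hSm _).inter measurableSet_closedBall
    have h5 : ENNReal.ofReal κ * μ (closedBall y r) +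
        ENNReal.ofReal (1 - κ) * μ (closedBall y r) = μ (closedBall y r) := by
      rw [← add_mul, ← ENNReal.ofReal_add hκ.le (by linarith)]
      simp
    have h6 : ENNReal.ofReal κ * μ (closedBall y r) ≠ ⊤ :=
      ENNReal.mul_ne_top ENNReal.ofReal_ne_top (hfinb _ _)
    rw [← ENNReal.add_le_add_iff_left h6, h5]
    refine le_trans ?_ h2
    rw [add_comm]
    gcongr
    rw [hbe y hr]
    exact h1
  have hS1 : ∀ k : ℕ, μ (S (k+1)) ≤ ENNReal.ofReal (1 - κ) * μ (closedBall (0:E) 1) := by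
    intro k
    have h1 := hcons k 0 1 one_pos (by simp) x1 (by simpa using hx1) (by
      have : 1 ≤ M ^ k := one_le_pow₀ hM.le
      rw [hv]; simp only; linarith)
    refine le_trans (measure_mono ?_) h1
    intro x hx
    exact ⟨hx, ball_subset_closedBall hx.1⟩
  have hfin : ∀ k, μ (S k) ≠ ⊤ := fun k =>
    ne_top_of_le_ne_top (hfinb 0 1) (measure_mono ((hSB k).trans ball_subset_closedBall))
  have hstep : ∀ k : ℕ, μ.real (S (k+1)) ≤ N / (N + κ) * μ.real (S k) := by
    intro k
    have h1 := ink_spots μ hκ hκ1 (D := {x ∈ closedBall (0:E) 1 | M ^ k < v x}) (hSm (k+1))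
      (hSB (k+1)) (hS1 k) (by
        intro y r hr hyr hlt x hx
        refine ⟨hx.2, ?_⟩
        by_contra hcon
        push Not at hcon
        exact absurd hlt (not_lt.2 (hcons k y r hr hyr x hx.1 hcon)))
    have h2 : μ ({x ∈ closedBall (0:E) 1 | M ^ k < v x} \ S (k+1)) ≤ μ (S k \ S (k+1)) := by
      calc _ ≤ μ ((S k \ S (k+1)) ∪ sphere (0:E) 1) := by
            apply measure_mono
            rintro x ⟨⟨hx1, hx2⟩, hx3⟩
            rcases (mem_closedBall.1 hx1).lt_or_eq with h | h
            · left; exact ⟨⟨mem_ball.2 h, hx2⟩, hx3⟩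
            · right; exact h
        _ ≤ _ := measure_union_le _ _
        _ = _ := by rw [Measure.addHaar_sphere_of_ne_zero μ 0 one_ne_zero, add_zero]
    have h3 : S (k+1) ⊆ S k := by
      rintro x ⟨hx, hx2⟩
      refine ⟨hx, lt_of_le_of_lt ?_ hx2⟩
      exact pow_le_pow_right₀ hM.le (Nat.le_succ k)
    have h4 : κ * μ.real (S (k+1)) ≤ N * (μ.real (S k) - μ.real (S (k+1))) := by
      have h5 : μ.real (S k \ S (k+1)) = μ.real (S k) - μ.real (S (k+1)) :=
        measureReal_sdiff h3 (hSm _) (hfin _)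
      rw [← h5]
      have h6 := h1.trans (mul_le_mul' le_rfl h2)
      have h7 := ENNReal.toReal_mono (ENNReal.mul_ne_top ENNReal.ofReal_ne_top
        (ne_top_of_le_ne_top (hfin k) (measure_mono sdiff_subset))) h6
      rw [ENNReal.toReal_mul, ENNReal.toReal_mul, ENNReal.toReal_ofReal hκ.le,
        ENNReal.toReal_ofReal (by positivity), ← hN] at h7
      exact h7
    rw [div_mul_eq_mul_div, le_div_iff₀ (by positivity)]
    linarith
  have hall : ∀ k : ℕ, μ.real (S k) ≤ (N / (N + κ)) ^ k * μ.real (ball (0:E) 1) := by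
    intro k
    induction k with
    | zero =>
      rw [pow_zero, one_mul]
      exact measureReal_mono (hSB 0) (ne_top_of_le_ne_top (hfinb 0 1) (measure_mono ball_subset_closedBall))
    | succ k ih =>
      refine (hstep k).trans ?_
      rw [pow_succ', mul_assoc]
      gcongr
  have hpos : 0 < μ.real (ball (0:E) 1) := by
    rw [measureReal_def]
    exact ENNReal.toReal_pos (measure_ball_pos μ 0 one_pos).ne'
      (ne_top_of_le_ne_top (hfinb 0 1) (measure_mono ball_subset_closedBall))
  have hfinal := hall (m+1)
  have e : {x ∈ ball (0:E) 1 | M ^ (m+1) < -(a x + b x)} = S (m+1) := by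
    rw [show S (m+1) = {x ∈ ball (0:E) 1 | M ^ (m+1) < v x} from rfl, hv]
  rw [e]
  have : (N / (N + κ)) ^ (m+1) < 1/2 := by
    refine lt_of_le_of_lt ?_ hm
    rw [pow_succ]
    exact mul_le_of_le_one_right (by positivity) hγ1.le
  nlinarith

/-- Harmonic functions: subsolution and supersolution -/
def Harm (F : (E →L[ℝ] E) → ℝ) (U : Set E) (u : E → ℝ) : Prop :=
  ContinuousOn u U ∧ SubV (fun _ A => F A ≤ 0) U u ∧
    SubV (fun _ A => dualF F A ≤ 0) U (fun x => - u x)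

lemma osc_unit {lam Lam : ℝ} (hlam : 0 < lam)
    (hlL : lam ≤ Lam) : ∃ θ : ℝ, 0 < θ ∧ θ < 1 ∧ ∀ F : (E →L[ℝ] E) → ℝ, Ell lam Lam F →
      ∀ u w : E → ℝ, Harm F (ball 0 5) u → Harm F (ball 0 5) w →
      (∀ x ∈ ball (0:E) 5, 0 ≤ u x - w x ∧ u x - w x ≤ 1) →
      (∀ x ∈ ball (0:E) 1, θ ≤ u x - w x) ∨ (∀ x ∈ ball (0:E) 1, u x - w x ≤ 1 - θ) := by
  obtain ⟨μ, hμ⟩ : ∃ μ : Measure E, μ.IsAddHaarMeasure := ⟨Measure.addHaar, inferInstance⟩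
  obtain ⟨K, hK, H⟩ := level_decay μ hlam hlL
  have hθ : 0 < 1 / (2 * K + 2) := by positivity
  refine ⟨1 / (2 * K + 2), hθ, ?_, ?_⟩
  · rw [div_lt_one (by positivity)]; linarith
  obtain ⟨θ, hθd⟩ : ∃ θ, θ = 1 / (2 * K + 2) := ⟨_, rfl⟩
  rw [← hθd] at hθ ⊢
  have hθK : θ * K < 1/2 := by
    rw [hθd, div_mul_eq_mul_div, div_lt_iff₀ (by positivity)]; linarith
  intro F hF u w hu hw huw
  by_contra hcon
  push Not at hcon
  obtain ⟨⟨x1, hx1, hx1v⟩, ⟨x2, hx2, hx2v⟩⟩ := hcon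
  have scale : ∀ (k : ℝ) (G : (E →L[ℝ] E) → ℝ) (f : E → ℝ), SubV (fun _ A => G A ≤ 0) (ball 0 5) f →
      SubV (fun _ A => θ⁻¹ * G (θ • A) ≤ 0) (ball 0 5) (fun x => (f x + k) / θ) := by
    intro k G f hf
    have := hf.rescale one_pos hθ 0 k
    simp only [one_smul, zero_add, div_one, one_pow] at this
    exact this.mono (fun x hx => hx) fun p A _ h =>
      mul_nonpos_of_nonneg_of_nonpos (by positivity) h
  have hdual : ∀ f k, SubV (fun _ A => dualF F A ≤ 0) (ball (0:E) 5) f →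
      SubV (fun _ A => dualF (fun A => θ⁻¹ * F (θ • A)) A ≤ 0) (ball 0 5) (fun x => (f x + k) / θ) := by
    intro f k hf
    refine (scale k _ f hf).mono subset_rfl fun p A _ h => ?_
    simp only [dualF] at h ⊢
    rw [← smul_neg] at h
    linarith
  have hFθ : Ell lam Lam (fun A => θ⁻¹ * F (θ • A)) := hF.rescale hθ
  have hb13 : ∀ x ∈ ball (0:E) 1, x ∈ closedBall (0:E) 3 := fun x hx =>
    ball_subset_closedBall (ball_subset_ball (by norm_num) hx)
  have h1 := H _ hFθ (fun x => (-u x + 0) / θ) (fun x => (w x + 0) / θ)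
    ((hu.1.neg.add continuousOn_const).div_const _) ((hw.1.add continuousOn_const).div_const _)
    (hdual _ _ hu.2.2) (scale _ _ _ hw.2.1)
    (fun x hx => by
      rw [← add_div]
      exact div_nonpos_of_nonpos_of_nonneg (by linarith [(huw x hx).1]) hθ.le)
    x1 (hb13 x1 hx1) (by rw [← add_div, le_div_iff₀ hθ]; linarith)
  have h2 := H _ hFθ (fun x => (-w x + (-1)) / θ) (fun x => (u x + 0) / θ)
    ((hw.1.neg.add continuousOn_const).div_const _) ((hu.1.add continuousOn_const).div_const _)
    (hdual _ _ hw.2.2) (scale _ _ _ hu.2.1)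
    (fun x hx => by
      rw [← add_div]
      exact div_nonpos_of_nonpos_of_nonneg (by linarith [(huw x hx).2]) hθ.le)
    x2 (hb13 x2 hx2) (by rw [← add_div, le_div_iff₀ hθ]; linarith)
  have hcov : ball (0:E) 1 ⊆ {x ∈ ball (0:E) 1 | K < -((-u x + 0) / θ + (w x + 0) / θ)} ∪
      {x ∈ ball (0:E) 1 | K < -((-w x + (-1)) / θ + (u x + 0) / θ)} := by
    intro x hx
    by_cases h : 1/2 ≤ u x - w x
    · left
      refine ⟨hx, ?_⟩
      rw [← add_div, ← neg_div, lt_div_iff₀ hθ]; linarith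
    · right
      refine ⟨hx, ?_⟩
      rw [← add_div, ← neg_div, lt_div_iff₀ hθ]; linarith
  have hproper : ProperSpace E := FiniteDimensional.proper_real E
  have hfinb : μ (ball (0:E) 1) ≠ ⊤ := ne_top_of_le_ne_top (isCompact_closedBall (0:E) 1).measure_lt_top.ne
    (measure_mono ball_subset_closedBall)
  have h3 := measureReal_mono (μ := μ) hcov (ne_top_of_le_ne_top hfinb (measure_mono (by
    rintro x (hx | hx) <;> exact hx.1)))
  have h4 := measureReal_union_le (μ := μ) {x ∈ ball (0:E) 1 | K < -((-u x + 0) / θ + (w x + 0) / θ)}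
      {x ∈ ball (0:E) 1 | K < -((-w x + (-1)) / θ + (u x + 0) / θ)}
  linarith

end KS9

section KS10
open Filter
variable {E : Type*} [NormedAddCommGroup E] [InnerProductSpace ℝ E]

lemma Harm.rescale {F : (E →L[ℝ] E) → ℝ} {U V : Set E} {u : E → ℝ} (hu : Harm F U u)
    {r t : ℝ} (hr : 0 < r) (ht : 0 < t) (x0 : E) (k : ℝ) (hV : ∀ x ∈ V, x0 + r • x ∈ U) :
    Harm (fun A => (t / r ^ 2)⁻¹ * F ((t / r ^ 2) • A)) V (fun x => (u (x0 + r • x) + k) / t) := by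
  refine ⟨((hu.1.comp (by fun_prop) hV).add continuousOn_const).div_const t, ?_, ?_⟩
  · refine (hu.2.1.rescale hr ht x0 k).mono hV fun p A _ h => ?_
    exact mul_nonpos_of_nonneg_of_nonpos (by positivity) h
  · have h1 := (hu.2.2.rescale hr ht x0 (-k)).mono (G' := fun _ A => dualF (fun A => (t / r ^ 2)⁻¹ * F ((t / r ^ 2) • A)) A ≤ 0)
      hV fun p A _ h => by
        simp only [dualF] at h ⊢
        rw [← smul_neg] at h
        have : 0 ≤ (t / r ^ 2)⁻¹ * (F ((t / r ^ 2) • (-A))) := by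
          apply mul_nonneg (by positivity); linarith
        linarith
    have e : (fun x => (-u (x0 + r • x) + -k) / t) = fun x => -((u (x0 + r • x) + k) / t) := by
      funext x; ring
    rwa [e] at h1

lemma Harm.mono {F : (E →L[ℝ] E) → ℝ} {U V : Set E} {u : E → ℝ} (hu : Harm F U u) (h : V ⊆ U) :
    Harm F V u :=
  ⟨hu.1.mono h, hu.2.1.mono h fun _ _ _ h => h, hu.2.2.mono h fun _ _ _ h => h⟩

lemma Harm.translate {F : (E →L[ℝ] E) → ℝ} {U V : Set E} {u : E → ℝ} (hu : Harm F U u) (h : E)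
    (hV : ∀ x ∈ V, x + h ∈ U) : Harm F V (fun x => u (x + h)) := by
  have := hu.rescale (V := V) one_pos one_pos h 0 (by
    intro x hx; rw [one_smul, add_comm]; exact hV x hx)
  simpa [add_comm] using this

variable [FiniteDimensional ℝ E] [MeasurableSpace E] [BorelSpace E]

lemma osc_scaled {lam Lam : ℝ} (hlam : 0 < lam)
    (hlL : lam ≤ Lam) : ∃ θ : ℝ, 0 < θ ∧ θ < 1 ∧ ∀ F : (E →L[ℝ] E) → ℝ, Ell lam Lam F →
      ∀ u w : E → ℝ, ∀ r t m : ℝ, 0 < r → 0 < t → Harm F (ball 0 (r * 5)) u → Harm F (ball 0 (r * 5)) w →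
      (∀ x ∈ ball (0:E) (r * 5), m ≤ u x - w x ∧ u x - w x ≤ m + t) →
      ∃ m', ∀ x ∈ ball (0:E) r, m' ≤ u x - w x ∧ u x - w x ≤ m' + (1 - θ) * t := by
  obtain ⟨θ, hθ, hθ1, H⟩ := osc_unit (E := E) hlam hlL
  refine ⟨θ, hθ, hθ1, ?_⟩
  intro F hF u w r t m hr ht hu hw huw
  have hmaps : ∀ x ∈ ball (0:E) 5, 0 + r • x ∈ ball (0:E) (r * 5) := by
    intro x hx
    rw [← image_aff_ball 0 hr]
    exact ⟨x, hx, rfl⟩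
  have h1 := H _ (hF.rescale (by positivity)) _ _ (hu.rescale hr ht 0 (-m) hmaps)
    (hw.rescale hr ht 0 0 hmaps) (by
      intro x hx
      have := huw _ (hmaps x hx)
      rw [← sub_div]
      constructor
      · apply div_nonneg _ ht.le; linarith
      · rw [div_le_one ht]; linarith)
  have hback : ∀ x ∈ ball (0:E) r, ∃ y ∈ ball (0:E) 1, x = 0 + r • y := by
    intro x hx
    have := image_aff_ball (0:E) hr 1
    rw [mul_one] at this
    rw [← this] at hx
    obtain ⟨y, hy, rfl⟩ := hx
    exact ⟨y, hy, rfl⟩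
  have hin : ∀ x ∈ ball (0:E) r, x ∈ ball (0:E) (r * 5) := fun x hx =>
    ball_subset_ball (by linarith) hx
  rcases h1 with h1 | h1
  · refine ⟨m + θ * t, fun x hx => ?_⟩
    have h2 := huw x (hin x hx)
    obtain ⟨y, hy, rfl⟩ := hback x hx
    have h3 := h1 y hy
    rw [← sub_div, le_div_iff₀ ht] at h3
    constructor <;> nlinarith
  · refine ⟨m, fun x hx => ?_⟩
    have h2 := huw x (hin x hx)
    obtain ⟨y, hy, rfl⟩ := hback x hx
    have h3 := h1 y hy
    rw [← sub_div, div_le_iff₀ ht] at h3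
    constructor <;> nlinarith

/-- interior gradient closeness for Lipschitz solutions -/
lemma grad_close {lam Lam : ℝ} (hlam : 0 < lam) (hlL : lam ≤ Lam) {L : ℝ} (hL : 0 < L) :
    ∃ σ : ℝ, 0 < σ ∧ σ ≤ 1/4 ∧ ∀ F : (E →L[ℝ] E) → ℝ, Ell lam Lam F →
      ∀ u : E → ℝ, Harm F (ball 0 (1/2)) u →
      (∀ x ∈ ball (0:E) (1/2), ∀ y ∈ ball (0:E) (1/2), |u x - u y| ≤ L * ‖x - y‖) →
      ∃ p : E, ∀ x ∈ ball (0:E) σ, ∀ y ∈ ball (0:E) σ, |u x - u y - inner ℝ p (x - y)| ≤ ‖x - y‖ / 16 := by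
  obtain ⟨θ, hθ, hθ1, H⟩ := osc_scaled (E := E) hlam hlL
  obtain ⟨k, hk⟩ := exists_pow_lt_of_lt_one (by positivity : (0:ℝ) < 1 / (32 * L)) (by linarith : 1 - θ < 1)
  have hLk : (1 - θ) ^ k * (2 * L) ≤ 1/16 := by
    rw [lt_div_iff₀ (by positivity)] at hk; linarith
  refine ⟨(1/5) ^ k / 4, by positivity, ?_, ?_⟩
  · have : (1/5:ℝ) ^ k ≤ 1 := pow_le_one₀ (by norm_num) (by norm_num)
    linarith
  intro F hF u hu hlip
  obtain ⟨σ, hσd⟩ : ∃ σ : ℝ, σ = (1/5) ^ k / 4 := ⟨_, rfl⟩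
  have hσ0 : 0 < σ := by rw [hσd]; positivity
  have hσ4 : σ ≤ 1/4 := by
    have : (1/5:ℝ) ^ k ≤ 1 := pow_le_one₀ (by norm_num) (by norm_num)
    linarith
  rw [← hσd]
  -- second differences
  have hsd : ∀ h : E, ‖h‖ ≤ 1/8 → h ≠ 0 → ∀ x ∈ ball (0:E) σ, ∀ y ∈ ball (0:E) σ,
      |(u (x + h) - u x) - (u (y + h) - u y)| ≤ ‖h‖ / 16 := by
    intro h hh hne
    have hh0 : 0 < ‖h‖ := norm_pos_iff.2 hne
    have hin : ∀ x ∈ ball (0:E) (1/4), x + h ∈ ball (0:E) (1/2) := by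
      intro x hx
      rw [mem_ball_zero_iff] at hx ⊢
      have := norm_add_le x h
      linarith
    have hin2 : ball (0:E) (1/4) ⊆ ball 0 (1/2) := ball_subset_ball (by norm_num)
    have hharm1 : Harm F (ball 0 (1/4)) (fun x => u (x + h)) := hu.translate h hin
    have hharm2 : Harm F (ball 0 (1/4)) u := hu.mono hin2
    have hiter : ∀ j : ℕ, ∃ m, ∀ x ∈ ball (0:E) ((1/5) ^ j / 4), m ≤ u (x + h) - u x ∧
        u (x + h) - u x ≤ m + (1 - θ) ^ j * (2 * L * ‖h‖) := by
      intro j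
      induction j with
      | zero =>
        refine ⟨-(L * ‖h‖), fun x hx => ?_⟩
        rw [pow_zero] at hx
        have := hlip _ (hin x hx) _ (hin2 hx)
        rw [add_sub_cancel_left, abs_le] at this
        constructor <;> linarith
      | succ j ih =>
        obtain ⟨m, hm⟩ := ih
        have e : (1/5:ℝ) ^ (j+1) / 4 * 5 = (1/5) ^ j / 4 := by rw [pow_succ]; ring
        have hle : ball (0:E) ((1/5) ^ j / 4) ⊆ ball 0 (1/4) := by
          apply ball_subset_ball
          have : (1/5:ℝ) ^ j ≤ 1 := pow_le_one₀ (by norm_num) (by norm_num)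
          linarith
        obtain ⟨m', hm'⟩ := H F hF (fun x => u (x + h)) u ((1/5) ^ (j+1) / 4) ((1 - θ) ^ j * (2 * L * ‖h‖)) m
          (by positivity) (by have : 0 < 1 - θ := by linarith
                              positivity)
          (by rw [e]; exact hharm1.mono hle) (by rw [e]; exact hharm2.mono hle) (by rw [e]; exact hm)
        refine ⟨m', fun x hx => ?_⟩
        have := hm' x hx
        refine ⟨this.1, ?_⟩
        rw [pow_succ']
        linarith [this.2]
    obtain ⟨m, hm⟩ := hiter k
    rw [← hσd] at hm
    intro x hx y hy
    have h1 := hm x hx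
    have h2 := hm y hy
    have h3 : (1 - θ) ^ k * (2 * L * ‖h‖) ≤ ‖h‖ / 16 := by nlinarith
    rw [abs_le]
    constructor <;> linarith
  -- Rademacher point
  have hLip : LipschitzOnWith (Real.toNNReal L) u (ball 0 (1/2)) := by
    apply LipschitzOnWith.of_dist_le_mul
    intro x hx y hy
    rw [Real.dist_eq, dist_eq_norm, Real.coe_toNNReal _ hL.le]
    exact hlip x hx y hy
  obtain ⟨g, hg, hgu⟩ := hLip.extend_real
  obtain ⟨y0, hy0, hdiff⟩ : ∃ y0 ∈ ball (0:E) σ, DifferentiableAt ℝ g y0 := by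
    have h1 := hg.ae_differentiableAt (μ := (Measure.addHaar : Measure E))
    by_contra hcon
    push Not at hcon
    have h2 : ball (0:E) σ ⊆ {x | ¬ DifferentiableAt ℝ g x} := fun x hx => hcon x hx
    have h3 := measure_mono_null h2 h1
    exact (measure_ball_pos (Measure.addHaar : Measure E) 0 hσ0).ne' h3
  have hder := hdiff.hasFDerivAt
  refine ⟨(InnerProductSpace.toDual ℝ E).symm (fderiv ℝ g y0), ?_⟩
  intro x hx y hy
  rw [InnerProductSpace.toDual_symm_apply]
  by_cases hxy : x = y
  · subst hxy; simp
  obtain ⟨d, hd⟩ : ∃ d, d = x - y := ⟨_, rfl⟩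
  have hdne : d ≠ 0 := by rw [hd]; exact sub_ne_zero.2 hxy
  rw [← hd]
  have hy12 : ∀ z ∈ ball (0:E) σ, z ∈ ball (0:E) (1/2) := fun z hz => ball_subset_ball (by linarith) hz
  have hdn : ‖d‖ ≤ 1/2 := by
    rw [hd]
    rw [mem_ball_zero_iff] at hx hy
    have := norm_sub_le x y
    linarith
  have htel : ∀ N : ℕ, 4 ≤ N → |u x - u y - (N:ℝ) * (u (y0 + (N:ℝ)⁻¹ • d) - u y0)| ≤ ‖d‖ / 16 := by
    intro N hN
    have hN0 : (0:ℝ) < N := by exact_mod_cast (by omega : 0 < N)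
    have hN4 : (4:ℝ) ≤ N := by exact_mod_cast hN
    have hhn : ‖(N:ℝ)⁻¹ • d‖ = ‖d‖ / N := by
      rw [norm_smul, Real.norm_of_nonneg (by positivity)]; ring
    have hh8 : ‖(N:ℝ)⁻¹ • d‖ ≤ 1/8 := by
      rw [hhn, div_le_iff₀ hN0]; linarith
    have hhne : (N:ℝ)⁻¹ • d ≠ 0 := smul_ne_zero (by positivity) hdne
    have hseg : ∀ i : ℕ, i ≤ N → y + (i:ℝ) • ((N:ℝ)⁻¹ • d) ∈ ball (0:E) σ := by
      intro i hi
      have hi' : (i:ℝ) ≤ N := by exact_mod_cast hi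
      have e : y + (i:ℝ) • ((N:ℝ)⁻¹ • d) = (1 - (i:ℝ) / N) • y + ((i:ℝ) / N) • x := by
        rw [hd, smul_smul, ← div_eq_mul_inv]; module
      rw [e]
      exact convex_ball (0:E) σ hy hx (by rw [sub_nonneg, div_le_one hN0]; exact hi') (by positivity) (by ring)
    have hsum : ∀ i : ℕ, i ≤ N → |u (y + (i:ℝ) • ((N:ℝ)⁻¹ • d)) - u y -
        (i:ℝ) * (u (y0 + (N:ℝ)⁻¹ • d) - u y0)| ≤ i * (‖d‖ / N / 16) := by
      intro i
      induction i with
      | zero => intro _; simp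
      | succ i ih =>
        intro hi
        have h1 := ih (by omega)
        have h2 := hsd _ hh8 hhne _ (hseg i (by omega)) y0 hy0
        have e : y + ((i+1:ℕ):ℝ) • ((N:ℝ)⁻¹ • d) = y + (i:ℝ) • ((N:ℝ)⁻¹ • d) + (N:ℝ)⁻¹ • d := by
          push_cast; module
        rw [hhn] at h2
        rw [e]
        push_cast
        rw [abs_le] at *
        constructor <;> linarith
    have h1 := hsum N le_rfl
    have e : y + (N:ℝ) • ((N:ℝ)⁻¹ • d) = x := by
      rw [smul_smul, mul_inv_cancel₀ hN0.ne', one_smul, hd]; abel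
    rw [e] at h1
    refine h1.trans (le_of_eq ?_)
    field_simp
  have hlim := hder.lim d (l := atTop) (c := fun N : ℕ => (N:ℝ)) (by
    simp only [Real.norm_natCast]
    exact tendsto_natCast_atTop_atTop)
  have hlim2 : Tendsto (fun N : ℕ => |u x - u y - (N:ℝ) * (g (y0 + (N:ℝ)⁻¹ • d) - g y0)|) atTop
      (𝓝 |u x - u y - fderiv ℝ g y0 d|) := by
    simp only [smul_eq_mul] at hlim
    exact (tendsto_const_nhds.sub hlim).abs
  refine le_of_tendsto hlim2 ?_
  filter_upwards [eventually_ge_atTop 4] with N hN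
  have h1 := htel N hN
  have hN4 : (4:ℝ) ≤ N := by exact_mod_cast hN
  have hyN : y0 + (N:ℝ)⁻¹ • d ∈ ball (0:E) (1/2) := by
    rw [mem_ball_zero_iff] at hy0 ⊢
    have h2 := norm_add_le y0 ((N:ℝ)⁻¹ • d)
    have h3 : ‖(N:ℝ)⁻¹ • d‖ ≤ 1/8 := by
      rw [norm_smul, Real.norm_of_nonneg (by positivity), inv_mul_le_iff₀ (by linarith)]
      linarith
    linarith
  rw [← hgu (hy12 y0 hy0), ← hgu hyN]
  exact h1

end KS10

section KS11
open Filter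
variable {E : Type*} [NormedAddCommGroup E] [InnerProductSpace ℝ E]

lemma pr_inner (z w : WithLp 2 (E × E)) :
    inner ℝ z w = inner ℝ z.fst w.fst + inner ℝ z.snd w.snd := WithLp.prod_inner_apply z w

lemma HasT2.restrict_fst {f : E → ℝ} {z : WithLp 2 (E × E)} {P : E}
    {A : WithLp 2 (E × E) →L[ℝ] WithLp 2 (E × E)}
    (h : HasT2 (fun w : WithLp 2 (E × E) => f w.fst) z (WithLp.toLp 2 (P, 0)) A) (hA : SymOp A) :
    ∃ X : E →L[ℝ] E, SymOp X ∧ HasT2 f z.fst P X := by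
  let i1 : E →L[ℝ] WithLp 2 (E × E) :=
    ((WithLp.prodContinuousLinearEquiv 2 ℝ E E).symm : E × E →L[ℝ] WithLp 2 (E × E)) ∘L
      ContinuousLinearMap.inl ℝ E E
  have hi : ∀ d, i1 d = WithLp.toLp 2 (d, 0) := fun d => rfl
  let X : E →L[ℝ] E := (WithLp.fstL 2 ℝ E E) ∘L A ∘L i1
  have hX : ∀ d e, inner ℝ (X d) e = inner ℝ (A (i1 d)) (i1 e) := by
    intro d e
    rw [pr_inner, hi e]
    simp [X]
  refine ⟨X, ?_, ?_⟩
  · intro x y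
    rw [hX, hA, real_inner_comm, ← hX, real_inner_comm]
  · intro ε hε
    have hc : Tendsto (fun y : E => z + i1 (y - z.fst)) (𝓝 z.fst) (𝓝 z) := by
      have : Continuous (fun y : E => z + i1 (y - z.fst)) := by fun_prop
      have h2 := this.tendsto z.fst
      simpa using h2
    filter_upwards [hc.eventually (h ε hε)] with y hy
    simp only [add_sub_cancel_left] at hy
    rw [← hX] at hy
    have e1 : (z + i1 (y - z.fst)).fst = y := by rw [hi]; simp
    have e2 : ‖i1 (y - z.fst)‖ ^ 2 = ‖y - z.fst‖ ^ 2 := by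
      rw [hi, WithLp.prod_norm_sq_eq_of_L2]; simp
    have e3 : inner ℝ (WithLp.toLp 2 (P, (0:E))) (i1 (y - z.fst)) = inner ℝ P (y - z.fst) := by
      rw [hi, pr_inner]; simp
    rw [e1, e2, e3] at hy
    exact hy

lemma HasT2.restrict_snd {f : E → ℝ} {z : WithLp 2 (E × E)} {P : E}
    {A : WithLp 2 (E × E) →L[ℝ] WithLp 2 (E × E)}
    (h : HasT2 (fun w : WithLp 2 (E × E) => f w.snd) z (WithLp.toLp 2 (0, P)) A) (hA : SymOp A) :
    ∃ X : E →L[ℝ] E, SymOp X ∧ HasT2 f z.snd P X := by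
  let i1 : E →L[ℝ] WithLp 2 (E × E) :=
    ((WithLp.prodContinuousLinearEquiv 2 ℝ E E).symm : E × E →L[ℝ] WithLp 2 (E × E)) ∘L
      ContinuousLinearMap.inr ℝ E E
  have hi : ∀ d, i1 d = WithLp.toLp 2 (0, d) := fun d => rfl
  let X : E →L[ℝ] E := (WithLp.sndL 2 ℝ E E) ∘L A ∘L i1
  have hX : ∀ d e, inner ℝ (X d) e = inner ℝ (A (i1 d)) (i1 e) := by
    intro d e
    rw [pr_inner, hi e]
    simp [X]
  refine ⟨X, ?_, ?_⟩
  · intro x y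
    rw [hX, hA, real_inner_comm, ← hX, real_inner_comm]
  · intro ε hε
    have hc : Tendsto (fun y : E => z + i1 (y - z.snd)) (𝓝 z.snd) (𝓝 z) := by
      have : Continuous (fun y : E => z + i1 (y - z.snd)) := by fun_prop
      have h2 := this.tendsto z.snd
      simpa using h2
    filter_upwards [hc.eventually (h ε hε)] with y hy
    simp only [add_sub_cancel_left] at hy
    rw [← hX] at hy
    have e1 : (z + i1 (y - z.snd)).snd = y := by rw [hi]; simp
    have e2 : ‖i1 (y - z.snd)‖ ^ 2 = ‖y - z.snd‖ ^ 2 := by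
      rw [hi, WithLp.prod_norm_sq_eq_of_L2]; simp
    have e3 : inner ℝ (WithLp.toLp 2 ((0:E), P)) (i1 (y - z.snd)) = inner ℝ P (y - z.snd) := by
      rw [hi, pr_inner]; simp
    rw [e1, e2, e3] at hy
    exact hy

lemma line_ineq [FiniteDimensional ℝ E] {α γ : E → ℝ} {x y P1 P2 : E} {X Y : E →L[ℝ] E} (h1 : HasT2 α x P1 X)
    (h2 : HasT2 γ y P2 Y) (d1 d2 : E) {g : ℝ → ℝ} {g0 m m' κ : ℝ}
    (hg : ∀ᶠ s in 𝓝 (0:ℝ), g s = g0 + s * m' + s ^ 2 * κ)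
    (h : ∀ᶠ s in 𝓝 (0:ℝ), g0 - α x - γ y + s * m ≤ g s - α (x + s • d1) - γ (y + s • d2)) :
    inner ℝ (X d1) d1 + inner ℝ (Y d2) d2 ≤ 2 * κ := by
  suffices 0 ≤ κ - (1/2) * inner ℝ (X d1) d1 - (1/2) * inner ℝ (Y d2) d2 by linarith
  apply nonneg_of_quad (m := m' - m - inner ℝ P1 d1 - inner ℝ P2 d2)
  intro ε hε
  filter_upwards [hg, h, h1.line d1 (ε/2) (by positivity), h2.line d2 (ε/2) (by positivity)]
    with s a1 a2 a3 a4
  rw [abs_le] at a3 a4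
  rw [a1] at a2
  nlinarith

/-- upper touching of `L (|w| - |w|^2/2)` -/
lemma omega_upper {L : ℝ} (hL : 0 ≤ L) {w : E} (hw : w ≠ 0) (w' : E) :
    L * (‖w'‖ - ‖w'‖ ^ 2 / 2) ≤ L * (‖w‖ - ‖w‖ ^ 2 / 2) +
      inner ℝ ((L * (1 / ‖w‖ - 1)) • w) (w' - w) + L / (2 * ‖w‖) * ‖w' - w‖ ^ 2 := by
  have hw0 : 0 < ‖w‖ := norm_pos_iff.2 hw
  have e1 : ‖w'‖ ^ 2 = ‖w‖ ^ 2 + 2 * inner ℝ w (w' - w) + ‖w' - w‖ ^ 2 := by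
    have : w' = w + (w' - w) := by abel
    conv_lhs => rw [this, norm_add_sq_real]
  have h1 : ‖w'‖ ≤ ‖w‖ + inner ℝ w (w' - w) / ‖w‖ + ‖w' - w‖ ^ 2 / (2 * ‖w‖) := by
    have : ‖w'‖ * (2 * ‖w‖) ≤ 2 * ‖w‖ ^ 2 + 2 * inner ℝ w (w' - w) + ‖w' - w‖ ^ 2 := by
      nlinarith [sq_nonneg (‖w'‖ - ‖w‖)]
    rw [← le_div_iff₀ (by positivity)] at this
    refine this.trans (le_of_eq ?_)
    field_simp
  have h2 : ‖w'‖ - ‖w'‖ ^ 2 / 2 ≤ ‖w‖ - ‖w‖ ^ 2 / 2 + (1 / ‖w‖ - 1) * inner ℝ w (w' - w) +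
      1 / (2 * ‖w‖) * ‖w' - w‖ ^ 2 := by
    have e2 : (1 / ‖w‖ - 1) * inner ℝ w (w' - w) = inner ℝ w (w' - w) / ‖w‖ - inner ℝ w (w' - w) := by ring
    have e3 : 1 / (2 * ‖w‖) * ‖w' - w‖ ^ 2 = ‖w' - w‖ ^ 2 / (2 * ‖w‖) := by ring
    rw [e2, e3]
    nlinarith [sq_nonneg ‖w' - w‖]
  have h3 := mul_le_mul_of_nonneg_left h2 hL
  rw [inner_smul_left]
  simp only [RCLike.conj_to_real]
  refine h3.trans (le_of_eq ?_)
  ring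

variable [FiniteDimensional ℝ E]

set_option maxHeartbeats 2000000 in
/-- doubling of variables (Ishii–Lions) -/
lemma doubling {G1 G2 : E → (E →L[ℝ] E) → Prop} {u : E → ℝ} (hu : ContinuousOn u (ball 0 1))
    (h1 : SubV G1 (ball 0 1) u) (h2 : SubV G2 (ball 0 1) (fun x => - u x))
    (hosc : ∀ x ∈ ball (0:E) 1, ∀ y ∈ ball (0:E) 1, u x - u y ≤ 1) {L : ℝ} (hL : 0 ≤ L)
    {x0 : E} (hx0 : ‖x0‖ ≤ 1/2) {xh yh : E} (hxy : ‖xh - x0‖ ^ 2 + ‖yh - x0‖ ^ 2 ≤ 1/16)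
    (hpos : 0 < u xh - u yh - L * (‖xh - yh‖ - ‖xh - yh‖ ^ 2 / 2) -
      32 * (‖xh - x0‖ ^ 2 + ‖yh - x0‖ ^ 2)) :
    ∃ (p1 p2 e : E) (X Y : E →L[ℝ] E), ‖e‖ = 1 ∧ SymOp X ∧ SymOp Y ∧ G1 p1 X ∧ G2 p2 Y ∧
      (∀ τ, inner ℝ (X τ) τ + inner ℝ (Y τ) τ ≤ 129 * ‖τ‖ ^ 2) ∧
      inner ℝ (X e) e + inner ℝ (Y e) e ≤ 129 - 4 * L ∧
      L / 2 - 17 ≤ ‖p1‖ ∧ ‖p1‖ ≤ L + 17 ∧ L / 2 - 17 ≤ ‖p2‖ ∧ ‖p2‖ ≤ L + 17 := by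
  have hproper : ProperSpace E := FiniteDimensional.proper_real E
  let _ : MeasurableSpace (WithLp 2 (E × E)) := borel _
  have : BorelSpace (WithLp 2 (E × E)) := ⟨rfl⟩
  obtain ⟨m, hm⟩ : ∃ m, m = u xh - u yh - L * (‖xh - yh‖ - ‖xh - yh‖ ^ 2 / 2) -
      32 * (‖xh - x0‖ ^ 2 + ‖yh - x0‖ ^ 2) := ⟨_, rfl⟩
  rw [← hm] at hpos
  obtain ⟨C, hCd⟩ : ∃ C, C = closedBall (0:E) (7/8) := ⟨_, rfl⟩
  have hCc : IsCompact C := by rw [hCd]; exact isCompact_closedBall _ _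
  have hCsub : C ⊆ ball 0 1 := by rw [hCd]; exact closedBall_subset_ball (by norm_num)
  have hCne : C.Nonempty := ⟨0, by rw [hCd]; exact mem_closedBall_self (by norm_num)⟩
  have ha : ContinuousOn u C := hu.mono hCsub
  have hb : ContinuousOn (fun x => -u x) C := ha.neg
  obtain ⟨τ, hτ0, hτ1, hτm⟩ : ∃ τ > 0, τ ≤ 1/8 ∧ τ ≤ m / 8 :=
    ⟨min (1/8) (m/8), by positivity, min_le_left _ _, min_le_right _ _⟩
  obtain ⟨ε1, hε1, hcl1⟩ := supConv_close hCc ha hτ0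
  obtain ⟨ε2, hε2, hcl2⟩ := supConv_close hCc hb hτ0
  obtain ⟨ε, hε, hεε1, hεε2⟩ : ∃ ε, 0 < ε ∧ ε < ε1 ∧ ε < ε2 :=
    ⟨min ε1 ε2 / 2, by positivity, by
      have := min_le_left ε1 ε2
      linarith, by
      have := min_le_right ε1 ε2
      linarith⟩
  obtain ⟨d, hd0, hd⟩ : ∃ d > 0, ∀ x ∈ C, ∀ y ∈ C, ‖x - y‖ < d → u x - u y < m / 2 := by
    have := hCc.uniformContinuousOn_of_continuous ha
    rw [Metric.uniformContinuousOn_iff] at this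
    obtain ⟨d, hd, h⟩ := this (m/2) (by positivity)
    refine ⟨d, hd, fun x hx y hy hxy => ?_⟩
    have := h x hx y hy (by rwa [dist_eq_norm])
    rw [Real.dist_eq] at this
    exact (le_abs_self _).trans_lt this
  obtain ⟨α, hα⟩ : ∃ α, α = supConv u C ε := ⟨_, rfl⟩
  obtain ⟨γ, hγ⟩ : ∃ γ, γ = supConv (fun x => -u x) C ε := ⟨_, rfl⟩
  choose y1 hy1 he1 using supConv_exists hCc hCne ha ε
  choose y2 hy2 he2 using supConv_exists hCc hCne hb ε
  have hclose1 : ∀ x ∈ C, ‖x - y1 x‖ < τ ∧ α x ≤ u x + τ ∧ u x ≤ α x := by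
    intro x hx
    have g1 := self_le_supConv hCc ha ε hx
    rw [he1] at g1
    have g2 := hcl1 ε hε hεε1 x hx (y1 x) (hy1 x) g1
    have : 0 ≤ ‖x - y1 x‖ ^ 2 / (2 * ε) := by positivity
    rw [hα, he1]
    exact ⟨g2.1, by linarith, g1⟩
  have hclose2 : ∀ x ∈ C, ‖x - y2 x‖ < τ ∧ γ x ≤ -u x + τ ∧ -u x ≤ γ x := by
    intro x hx
    have g1 := self_le_supConv hCc hb ε hx
    rw [he2] at g1
    have g2 := hcl2 ε hε hεε2 x hx (y2 x) (hy2 x) g1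
    have : 0 ≤ ‖x - y2 x‖ ^ 2 / (2 * ε) := by positivity
    rw [hγ, he2]
    exact ⟨g2.1, by linarith, g1⟩
  have hαc : Continuous α := by rw [hα]; exact supConv_continuous hCc hCne ha hε
  have hγc : Continuous γ := by rw [hγ]; exact supConv_continuous hCc hCne hb hε
  obtain ⟨z0, hz0⟩ : ∃ z0 : WithLp 2 (E × E), z0 = WithLp.toLp 2 (x0, x0) := ⟨_, rfl⟩
  have hzn : ∀ z : WithLp 2 (E × E), ‖z - z0‖ ^ 2 = ‖z.fst - x0‖ ^ 2 + ‖z.snd - x0‖ ^ 2 := by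
    intro z; rw [WithLp.prod_norm_sq_eq_of_L2, hz0]; simp
  have hzC : ∀ z ∈ closedBall z0 (1/4), ‖z.fst - x0‖ ≤ 1/4 ∧ ‖z.snd - x0‖ ≤ 1/4 ∧
      ‖z.fst‖ ≤ 3/4 ∧ ‖z.snd‖ ≤ 3/4 := by
    intro z hz
    rw [mem_closedBall_iff_norm] at hz
    have g1 := hzn z
    have g2 : ‖z - z0‖ ^ 2 ≤ 1/16 := by nlinarith [norm_nonneg (z - z0)]
    have g3 : ‖z.fst - x0‖ ≤ 1/4 := by
      refine (sq_le_sq₀ (norm_nonneg _) (by norm_num)).1 ?_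
      nlinarith [sq_nonneg ‖z.snd - x0‖]
    have g4 : ‖z.snd - x0‖ ≤ 1/4 := by
      refine (sq_le_sq₀ (norm_nonneg _) (by norm_num)).1 ?_
      nlinarith [sq_nonneg ‖z.fst - x0‖]
    refine ⟨g3, g4, ?_, ?_⟩
    · have := norm_add_le (z.fst - x0) x0
      rw [sub_add_cancel] at this; linarith
    · have := norm_add_le (z.snd - x0) x0
      rw [sub_add_cancel] at this; linarith
  have hmemC : ∀ x : E, ‖x‖ ≤ 3/4 → x ∈ C := by
    intro x hx; rw [hCd, mem_closedBall_zero_iff]; linarith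
  obtain ⟨g, hg⟩ : ∃ g : WithLp 2 (E × E) → ℝ, g = fun z =>
      L * (‖z.fst - z.snd‖ - ‖z.fst - z.snd‖ ^ 2 / 2) +
      32 * (‖z.fst - x0‖ ^ 2 + ‖z.snd - x0‖ ^ 2) := ⟨_, rfl⟩
  obtain ⟨f, hf⟩ : ∃ f : WithLp 2 (E × E) → ℝ, f = fun z => g z - α z.fst - γ z.snd := ⟨_, rfl⟩
  obtain ⟨δ, hδ0, hδ1, hδm⟩ : ∃ δ > 0, δ ≤ 1 ∧ δ ≤ m / 2 :=
    ⟨min 1 (m/2), by positivity, min_le_left _ _, min_le_right _ _⟩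
  obtain ⟨zh, hzh⟩ : ∃ zh : WithLp 2 (E × E), zh = WithLp.toLp 2 (xh, yh) := ⟨_, rfl⟩
  have hzhb : zh ∈ closedBall z0 (1/4) := by
    rw [mem_closedBall_iff_norm]
    refine (sq_le_sq₀ (norm_nonneg _) (by norm_num)).1 ?_
    rw [hzn, hzh]
    simp only [WithLp.toLp_fst, WithLp.toLp_snd]
    linarith
  have hfzh : f zh ≤ -m := by
    have g0 := hzC zh hzhb
    have g1 := (hclose1 _ (hmemC _ g0.2.2.1)).2.2
    have g2 := (hclose2 _ (hmemC _ g0.2.2.2)).2.2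
    rw [hf, hg]
    rw [hzh] at g1 g2 ⊢
    simp only [WithLp.toLp_fst, WithLp.toLp_snd] at g1 g2 ⊢
    linarith
  have hlow : ∀ z ∈ closedBall z0 (1/4), 32 * ‖z - z0‖ ^ 2 - (u z.fst - u z.snd) - 2 * τ ≤ f z := by
    intro z hz
    have g0 := hzC z hz
    have g1 := (hclose1 _ (hmemC _ g0.2.2.1)).2.1
    have g2 := (hclose2 _ (hmemC _ g0.2.2.2)).2.1
    have g3 : ‖z.fst - z.snd‖ ≤ 1/2 := by
      have : z.fst - z.snd = (z.fst - x0) - (z.snd - x0) := by abel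
      rw [this]
      exact (norm_sub_le _ _).trans (by linarith)
    have g4 : 0 ≤ L * (‖z.fst - z.snd‖ - ‖z.fst - z.snd‖ ^ 2 / 2) := by
      apply mul_nonneg hL
      nlinarith [norm_nonneg (z.fst - z.snd)]
    rw [hf, hg, hzn]
    simp only
    linarith
  have hgap : ∀ z ∈ sphere z0 (1/4), f zh + 2 * (1/4) * δ < f z := by
    intro z hz
    have hz' := sphere_subset_closedBall hz
    have g0 := hzC z hz'
    have g1 := hlow z hz'
    have g2 : ‖z - z0‖ = 1/4 := by rw [← mem_sphere_iff_norm]; exact hz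
    rw [g2] at g1
    have g3 := hosc _ (hCsub (hmemC _ g0.2.2.1)) _ (hCsub (hmemC _ g0.2.2.2))
    linarith
  -- contact points are off-diagonal
  have hoff : ∀ z q, Contact f (closedBall z0 (1/4)) δ z q → d ≤ ‖z.fst - z.snd‖ := by
    intro z q hq
    have g0 := hzC z hq.1
    have g1 := hlow z hq.1
    have g2 := hq.2.2 zh hzhb
    have g3 := abs_real_inner_le_norm q (zh - z)
    have g4 : ‖zh - z‖ ≤ 1/2 := by
      have : zh - z = (zh - z0) - (z - z0) := by abel
      rw [this]
      have b1 := mem_closedBall_iff_norm.1 hzhb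
      have b2 := mem_closedBall_iff_norm.1 hq.1
      exact (norm_sub_le _ _).trans (by linarith)
    have g5 : ‖q‖ * ‖zh - z‖ ≤ δ * (1/2) := mul_le_mul hq.2.1 g4 (norm_nonneg _) hδ0.le
    rw [abs_le] at g3
    by_contra hcon
    push Not at hcon
    have g6 := hd _ (hmemC _ g0.2.2.1) _ (hmemC _ g0.2.2.2) hcon
    have g7 : 0 ≤ 32 * ‖z - z0‖ ^ 2 := by positivity
    linarith
  -- upper touching of g
  have hgup : ∀ z : WithLp 2 (E × E), z.fst - z.snd ≠ 0 → ∀ z', g z' ≤ g z +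
      inner ℝ (WithLp.toLp 2 ((L * (1 / ‖z.fst - z.snd‖ - 1)) • (z.fst - z.snd) + (64:ℝ) • (z.fst - x0),
        -((L * (1 / ‖z.fst - z.snd‖ - 1)) • (z.fst - z.snd)) + (64:ℝ) • (z.snd - x0))) (z' - z) +
      (L / ‖z.fst - z.snd‖ + 32) * ‖z' - z‖ ^ 2 := by
    intro z hz z'
    have g1 := omega_upper hL hz (z'.fst - z'.snd)
    have g0 : 0 < ‖z.fst - z.snd‖ := norm_pos_iff.2 hz
    have hsq : ∀ x y : E, ‖y - x0‖ ^ 2 = ‖x - x0‖ ^ 2 + 2 * inner ℝ (x - x0) (y - x) + ‖y - x‖ ^ 2 := by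
      intro x y
      have : y - x0 = (x - x0) + (y - x) := by abel
      rw [this, norm_add_sq_real]
    have g2 := hsq z.fst z'.fst
    have g3 := hsq z.snd z'.snd
    have g4 : ‖z' - z‖ ^ 2 = ‖z'.fst - z.fst‖ ^ 2 + ‖z'.snd - z.snd‖ ^ 2 := by
      rw [WithLp.prod_norm_sq_eq_of_L2]; simp
    have g5 : ‖(z'.fst - z'.snd) - (z.fst - z.snd)‖ ^ 2 ≤ 2 * ‖z' - z‖ ^ 2 := by
      have e : (z'.fst - z'.snd) - (z.fst - z.snd) = (z'.fst - z.fst) - (z'.snd - z.snd) := by abel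
      rw [e, g4]
      have := norm_sub_le (z'.fst - z.fst) (z'.snd - z.snd)
      have g6 := norm_nonneg (z'.fst - z.fst - (z'.snd - z.snd))
      nlinarith [sq_nonneg (‖z'.fst - z.fst‖ - ‖z'.snd - z.snd‖), norm_nonneg (z'.fst - z.fst),
        norm_nonneg (z'.snd - z.snd)]
    have g7 : L / (2 * ‖z.fst - z.snd‖) * ‖(z'.fst - z'.snd) - (z.fst - z.snd)‖ ^ 2 ≤
        L / ‖z.fst - z.snd‖ * ‖z' - z‖ ^ 2 := by
      calc _ ≤ L / (2 * ‖z.fst - z.snd‖) * (2 * ‖z' - z‖ ^ 2) := by gcongr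
        _ = _ := by field_simp
    have e3 : (z'.fst - z'.snd) - (z.fst - z.snd) = (z'.fst - z.fst) - (z'.snd - z.snd) := by abel
    rw [pr_inner]
    simp only [WithLp.toLp_fst, WithLp.toLp_snd, WithLp.sub_fst, WithLp.sub_snd, inner_add_left,
      inner_neg_left]
    rw [hg]
    simp only
    rw [g2, g3]
    rw [e3, inner_sub_right] at g1
    rw [e3] at g7
    rw [inner_smul_left _ (z'.fst - z.fst) (64:ℝ), inner_smul_left _ (z'.snd - z.snd) (64:ℝ)]
    simp only [RCLike.conj_to_real]
    rw [add_mul, g4] at *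
    linarith
  obtain ⟨k, hkd⟩ : ∃ k, k = 1 / (2 * ε) + (L / d + 32) := ⟨_, rfl⟩
  have hk : 0 ≤ k := by rw [hkd]; positivity
  have hk1 : 1 / (2 * ε) ≤ k := by
    have : 0 ≤ L / d + 32 := by positivity
    linarith
  have hfstle : ∀ z : WithLp 2 (E × E), ‖z.fst‖ ^ 2 ≤ ‖z‖ ^ 2 := fun z => by
    rw [WithLp.prod_norm_sq_eq_of_L2 z]; nlinarith [sq_nonneg ‖z.snd‖]
  have hsndle : ∀ z : WithLp 2 (E × E), ‖z.snd‖ ^ 2 ≤ ‖z‖ ^ 2 := fun z => by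
    rw [WithLp.prod_norm_sq_eq_of_L2 z]; nlinarith [sq_nonneg ‖z.fst‖]
  have hlo1 : ∀ x z : WithLp 2 (E × E), α x.fst + inner ℝ (WithLp.toLp 2 ((1 / ε) • (y1 x.fst - x.fst), (0:E))) (z - x)
      - k * ‖z - x‖ ^ 2 ≤ α z.fst := by
    intro x z
    have g1 := supConv_lower hCc ha hε (hy1 x.fst) (he1 x.fst) z.fst
    rw [← hα] at g1
    have g2 := hfstle (z - x)
    rw [pr_inner]
    simp only [WithLp.toLp_fst, WithLp.toLp_snd, WithLp.sub_fst, WithLp.sub_snd, inner_zero_left,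
      add_zero] at g2 ⊢
    have g3 : 1 / (2 * ε) * ‖z.fst - x.fst‖ ^ 2 ≤ k * ‖z - x‖ ^ 2 := by gcongr
    linarith
  have hlo2 : ∀ x z : WithLp 2 (E × E), γ x.snd + inner ℝ (WithLp.toLp 2 ((0:E), (1 / ε) • (y2 x.snd - x.snd))) (z - x)
      - k * ‖z - x‖ ^ 2 ≤ γ z.snd := by
    intro x z
    have g1 := supConv_lower hCc hb hε (hy2 x.snd) (he2 x.snd) z.snd
    rw [← hγ] at g1
    have g2 := hsndle (z - x)
    rw [pr_inner]
    simp only [WithLp.toLp_fst, WithLp.toLp_snd, WithLp.sub_fst, WithLp.sub_snd, inner_zero_left,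
      zero_add] at g2 ⊢
    have g3 : 1 / (2 * ε) * ‖z.snd - x.snd‖ ^ 2 ≤ k * ‖z - x‖ ^ 2 := by gcongr
    linarith
  have hupk : ∀ z q, Contact f (closedBall z0 (1/4)) δ z q → ∀ z', g z' ≤ g z +
      inner ℝ (WithLp.toLp 2 ((L * (1 / ‖z.fst - z.snd‖ - 1)) • (z.fst - z.snd) + (64:ℝ) • (z.fst - x0),
        -((L * (1 / ‖z.fst - z.snd‖ - 1)) • (z.fst - z.snd)) + (64:ℝ) • (z.snd - x0))) (z' - z) +
      k * ‖z' - z‖ ^ 2 := by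
    intro z q hq z'
    have g1 := hoff z q hq
    have g2 : z.fst - z.snd ≠ 0 := norm_pos_iff.1 (hd0.trans_le g1)
    refine (hgup z g2 z').trans ?_
    gcongr
    rw [hkd]
    have g3 : L / ‖z.fst - z.snd‖ ≤ L / d := by gcongr
    have g4 : 0 < 1 / (2 * ε) := by positivity
    linarith
  have habp := abp_two (Measure.addHaar : Measure (WithLp 2 (E × E))) (g := g)
    (α := fun z => α z.fst) (β := fun z => γ z.snd)
    (p1 := fun x => WithLp.toLp 2 ((1 / ε) • (y1 x.fst - x.fst), (0:E)))
    (p2 := fun x => WithLp.toLp 2 ((0:E), (1 / ε) • (y2 x.snd - x.snd)))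
    (z0 := z0) (R := 1/4) (δ := δ) (k := k) hδ0 hk
    (by
      have : Continuous g := by rw [hg]; fun_prop
      exact this.continuousOn)
    (by fun_prop) (by fun_prop) hlo1 hlo2 hf hzhb hgap
    (fun z q hq => ⟨_, fun z' _ => hupk z q hq z'⟩)
  obtain ⟨hTb, hT0, hnull, -⟩ := habp
  obtain ⟨z, ⟨q, hq⟩, A1, A2, hs1, hs2, ht1, ht2⟩ : ∃ z ∈ CSet f (closedBall z0 (1/4)) δ,
      ∃ A1 A2, SymOp A1 ∧ SymOp A2 ∧
      HasT2 (fun z => α z.fst) z (WithLp.toLp 2 ((1 / ε) • (y1 z.fst - z.fst), (0:E))) A1 ∧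
      HasT2 (fun z => γ z.snd) z (WithLp.toLp 2 ((0:E), (1 / ε) • (y2 z.snd - z.snd))) A2 := by
    by_contra hcon
    push Not at hcon
    apply hT0
    refine measure_mono_null ?_ hnull
    rintro z hz
    refine ⟨hz, ?_⟩
    rintro ⟨A1, A2, b1, b2, b3, b4⟩
    exact hcon z hz A1 A2 b1 b2 b3 b4
  have hzb : z ∈ ball z0 (1/4) := hTb ⟨q, hq⟩
  have hzc := hzC z hq.1
  have htd := hoff z q hq
  have hup := hupk z q hq
  -- slopes
  have hslope : WithLp.toLp 2 ((1 / ε) • (y1 z.fst - z.fst), (1 / ε) • (y2 z.snd - z.snd)) =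
      WithLp.toLp 2 ((L * (1 / ‖z.fst - z.snd‖ - 1)) • (z.fst - z.snd) + (64:ℝ) • (z.fst - x0),
        -((L * (1 / ‖z.fst - z.snd‖ - 1)) • (z.fst - z.snd)) + (64:ℝ) • (z.snd - x0)) - q := by
    apply slope_unique (f := fun z => α z.fst + γ z.snd) (x := z) (K := 2 * k)
    · refine Eventually.of_forall fun z' => ?_
      have b1 := hlo1 z z'
      have b2 := hlo2 z z'
      rw [pr_inner] at b1 b2 ⊢
      simp only [WithLp.toLp_fst, WithLp.toLp_snd, inner_zero_left, zero_add, add_zero] at b1 b2 ⊢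
      linarith
    · filter_upwards [isOpen_ball.mem_nhds hzb] with z' hz'
      have b1 := hq.2.2 z' (ball_subset_closedBall hz')
      have b2 := hup z'
      rw [inner_sub_left]
      rw [hf] at b1
      simp only at b1
      have b3 : 0 ≤ k * ‖z' - z‖ ^ 2 := by positivity
      linarith
  have hs1' := congrArg WithLp.fst hslope
  have hs2' := congrArg WithLp.snd hslope
  simp only [WithLp.toLp_fst, WithLp.toLp_snd, WithLp.sub_fst, WithLp.sub_snd] at hs1' hs2'
  obtain ⟨X, hXs, hXt⟩ := ht1.restrict_fst hs1
  obtain ⟨Y, hYs, hYt⟩ := ht2.restrict_snd hs2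
  obtain ⟨x, hxd⟩ : ∃ x, x = z.fst := ⟨_, rfl⟩
  obtain ⟨y, hyd⟩ : ∃ y, y = z.snd := ⟨_, rfl⟩
  rw [← hxd] at hzc htd hs1' hs2' hXt
  rw [← hyd] at hzc htd hs1' hs2' hYt
  obtain ⟨t, htdef⟩ : ∃ t, t = ‖x - y‖ := ⟨_, rfl⟩
  rw [← htdef] at htd hs1' hs2'
  have ht0 : 0 < t := hd0.trans_le htd
  have ht12 : t ≤ 1/2 := by
    rw [htdef]
    have : x - y = (x - x0) - (y - x0) := by abel
    rw [this]
    exact (norm_sub_le _ _).trans (by linarith)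
  have hwn : ‖(L * (1 / t - 1)) • (x - y)‖ = L * (1 - t) := by
    have : 0 ≤ 1 / t - 1 := by
      rw [sub_nonneg, le_div_iff₀ ht0]; linarith
    rw [norm_smul, Real.norm_of_nonneg (by positivity), ← htdef]
    field_simp
  have hq1 : ‖q.fst‖ ≤ 1 := by
    have := hfstle q
    have := hq.2.1
    nlinarith [norm_nonneg q, norm_nonneg q.fst]
  have hq2 : ‖q.snd‖ ≤ 1 := by
    have := hsndle q
    have := hq.2.1
    nlinarith [norm_nonneg q, norm_nonneg q.snd]
  have hpb : ∀ w v r : E, ‖w‖ = L * (1 - t) → ‖v‖ ≤ 1/4 → ‖r‖ ≤ 1 →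
      L / 2 - 17 ≤ ‖w + (64:ℝ) • v - r‖ ∧ ‖w + (64:ℝ) • v - r‖ ≤ L + 17 := by
    intro w v r hw hv hr
    have b1 : ‖(64:ℝ) • v - r‖ ≤ 17 := by
      refine (norm_sub_le _ _).trans ?_
      rw [norm_smul]; norm_num; linarith
    have b2 : w + (64:ℝ) • v - r = w + ((64:ℝ) • v - r) := by abel
    rw [b2]
    have b3 := norm_add_le w ((64:ℝ) • v - r)
    have b4 := norm_sub_le (w + ((64:ℝ) • v - r)) ((64:ℝ) • v - r)
    rw [add_sub_cancel_right] at b4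
    have b5 : L * (1 - t) ≤ L := by nlinarith
    have b6 : L / 2 ≤ L * (1 - t) := by nlinarith
    constructor <;> linarith
  have hP1 := hpb _ (x - x0) q.fst hwn hzc.1 hq1
  have hP2 := hpb (-((L * (1 / t - 1)) • (x - y))) (y - x0) q.snd (by rw [norm_neg, hwn]) hzc.2.1 hq2
  rw [← hs1'] at hP1
  rw [← hs2'] at hP2
  -- lines
  have hcontact : ∀ d1 d2 : E, ∀ᶠ s in 𝓝 (0:ℝ), g z - α x - γ y + s * inner ℝ q (WithLp.toLp 2 (d1, d2)) ≤
      g (z + s • WithLp.toLp 2 (d1, d2)) - α (x + s • d1) - γ (y + s • d2) := by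
    intro d1 d2
    have hc : Tendsto (fun s : ℝ => z + s • WithLp.toLp 2 (d1, d2)) (𝓝 0) (𝓝 z) := by
      have : Continuous (fun s : ℝ => z + s • WithLp.toLp 2 (d1, d2)) := by fun_prop
      simpa using this.tendsto 0
    filter_upwards [hc.eventually (isOpen_ball.mem_nhds hzb)] with s hs
    have b1 := hq.2.2 _ (ball_subset_closedBall hs)
    rw [add_sub_cancel_left, inner_smul_right, hf] at b1
    simp only [WithLp.add_fst, WithLp.add_snd, WithLp.smul_fst, WithLp.smul_snd, WithLp.toLp_fst,
      WithLp.toLp_snd] at b1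
    rw [← hxd, ← hyd] at b1
    exact b1
  have hsq : ∀ (v d : E) (s : ℝ), ‖v + s • d‖ ^ 2 = ‖v‖ ^ 2 + s * (2 * inner ℝ v d) + s ^ 2 * ‖d‖ ^ 2 := by
    intro v d s
    rw [norm_add_sq_real, inner_smul_right, norm_smul, mul_pow, Real.norm_eq_abs, sq_abs]
    ring
  have hlineττ : ∀ τ' : E, inner ℝ (X τ') τ' + inner ℝ (Y τ') τ' ≤ 2 * (64 * ‖τ'‖ ^ 2) := by
    intro τ'
    refine line_ineq hXt hYt τ' τ' (g := fun s => g (z + s • WithLp.toLp 2 (τ', τ'))) (g0 := g z)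
      (m' := 32 * (2 * inner ℝ (x - x0) τ' + 2 * inner ℝ (y - x0) τ'))
      (Eventually.of_forall fun s => ?_) (hcontact τ' τ')
    rw [hg]
    simp only [WithLp.add_fst, WithLp.add_snd, WithLp.smul_fst, WithLp.smul_snd, WithLp.toLp_fst,
      WithLp.toLp_snd]
    rw [← hxd, ← hyd]
    have c1 : x + s • τ' - (y + s • τ') = x - y := by abel
    have c2 : x + s • τ' - x0 = (x - x0) + s • τ' := by abel
    have c3 : y + s • τ' - x0 = (y - x0) + s • τ' := by abel
    rw [c1, c2, c3, hsq, hsq]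
    ring
  obtain ⟨e, he⟩ : ∃ e, e = (1 / t) • (x - y) := ⟨_, rfl⟩
  have hen : ‖e‖ = 1 := by
    rw [he, norm_smul, Real.norm_of_nonneg (by positivity), ← htdef]; field_simp
  have hte : x - y = t • e := by
    rw [he, smul_smul, mul_one_div_cancel ht0.ne', one_smul]
  have hlinee : inner ℝ (X e) e + inner ℝ (Y (-e)) (-e) ≤ 2 * (64 - 2 * L) := by
    refine line_ineq hXt hYt e (-e) (g := fun s => g (z + s • WithLp.toLp 2 (e, -e))) (g0 := g z)
      (m' := 32 * (2 * inner ℝ (x - x0) e + 2 * inner ℝ (y - x0) (-e)) + L * (2 - 2 * t))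
      ?_ (hcontact e (-e))
    have hpos : ∀ᶠ s in 𝓝 (0:ℝ), 0 < t + 2 * s := by
      have : Tendsto (fun s : ℝ => t + 2 * s) (𝓝 0) (𝓝 t) := by
        have : Continuous (fun s : ℝ => t + 2 * s) := by fun_prop
        simpa using this.tendsto 0
      exact this.eventually (lt_mem_nhds ht0)
    filter_upwards [hpos] with s hs
    rw [hg]
    simp only [WithLp.add_fst, WithLp.add_snd, WithLp.smul_fst, WithLp.smul_snd, WithLp.toLp_fst,
      WithLp.toLp_snd]
    rw [← hxd, ← hyd]
    have c1 : x + s • e - (y + s • (-e)) = (t + 2 * s) • e := by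
      have : x + s • e - (y + s • (-e)) = (x - y) + (2 * s) • e := by module
      rw [this, hte]; module
    have c2 : x + s • e - x0 = (x - x0) + s • e := by abel
    have c3 : y + s • (-e) - x0 = (y - x0) + s • (-e) := by abel
    have c4 : ‖(t + 2 * s) • e‖ = t + 2 * s := by
      rw [norm_smul, hen, mul_one, Real.norm_of_nonneg hs.le]
    rw [c1, c2, c3, hsq, hsq, c4, ← htdef, norm_neg, hen]
    ring
  rw [map_neg, inner_neg_neg] at hlinee
  -- the equations
  have hyC : ∀ y' : E, ∀ x' : E, ‖x'‖ ≤ 3/4 → ‖x' - y'‖ < τ → y' ∈ ball (0:E) (7/8) := by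
    intro y' x' hx' hy'
    rw [mem_ball_zero_iff]
    calc ‖y'‖ = ‖x' - (x' - y')‖ := by congr 1; abel
      _ ≤ ‖x'‖ + ‖x' - y'‖ := norm_sub_le _ _
      _ < 7/8 := by linarith
  have hn1 := hyC _ _ hzc.2.2.1 (hclose1 x (hmemC _ hzc.2.2.1)).1
  have hn2 := hyC _ _ hzc.2.2.2 (hclose2 y (hmemC _ hzc.2.2.2)).1
  have hnh : ∀ w ∈ ball (0:E) (7/8), C ∈ 𝓝 w := fun w hw => by
    rw [hCd]; exact mem_of_superset (isOpen_ball.mem_nhds hw) ball_subset_closedBall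
  have r1 := h1.supConv hCc ha (he1 x) (hnh _ hn1) (hCsub (mem_of_mem_nhds (hnh _ hn1))) hXs
    (by rw [← hα]; exact hXt) (by norm_num : (0:ℝ) < 1/2)
  have r2 := h2.supConv hCc hb (he2 y) (hnh _ hn2) (hCsub (mem_of_mem_nhds (hnh _ hn2))) hYs
    (by rw [← hγ]; exact hYt) (by norm_num : (0:ℝ) < 1/2)
  refine ⟨_, _, e, _, _, hen, hXs.add (SymOp.id.smul _), hYs.add (SymOp.id.smul _), r1, r2, ?_, ?_,
    hP1.1, hP1.2, hP2.1, hP2.2⟩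
  · intro τ'
    have := hlineττ τ'
    simp only [add_apply, smul_apply, ContinuousLinearMap.id_apply, inner_add_left, inner_smul_left,
      real_inner_self_eq_norm_sq, RCLike.conj_to_real]
    linarith
  · simp only [add_apply, smul_apply, ContinuousLinearMap.id_apply, inner_add_left, inner_smul_left,
      real_inner_self_eq_norm_sq, RCLike.conj_to_real, hen]
    linarith

end KS11

section KS12
open Filter
variable {E : Type*} [NormedAddCommGroup E] [InnerProductSpace ℝ E]

/-- degenerate subsolution condition -/
def Deg (P : ℝ) (ξ : E) (c : ℝ) (F : (E →L[ℝ] E) → ℝ) (p : E) (A : E →L[ℝ] E) : Prop :=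
  min 1 (‖ξ + p‖ ^ P) * F A ≤ c

lemma Deg.of_large {P : ℝ} {ξ : E} {c : ℝ} {F : (E →L[ℝ] E) → ℝ} {p : E} {A : E →L[ℝ] E}
    (h : Deg P ξ c F p A) (hP : 0 ≤ P) (h1 : 1 ≤ ‖ξ + p‖) : F A ≤ c := by
  have : 1 ≤ ‖ξ + p‖ ^ P := Real.one_le_rpow h1 hP
  rw [Deg, min_eq_left this, one_mul] at h
  exact h

variable [FiniteDimensional ℝ E]

lemma ishii_lions {lam Lam : ℝ} (hlam : 0 < lam) {L : ℝ} (hL : 0 ≤ L)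
    (hL1 : 2 + 129 * Lam * Module.finrank ℝ E < 4 * lam * L)
    {F : (E →L[ℝ] E) → ℝ} (hF : Ell lam Lam F) {P : ℝ} (hP : 0 ≤ P) {ξ : E} {c : ℝ}
    (hc1 : c ≤ 1) (hξ : L + 18 ≤ ‖ξ‖ ∨ ‖ξ‖ + 18 ≤ L / 2)
    {u : E → ℝ} (hu : ContinuousOn u (ball 0 1)) (h1 : SubV (Deg P ξ c F) (ball 0 1) u)
    (h2 : SubV (Deg P (-ξ) c (dualF F)) (ball 0 1) (fun x => - u x))
    (hosc : ∀ x ∈ ball (0:E) 1, ∀ y ∈ ball (0:E) 1, u x - u y ≤ 1)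
    {x0 : E} (hx0 : ‖x0‖ ≤ 1/2) {x : E} (hx : ‖x - x0‖ ≤ 1/4) :
    u x - u x0 ≤ (L + 8) * ‖x - x0‖ := by
  by_contra hcon
  push Not at hcon
  have hn := norm_nonneg (x - x0)
  obtain ⟨p1, p2, e, X, Y, he, hX, hY, g1, g2, hq, hqe, b1, b2, b3, b4⟩ :=
    doubling hu h1 h2 hosc hL hx0 (xh := x) (yh := x0)
      (by simp only [sub_self, norm_zero]; nlinarith) (by
        simp only [sub_self, norm_zero]
        nlinarith [mul_nonneg hL (sq_nonneg ‖x - x0‖)])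
  have c1 : 1 ≤ ‖ξ + p1‖ := by
    have a1 := norm_sub_le (ξ + p1) p1
    have a2 := norm_sub_le (ξ + p1) ξ
    rw [add_sub_cancel_right] at a1
    rw [add_sub_cancel_left] at a2
    rcases hξ with h | h <;> linarith
  have c2 : 1 ≤ ‖-ξ + p2‖ := by
    have a1 := norm_sub_le (-ξ + p2) p2
    have a2 := norm_sub_le (-ξ + p2) (-ξ)
    rw [add_sub_cancel_right] at a1
    rw [add_sub_cancel_left] at a2
    rw [norm_neg] at a1 a2
    rcases hξ with h | h <;> linarith
  have d1 := g1.of_large hP c1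
  have d2 := g2.of_large hP c2
  obtain ⟨N, hN⟩ : ∃ N, N = (129:ℝ) • ContinuousLinearMap.id ℝ E - (X + Y) := ⟨_, rfl⟩
  have hNi : ∀ τ, inner ℝ (N τ) τ = 129 * ‖τ‖ ^ 2 - (inner ℝ (X τ) τ + inner ℝ (Y τ) τ) := by
    intro τ
    rw [hN]
    simp only [add_apply, sub_apply, smul_apply, ContinuousLinearMap.id_apply, inner_sub_left,
      inner_add_left, inner_smul_left, real_inner_self_eq_norm_sq, RCLike.conj_to_real]
  have hNs : SymOp N := by rw [hN]; exact (SymOp.id.smul _).sub (hX.add hY)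
  have hNp : PosO N := fun τ => by rw [hNi]; linarith [hq τ]
  have hNt := hNp.le_trO he
  rw [hNi, he] at hNt
  have hlow := hF.lower hX hNs (SymOp.id.smul (129:ℝ)) hNp (PosO.id.smul (by norm_num : (0:ℝ) ≤ 129))
  have e1 : X + N - (129:ℝ) • ContinuousLinearMap.id ℝ E = -Y := by rw [hN]; abel
  rw [e1, trO_smul, trO_id] at hlow
  unfold dualF at d2
  nlinarith

/-- Lipschitz estimate, uniform in the shift `ξ` -/
lemma deg_lip {lam Lam : ℝ} (hlam : 0 < lam) (hlL : lam ≤ Lam) : ∃ K : ℝ, 0 < K ∧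
    ∀ F : (E →L[ℝ] E) → ℝ, Ell lam Lam F → ∀ P : ℝ, 0 ≤ P → ∀ (ξ : E) (c : ℝ), c ≤ 1 →
    ∀ u : E → ℝ, ContinuousOn u (ball 0 1) → SubV (Deg P ξ c F) (ball 0 1) u →
    SubV (Deg P (-ξ) c (dualF F)) (ball 0 1) (fun x => - u x) →
    (∀ x ∈ ball (0:E) 1, ∀ y ∈ ball (0:E) 1, u x - u y ≤ 1) →
    ∀ x ∈ ball (0:E) (1/2), ∀ y ∈ ball (0:E) (1/2), |u x - u y| ≤ K * ‖x - y‖ := by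
  obtain ⟨L1, hL1, hL1p⟩ : ∃ L1 : ℝ, 2 + 129 * Lam * Module.finrank ℝ E < 4 * lam * L1 ∧ 0 < L1 := by
    have : 0 < 2 + 129 * Lam * Module.finrank ℝ E := by
      have : 0 ≤ Lam := hlam.le.trans hlL
      positivity
    refine ⟨(2 + 129 * Lam * Module.finrank ℝ E) / lam, ?_, by positivity⟩
    rw [mul_assoc 4 lam, mul_div_cancel₀ _ hlam.ne']
    linarith
  refine ⟨2 * L1 + 84, by positivity, ?_⟩
  intro F hF P hP ξ c hc u hu h1 h2 hosc
  have hone : ∀ x ∈ ball (0:E) (1/2), ∀ y ∈ ball (0:E) (1/2), u x - u y ≤ (2 * L1 + 84) * ‖x - y‖ := by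
    intro x hx y hy
    by_cases hxy : ‖x - y‖ ≤ 1/4
    · have hy' : ‖y‖ ≤ 1/2 := (mem_ball_zero_iff.1 hy).le
      have hn := norm_nonneg (x - y)
      by_cases hξ : L1 + 18 ≤ ‖ξ‖
      · have := ishii_lions hlam hL1p.le hL1 hF hP hc (Or.inl hξ) hu h1 h2 hosc hy' hxy
        nlinarith
      · have := ishii_lions hlam (L := 2 * L1 + 72) (by positivity) (by nlinarith) hF hP hc
          (Or.inr (by linarith)) hu h1 h2 hosc hy' hxy
        nlinarith
    · push Not at hxy
      have := hosc x (ball_subset_ball (by norm_num) hx) y (ball_subset_ball (by norm_num) hy)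
      nlinarith
  intro x hx y hy
  rw [abs_le]
  have a := hone x hx y hy
  have b := hone y hy x hx
  rw [norm_sub_rev] at b
  constructor <;> linarith

end KS12

section KS13
open Filter
variable {E : Type*} [NormedAddCommGroup E] [InnerProductSpace ℝ E] [FiniteDimensional ℝ E]

lemma contact_pert {G : E → (E →L[ℝ] E) → Prop} {U : Set E} {v : E → ℝ} (hG : SubV G U v)
    {x0 p a : E} {A : E →L[ℝ] E} (hA : SymOp A) {r δ η w : ℝ} (hr : 0 < r) (hw : 0 ≤ w)
    (hU : closedBall x0 r ⊆ U) (hv : ContinuousOn v (closedBall x0 r))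
    (hup : ∀ x ∈ closedBall x0 r, v x ≤ v x0 + inner ℝ p (x - x0) +
      (1/2) * inner ℝ (A (x - x0)) (x - x0) - δ / 2 * ‖x - x0‖ ^ 2 + η)
    (hη : η + w * (‖a‖ * r) < δ / 2 * r ^ 2) :
    ∃ x ∈ ball x0 r, ∃ s : ℝ, (s = 1 ∨ s = -1) ∧ s * inner ℝ a (x - x0) = |inner ℝ a (x - x0)| ∧
      G (p + A (x - x0) - (w * s) • a) A := by
  have hproper : ProperSpace E := FiniteDimensional.proper_real E
  obtain ⟨g, hg⟩ : ∃ g : E → ℝ, g = fun x => v x - inner ℝ p (x - x0) -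
      (1/2) * inner ℝ (A (x - x0)) (x - x0) + w * |inner ℝ a (x - x0)| := ⟨_, rfl⟩
  have hgc : ContinuousOn g (closedBall x0 r) := by
    rw [hg]
    refine ((hv.sub ?_).sub ?_).add ?_
    · exact Continuous.continuousOn (by fun_prop)
    · exact Continuous.continuousOn (by fun_prop)
    · exact Continuous.continuousOn (by fun_prop)
  obtain ⟨x, hx, hmax⟩ := (isCompact_closedBall x0 r).exists_isMaxOn ⟨x0, mem_closedBall_self hr.le⟩ hgc
  have hmax' : ∀ z ∈ closedBall x0 r, g z ≤ g x := fun z hz => hmax hz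
  have hg0 : g x0 = v x0 := by rw [hg]; simp
  have hxb : x ∈ ball x0 r := by
    rw [mem_ball_iff_norm]
    rw [mem_closedBall_iff_norm] at hx
    refine lt_of_le_of_ne hx fun he => ?_
    have b1 := hmax' x0 (mem_closedBall_self hr.le)
    have b2 := hup x (by rw [mem_closedBall_iff_norm]; exact hx)
    have b3 := abs_real_inner_le_norm a (x - x0)
    rw [he] at b3 b2
    have b4 := mul_le_mul_of_nonneg_left b3 hw
    rw [hg0, hg] at b1
    simp only at b1
    linarith
  obtain ⟨s, hs, hsa⟩ : ∃ s : ℝ, (s = 1 ∨ s = -1) ∧ s * inner ℝ a (x - x0) = |inner ℝ a (x - x0)| := by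
    rcases le_total 0 (inner ℝ a (x - x0)) with h | h
    · exact ⟨1, Or.inl rfl, by rw [abs_of_nonneg h, one_mul]⟩
    · exact ⟨-1, Or.inr rfl, by rw [abs_of_nonpos h]; ring⟩
  refine ⟨x, hxb, s, hs, hsa, hG x (hU hx) _ _ hA ?_⟩
  filter_upwards [isOpen_ball.mem_nhds hxb] with z hz
  have b1 := hmax' z (ball_subset_closedBall hz)
  rw [hg] at b1
  simp only at b1
  rw [← hsa] at b1
  have b2 : s * inner ℝ a (z - x0) ≤ |inner ℝ a (z - x0)| := by
    rcases hs with h | h <;> rw [h]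
    · rw [one_mul]; exact le_abs_self _
    · rw [neg_one_mul]; exact neg_le_abs _
  have b3 := mul_le_mul_of_nonneg_left b2 hw
  obtain ⟨d, hd⟩ : ∃ d, d = z - x := ⟨_, rfl⟩
  obtain ⟨y, hy⟩ : ∃ y, y = x - x0 := ⟨_, rfl⟩
  have e1 : z - x0 = y + d := by rw [hd, hy]; abel
  rw [e1] at b1 b3
  rw [← hy] at b1 ⊢
  rw [← hd]
  simp only [map_add, inner_add_left, inner_add_right, inner_sub_left, inner_smul_left,
    RCLike.conj_to_real] at b1 b3 ⊢
  have e2 : inner ℝ (A d) y = inner ℝ (A y) d := by rw [hA, real_inner_comm]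
  rw [e2] at b1
  linarith

lemma Ell.limit {l : Filter ℕ} [l.NeBot] {lam Lam : ℝ} {F : (E →L[ℝ] E) → ℝ}
    {Fk : ℕ → (E →L[ℝ] E) → ℝ}
    (hFk : ∀ k, Ell lam Lam (Fk k)) (hF : ∀ A, SymOp A → Tendsto (fun k => Fk k A) l (𝓝 (F A))) :
    Ell lam Lam F := by
  intro A B hA hB hp
  have h := (hF A hA).sub (hF (A + B) (hA.add hB))
  exact ⟨ge_of_tendsto' h fun k => (hFk k A B hA hB hp).1,
    le_of_tendsto' h fun k => (hFk k A B hA hB hp).2⟩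

lemma stable_sub {l : Filter ℕ} [l.NeBot] {lam Lam : ℝ} (hlam : 0 < lam) (hlL : lam ≤ Lam)
    {F : (E →L[ℝ] E) → ℝ}
    {Fk : ℕ → (E →L[ℝ] E) → ℝ} (hFk : ∀ k, Ell lam Lam (Fk k))
    (hF : ∀ A, SymOp A → Tendsto (fun k => Fk k A) l (𝓝 (F A))) (hF0 : F 0 = 0)
    {uk : ℕ → E → ℝ} {u : E → ℝ} (huk : ∀ k, ContinuousOn (uk k) (ball 0 1))
    (hunif : ∀ ε > 0, ∀ᶠ k in l, ∀ x ∈ ball (0:E) (1/2), |uk k x - u x| ≤ ε)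
    {c : ℕ → ℝ} (hc : Tendsto c l (𝓝 0)) {P : ℝ} (hP : 0 ≤ P) {ξ : ℕ → E}
    (hsub : ∀ k, SubV (Deg P (ξ k) (c k) (Fk k)) (ball 0 1) (uk k)) :
    SubV (fun _ A => F A ≤ 0) (ball 0 (1/2)) u := by
  intro x0 hx0 p A hA htouch
  have hFE : Ell lam Lam F := Ell.limit hFk hF
  have hLam : 0 < Lam := hlam.trans_le hlL
  by_contra hcon
  push Not at hcon
  obtain ⟨n, hn⟩ : ∃ n : ℝ, n = Module.finrank ℝ E := ⟨_, rfl⟩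
  have hn0 : 0 ≤ n := by rw [hn]; positivity
  obtain ⟨δ, hδ, hδF⟩ : ∃ δ > 0, Lam * (δ * n) < F A := by
    refine ⟨F A / (Lam * (n + 1)), by positivity, ?_⟩
    rw [show Lam * (F A / (Lam * (n + 1)) * n) = F A * (n / (n + 1)) by field_simp]
    have : n / (n + 1) < 1 := by rw [div_lt_one (by positivity)]; linarith
    nlinarith
  obtain ⟨B, hB⟩ : ∃ B, B = A + δ • ContinuousLinearMap.id ℝ E := ⟨_, rfl⟩
  have hBs : SymOp B := by rw [hB]; exact hA.add (SymOp.id.smul _)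
  have hFB : 0 < F B := by
    have := (hFE A (δ • ContinuousLinearMap.id ℝ E) hA (SymOp.id.smul _) (PosO.id.smul hδ.le)).2
    rw [trO_smul, trO_id, ← hB, ← hn] at this
    linarith
  obtain ⟨e, he⟩ : ∃ e, inner ℝ (B e) e < 0 := by
    by_contra h
    push Not at h
    have h1 := (hFE 0 B SymOp.zero hBs h).1
    have h2 := PosO.trO_nonneg (A := B) h
    rw [zero_add, hF0] at h1
    have : 0 ≤ lam * trO B := by positivity
    linarith
  obtain ⟨a, ha⟩ : ∃ a, a = B e := ⟨_, rfl⟩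
  have hae : inner ℝ a e < 0 := by rw [ha]; exact he
  have he0 : 0 < ‖e‖ := by
    rw [norm_pos_iff]; rintro rfl; simp at he
  have ha0 : 0 < ‖a‖ := by
    rw [norm_pos_iff]; rintro rfl; simp at hae
  have hBi : ∀ d, inner ℝ (B d) d = inner ℝ (A d) d + δ * ‖d‖ ^ 2 := by
    intro d
    rw [hB]
    simp only [add_apply, smul_apply, ContinuousLinearMap.id_apply, inner_add_left,
      inner_smul_left, real_inner_self_eq_norm_sq, RCLike.conj_to_real]
  -- radius
  obtain ⟨R, hR, hRs⟩ := Metric.eventually_nhds_iff_ball.1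
    (htouch.and (isOpen_ball.mem_nhds hx0))
  have key : ∀ r w : ℝ, 0 < r → r < R → 0 ≤ w → w * (‖a‖ * r) < δ / 4 * r ^ 2 → ∀ᶠ k in l,
      ∃ x ∈ ball x0 r, ∃ s : ℝ, (s = 1 ∨ s = -1) ∧ s * inner ℝ a (x - x0) = |inner ℝ a (x - x0)| ∧
      Deg P (ξ k) (c k) (Fk k) (p + B (x - x0) - (w * s) • a) B := by
    intro r w hr hrR hw hwr
    filter_upwards [hunif (δ / 8 * r ^ 2) (by positivity)] with k hk
    have hcb : closedBall x0 r ⊆ ball x0 R := closedBall_subset_ball hrR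
    have hU : closedBall x0 r ⊆ ball 0 1 := fun x hx =>
      ball_subset_ball (by norm_num) (hRs x (hcb hx)).2
    refine contact_pert (hsub k) hBs hr hw hU ((huk k).mono hU) (δ := δ) (η := δ / 4 * r ^ 2)
      (fun x hx => ?_) (by linarith)
    have b1 := hRs x (hcb hx)
    have b2 := abs_le.1 (hk x b1.2)
    have b3 := abs_le.1 (hk x0 hx0)
    rw [hBi]
    linarith [b1.1]
  obtain ⟨r1, hr1, hr1R⟩ : ∃ r1, 0 < r1 ∧ r1 < R := ⟨R / 2, by positivity, by linarith⟩
  obtain ⟨w, hw, hwr⟩ : ∃ w, 0 < w ∧ w * (‖a‖ * r1) < δ / 4 * r1 ^ 2 := by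
    refine ⟨δ / 8 * r1 / ‖a‖, by positivity, ?_⟩
    rw [show δ / 8 * r1 / ‖a‖ * (‖a‖ * r1) = δ / 8 * r1 ^ 2 by field_simp]
    have : 0 < δ * r1 ^ 2 := by positivity
    linarith
  obtain ⟨κ, hκ⟩ : ∃ κ, κ = w * (-inner ℝ a e) / 2 := ⟨_, rfl⟩
  have hκ0 : 0 < κ := by
    have : 0 < -inner ℝ a e := by linarith
    rw [hκ]; positivity
  obtain ⟨r2, hr2, hr2R, hr2κ⟩ : ∃ r2, 0 < r2 ∧ r2 < R ∧ ‖a‖ * r2 ≤ κ / 2 := by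
    refine ⟨min (R / 2) (κ / 2 / ‖a‖), by positivity, ?_, ?_⟩
    · have := min_le_left (R / 2) (κ / 2 / ‖a‖); linarith
    · have := mul_le_mul_of_nonneg_left (min_le_right (R / 2) (κ / 2 / ‖a‖)) ha0.le
      rwa [mul_div_cancel₀ _ ha0.ne'] at this
  have k1 := key r1 w hr1 hr1R hw.le hwr
  have k2 := key r2 0 hr2 hr2R le_rfl (by rw [zero_mul]; positivity)
  obtain ⟨κ', hκ'⟩ : ∃ κ', κ' = κ / 2 / ‖e‖ := ⟨_, rfl⟩
  have hκ'0 : 0 < κ' := by rw [hκ']; positivity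
  have hinn : ∀ (x : E) (k : ℕ) (t : ℝ), inner ℝ (ξ k + (p + B (x - x0) - t • a)) e =
      inner ℝ (ξ k + p) e + inner ℝ a (x - x0) - t * inner ℝ a e := by
    intro x k t
    have : inner ℝ (B (x - x0)) e = inner ℝ a (x - x0) := by
      rw [hBs, ← ha, real_inner_comm]
    simp only [inner_add_left, inner_sub_left, inner_smul_left, RCLike.conj_to_real, this]
    ring
  have hfin : ∀ᶠ k in l, ∃ z, κ' ≤ ‖ξ k + z‖ ∧ Deg P (ξ k) (c k) (Fk k) z B := by
    filter_upwards [k1, k2] with k h1 h2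
    have hsuff : ∀ z, κ / 2 ≤ |inner ℝ (ξ k + z) e| → κ' ≤ ‖ξ k + z‖ := by
      intro z hz
      rw [hκ', div_le_iff₀ he0]
      exact hz.trans (abs_real_inner_le_norm _ _)
    by_cases hk : |inner ℝ (ξ k + p) e| ≤ κ
    · obtain ⟨x, -, s, hs, hsa, hD⟩ := h1
      refine ⟨_, hsuff _ ?_, hD⟩
      rw [hinn]
      have b0 := abs_nonneg (inner ℝ a (x - x0))
      have b1 := abs_le.1 hk
      rw [le_abs]
      rcases hs with h | h
      · rw [h] at hsa ⊢
        left
        linarith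
      · rw [h] at hsa ⊢
        right
        linarith
    · push Not at hk
      obtain ⟨x, hx, s, hs, hsa, hD⟩ := h2
      refine ⟨_, hsuff _ ?_, hD⟩
      rw [hinn, zero_mul, zero_mul, sub_zero]
      have b1 := abs_real_inner_le_norm a (x - x0)
      have b2 : ‖a‖ * ‖x - x0‖ ≤ ‖a‖ * r2 := by
        have := (mem_ball_iff_norm.1 hx).le
        gcongr
      have b3 := abs_sub_abs_le_abs_sub (inner ℝ (ξ k + p) e) (-inner ℝ a (x - x0))
      rw [sub_neg_eq_add, abs_neg] at b3
      linarith
  have hm0 : 0 < min 1 (κ' ^ P) := lt_min one_pos (Real.rpow_pos_of_pos hκ'0 P)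
  have hlim : Tendsto (fun k => c k - min 1 (κ' ^ P) * Fk k B) l (𝓝 (0 - min 1 (κ' ^ P) * F B)) :=
    hc.sub ((hF B hBs).const_mul _)
  have hge : 0 ≤ 0 - min 1 (κ' ^ P) * F B := by
    apply ge_of_tendsto hlim
    filter_upwards [hfin, (hF B hBs).eventually (lt_mem_nhds hFB)] with k hk hpos
    obtain ⟨z, hz, hD⟩ := hk
    rw [Deg] at hD
    have : min 1 (κ' ^ P) ≤ min 1 (‖ξ k + z‖ ^ P) := by
      gcongr
    nlinarith
  nlinarith

end KS13

section KS14
open Filter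
variable {E : Type*} [NormedAddCommGroup E] [InnerProductSpace ℝ E] [FiniteDimensional ℝ E]

lemma Ell.le_bound {lam Lam : ℝ} (hlam : 0 < lam) (hlL : lam ≤ Lam) {F : (E →L[ℝ] E) → ℝ}
    (hF : Ell lam Lam F) (hF0 : F 0 = 0) {A : E →L[ℝ] E} (hA : SymOp A) :
    F A ≤ Lam * (‖A‖ * Module.finrank ℝ E) := by
  have hp : PosO (A + ‖A‖ • ContinuousLinearMap.id ℝ E) := by
    intro x
    have := abs_le.1 (abs_inner_op_le A x x)
    simp only [add_apply, smul_apply, ContinuousLinearMap.id_apply, inner_add_left,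
      inner_smul_left, real_inner_self_eq_norm_sq, RCLike.conj_to_real]
    linarith
  have h := hF.lower (X := 0) SymOp.zero (hA.add (SymOp.id.smul ‖A‖)) (SymOp.id.smul ‖A‖) hp
    (PosO.id.smul (norm_nonneg A))
  rw [zero_add, add_sub_cancel_right, hF0, trO_smul, trO_id] at h
  have h2 := hp.trO_nonneg
  have : 0 ≤ lam * trO (A + ‖A‖ • ContinuousLinearMap.id ℝ E) := by positivity
  linarith

lemma dualF_zero {F : (E →L[ℝ] E) → ℝ} (hF0 : F 0 = 0) : dualF F 0 = 0 := by
  simp [dualF, hF0]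

lemma Ell.abs_bound {lam Lam : ℝ} (hlam : 0 < lam) (hlL : lam ≤ Lam) {F : (E →L[ℝ] E) → ℝ}
    (hF : Ell lam Lam F) (hF0 : F 0 = 0) {A : E →L[ℝ] E} (hA : SymOp A) :
    |F A| ≤ Lam * (‖A‖ * Module.finrank ℝ E) := by
  have h1 := hF.le_bound hlam hlL hF0 hA
  have h2 := hF.dual.le_bound hlam hlL (dualF_zero hF0) hA.neg
  rw [dualF, neg_neg, norm_neg] at h2
  rw [abs_le]
  constructor <;> linarith

lemma ultra_lim (l : Ultrafilter ℕ) {f : ℕ → ℝ} {M : ℝ} (hM : ∀ k, |f k| ≤ M) :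
    ∃ x, Tendsto f l (𝓝 x) := by
  obtain ⟨x, -, hx⟩ := (isCompact_Icc (a := -M) (b := M)).ultrafilter_le_nhds (l.map f)
    (by
      rw [le_principal_iff]
      have : ∀ᶠ k in (l : Filter ℕ), f k ∈ Icc (-M) M := Eventually.of_forall fun k => abs_le.1 (hM k)
      exact this)
  exact ⟨x, hx⟩

variable [MeasurableSpace E] [BorelSpace E]

theorem abstract_approx {lam Lam : ℝ} (hlam : 0 < lam) (hlL : lam ≤ Lam) : ∃ σ ∈ Ioo (0:ℝ) 1,
    ∀ P : ℝ, 0 ≤ P → ∃ ε₀ ∈ Ioo (0:ℝ) 1,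
    ∀ F : (E →L[ℝ] E) → ℝ, Ell lam Lam F → F 0 = 0 → ∀ (ξ : E) (c : ℝ), 0 ≤ c → c ≤ ε₀ →
    ∀ u : E → ℝ, ContinuousOn u (ball 0 1) → (∀ x ∈ ball (0:E) 1, |u x| ≤ 1) →
    (∀ x ∈ ball (0:E) 1, ∀ y ∈ ball (0:E) 1, u x - u y ≤ 1) →
    SubV (Deg P ξ c F) (ball 0 1) u →
    SubV (Deg P (-ξ) c (dualF F)) (ball 0 1) (fun x => - u x) →
    ∃ (p : E) (m : ℝ), m < σ / 2 ∧ ∀ x ∈ ball (0:E) σ, ∀ y ∈ ball (0:E) σ,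
      (u x - inner ℝ p x) - (u y - inner ℝ p y) ≤ m := by
  obtain ⟨K, hK, hlip⟩ := deg_lip (E := E) hlam hlL
  obtain ⟨σ, hσ, hσ4, hgrad⟩ := grad_close (E := E) hlam hlL hK
  refine ⟨σ, ⟨hσ, by linarith⟩, fun P hP => ?_⟩
  by_contra hcon
  push Not at hcon
  have hε : ∀ k : ℕ, (1 / ((k:ℝ) + 2)) ∈ Ioo (0:ℝ) 1 := by
    intro k
    refine ⟨by positivity, ?_⟩
    rw [div_lt_one (by positivity)]
    have : (0:ℝ) ≤ k := by positivity
    linarith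
  choose Fk hFk hFk0 ξ c hc0 hc uk huk hub hosc hs1 hs2 hbad using fun k => hcon _ (hε k)
  obtain ⟨l, hl⟩ : ∃ l : Ultrafilter ℕ, l = hyperfilter ℕ := ⟨_, rfl⟩
  have hlat : (l : Filter ℕ) ≤ atTop := by
    rw [hl]; exact Nat.hyperfilter_le_atTop
  have hclim : Tendsto c l (𝓝 0) := by
    have h1 : Tendsto (fun k : ℕ => 1 / ((k:ℝ) + 2)) atTop (𝓝 0) := by
      have : Tendsto (fun k : ℕ => (k:ℝ) + 2) atTop atTop :=
        tendsto_atTop_add_const_right _ _ tendsto_natCast_atTop_atTop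
      simp only [one_div]
      exact this.inv_tendsto_atTop
    exact squeeze_zero hc0 hc (h1.mono_left hlat)
  -- limit operator
  have hFex : ∀ A : E →L[ℝ] E, ∃ y, SymOp A → Tendsto (fun k => Fk k A) l (𝓝 y) := by
    intro A
    by_cases hA : SymOp A
    · obtain ⟨y, hy⟩ := ultra_lim l fun k => (hFk k).abs_bound hlam hlL (hFk0 k) hA
      exact ⟨y, fun _ => hy⟩
    · exact ⟨0, fun h => absurd h hA⟩
  choose F hF using hFex
  have hF0 : F 0 = 0 := by
    have h1 := hF 0 SymOp.zero
    simp only [hFk0] at h1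
    exact tendsto_nhds_unique h1 tendsto_const_nhds
  have hFE : Ell lam Lam F := Ell.limit hFk hF
  have hdF : ∀ A, SymOp A → Tendsto (fun k => dualF (Fk k) A) l (𝓝 (dualF F A)) := fun A hA =>
    (hF (-A) hA.neg).neg
  -- limit function
  have huex : ∀ x : E, ∃ y, x ∈ ball (0:E) 1 → Tendsto (fun k => uk k x) l (𝓝 y) := by
    intro x
    by_cases hx : x ∈ ball (0:E) 1
    · obtain ⟨y, hy⟩ := ultra_lim l fun k => hub k x hx
      exact ⟨y, fun _ => hy⟩
    · exact ⟨0, fun h => absurd h hx⟩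
  choose u hu using huex
  have hsub : ball (0:E) (1/2) ⊆ ball 0 1 := ball_subset_ball (by norm_num)
  have hklip : ∀ k, ∀ x ∈ ball (0:E) (1/2), ∀ y ∈ ball (0:E) (1/2), |uk k x - uk k y| ≤ K * ‖x - y‖ :=
    fun k => hlip _ (hFk k) P hP (ξ k) (c k) ((hc k).trans (hε k).2.le) (uk k) (huk k) (hs1 k) (hs2 k)
      (hosc k)
  have hulip : ∀ x ∈ ball (0:E) (1/2), ∀ y ∈ ball (0:E) (1/2), |u x - u y| ≤ K * ‖x - y‖ := by
    intro x hx y hy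
    exact le_of_tendsto' ((hu x (hsub hx)).sub (hu y (hsub hy))).abs fun k => hklip k x hx y hy
  have hunif : ∀ ε > 0, ∀ᶠ k in (l : Filter ℕ), ∀ x ∈ ball (0:E) (1/2), |uk k x - u x| ≤ ε := by
    intro ε hε
    have hproper : ProperSpace E := FiniteDimensional.proper_real E
    have htb : TotallyBounded (ball (0:E) (1/2)) :=
      (isCompact_closedBall (0:E) (1/2)).totallyBounded.subset ball_subset_closedBall
    obtain ⟨t, hts, htf, hcov⟩ := Metric.finite_approx_of_totallyBounded htb (ε / (3 * K)) (by positivity)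
    have h1 : ∀ᶠ k in (l : Filter ℕ), ∀ y ∈ t, |uk k y - u y| < ε / 3 := by
      rw [htf.eventually_all]
      intro y hy
      have h2 := ((hu y (hsub (hts hy))).sub_const (u y)).abs
      rw [sub_self, abs_zero] at h2
      exact h2.eventually (gt_mem_nhds (by positivity))
    filter_upwards [h1] with k hk x hx
    obtain ⟨y, hy, hxy⟩ := mem_iUnion₂.1 (hcov hx)
    rw [mem_ball_iff_norm] at hxy
    have b1 := hk y hy
    have b2 := hklip k x hx y (hts hy)
    have b3 := hulip x hx y (hts hy)
    have b4 : K * ‖x - y‖ ≤ ε / 3 := by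
      have := mul_le_mul_of_nonneg_left hxy.le hK.le
      refine this.trans (le_of_eq ?_)
      field_simp
    rw [abs_le] at b2 b3 ⊢
    rw [abs_lt] at b1
    constructor <;> linarith
  have hcont : ContinuousOn u (ball 0 (1/2)) := by
    have : LipschitzOnWith K.toNNReal u (ball 0 (1/2)) := by
      apply LipschitzOnWith.of_dist_le_mul
      intro x hx y hy
      rw [Real.dist_eq, dist_eq_norm, Real.coe_toNNReal _ hK.le]
      exact hulip x hx y hy
    exact this.continuousOn
  have hH : Harm F (ball 0 (1/2)) u := by
    refine ⟨hcont, stable_sub hlam hlL hFk hF hF0 huk hunif hclim hP hs1, ?_⟩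
    refine stable_sub hlam hlL (fun k => (hFk k).dual) hdF (dualF_zero hF0)
      (uk := fun k x => - uk k x) (fun k => (huk k).neg) ?_ hclim hP hs2
    intro ε hε
    filter_upwards [hunif ε hε] with k hk x hx
    have := hk x hx
    rw [← abs_neg]
    convert this using 2
    ring
  obtain ⟨p, hp⟩ := hgrad F hFE u hH hulip
  obtain ⟨k, hk⟩ := (hunif (σ / 16) (by positivity)).exists
  obtain ⟨x, hx, y, hy, hxy⟩ := hbad k p (σ / 4) (by linarith)
  have hσs : ball (0:E) σ ⊆ ball 0 (1/2) := ball_subset_ball (by linarith)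
  have b1 := abs_le.1 (hk x (hσs hx))
  have b2 := abs_le.1 (hk y (hσs hy))
  have b3 := abs_le.1 (hp x hx y hy)
  have b4 : ‖x - y‖ ≤ 2 * σ := by
    have := norm_sub_le x y
    rw [mem_ball_zero_iff] at hx hy
    linarith
  rw [inner_sub_right] at b3
  linarith

end KS14

section KS15
open Filter

lemma scalar_deg {t P pp pm Hq Hs G c : ℝ} (ht : 0 ≤ t) (hpp : 0 ≤ pp) (hpm : 0 ≤ pm)
    (hP1 : pp ≤ P) (hP2 : pm ≤ P) (hq : t ^ pp ≤ Hq) (hs : t ^ pm ≤ Hs) (hc : 0 ≤ c)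
    (h : min G (min (Hq * G) (Hs * G)) ≤ c) : min 1 (t ^ P) * G ≤ c := by
  have h0 : 0 ≤ min 1 (t ^ P) := le_min zero_le_one (Real.rpow_nonneg ht P)
  rcases le_or_gt G 0 with hG | hG
  · nlinarith
  have key : ∀ r, 0 ≤ r → r ≤ P → min 1 (t ^ P) ≤ t ^ r := by
    intro r hr hrP
    rcases le_or_gt 1 t with h1 | h1
    · exact (min_le_left _ _).trans (Real.one_le_rpow h1 hr)
    · exact (min_le_right _ _).trans (Real.rpow_le_rpow_of_exponent_ge' ht h1.le hr hrP)
  rw [min_le_iff, min_le_iff] at h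
  rcases h with h | h | h
  · have := min_le_left 1 (t ^ P)
    nlinarith
  · have := (key pp hpp hP1).trans hq
    nlinarith
  · have := (key pm hpm hP2).trans hs
    nlinarith

variable {n : ℕ}

/-- matrix of an operator in the standard basis -/
def opM (A : En n →L[ℝ] En n) : Mat n := Matrix.of fun i j =>
  inner ℝ (A (EuclideanSpace.single i (1:ℝ))) (EuclideanSpace.single j (1:ℝ))

lemma opM_apply (A : En n →L[ℝ] En n) (i j : Fin n) : opM A i j =
  inner ℝ (A (EuclideanSpace.single i (1:ℝ))) (EuclideanSpace.single j (1:ℝ)) := rfl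

lemma opM_add (A B : En n →L[ℝ] En n) : opM (A + B) = opM A + opM B := by
  ext i j
  simp only [Matrix.add_apply, opM_apply, add_apply, inner_add_left]

lemma opM_zero : opM (0 : En n →L[ℝ] En n) = 0 := by
  ext i j
  simp only [opM_apply, zero_apply, inner_zero_left, Matrix.zero_apply]

lemma opM_symm {A : En n →L[ℝ] En n} (hA : SymOp A) : (opM A).IsSymm := by
  ext i j
  rw [Matrix.transpose_apply, opM_apply, opM_apply, hA, real_inner_comm]

lemma opM_trace (A : En n →L[ℝ] En n) : (opM A).trace = trO A := by
  rw [trO, LinearMap.trace_eq_sum_inner _ (EuclideanSpace.basisFun (Fin n) ℝ)]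
  simp only [Matrix.trace, Matrix.diag_apply]
  refine Finset.sum_congr rfl fun i _ => ?_
  rw [opM_apply, real_inner_comm]
  simp

lemma opM_pos {A : En n →L[ℝ] En n} (hA : SymOp A) (hp : PosO A) : (opM A).PosSemidef := by
  refine Matrix.PosSemidef.of_dotProduct_mulVec_nonneg ?_ fun x => ?_
  · rw [Matrix.IsHermitian, Matrix.conjTranspose_eq_transpose_of_trivial]
    exact opM_symm hA
  · have h := hp (∑ i, x i • EuclideanSpace.single i (1:ℝ))
    refine h.trans_eq ?_
    symm
    rw [map_sum, sum_inner]
    simp only [dotProduct, Matrix.mulVec, star_trivial]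
    refine Finset.sum_congr rfl fun i _ => ?_
    rw [inner_sum, Finset.mul_sum]
    refine Finset.sum_congr rfl fun j _ => ?_
    rw [map_smul, inner_smul_left, inner_smul_right, opM_apply]
    simp only [RCLike.conj_to_real]
    ring

lemma opM_ell {lam Lam : ℝ} {F : Mat n → ℝ} (hF : UniformlyElliptic lam Lam F) :
    Ell lam Lam (fun A : En n →L[ℝ] En n => F (opM A)) := by
  intro A B hA hB hp
  have := hF.2 (opM A) (opM B) (opM_symm hA) (opM_symm hB) (opM_pos hB hp)
  rw [opM_trace, ← opM_add] at this
  exact this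

/-- quadratic test function -/
def quadT (x0 p : En n) (A : En n →L[ℝ] En n) (x : En n) : ℝ :=
  inner ℝ p (x - x0) + (1/2) * inner ℝ (A (x - x0)) (x - x0)

lemma quadT_contDiff (x0 p : En n) (A : En n →L[ℝ] En n) : ContDiff ℝ 2 (quadT x0 p A) := by
  unfold quadT
  have h1 : ContDiff ℝ 2 (fun x : En n => x - x0) := contDiff_id.sub contDiff_const
  exact (contDiff_const.inner ℝ h1).add (contDiff_const.mul ((A.contDiff.comp h1).inner ℝ h1))

lemma quadT_fderiv (x0 p : En n) {A : En n →L[ℝ] En n} (hA : SymOp A) (x : En n) :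
    HasFDerivAt (quadT x0 p A) (innerSL ℝ (p + A (x - x0))) x := by
  have h1 : HasFDerivAt (fun x : En n => x - x0) (ContinuousLinearMap.id ℝ (En n)) x :=
    (hasFDerivAt_id x).sub_const x0
  have h2 : HasFDerivAt (fun x : En n => A (x - x0)) (A ∘L ContinuousLinearMap.id ℝ (En n)) x :=
    A.hasFDerivAt.comp x h1
  have h3 := ((hasFDerivAt_const p x).inner ℝ h1).add ((h2.inner ℝ h1).const_mul (1/2))
  refine h3.congr_fderiv ?_
  ext v
  have e2 : inner ℝ (A v) (x - x0) = inner ℝ (A (x - x0)) v := by rw [hA, real_inner_comm]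
  simp [e2]
  rw [inner_sub_left]
  ring

lemma quadT_gradient (x0 p : En n) {A : En n →L[ℝ] En n} (hA : SymOp A) :
    gradient (quadT x0 p A) x0 = p := by
  have h := quadT_fderiv x0 p hA x0
  rw [sub_self, map_zero, add_zero] at h
  have : HasGradientAt (quadT x0 p A) p x0 := h
  exact this.gradient

lemma quadT_hessian (x0 p : En n) {A : En n →L[ℝ] En n} (hA : SymOp A) :
    hessianMatrix (quadT x0 p A) x0 = opM A := by
  have h1 : fderiv ℝ (quadT x0 p A) = fun x => innerSL ℝ (p + A (x - x0)) := by
    ext1 x; exact (quadT_fderiv x0 p hA x).fderiv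
  have h2 : HasFDerivAt (fun x => innerSL ℝ (p + A (x - x0))) ((innerSL ℝ) ∘L A) x0 := by
    have : HasFDerivAt (fun x : En n => p + A (x - x0)) A x0 := by
      have := (A.hasFDerivAt.comp x0 ((hasFDerivAt_id x0).sub_const x0)).const_add p
      exact this
    exact (innerSL ℝ).hasFDerivAt.comp x0 this
  ext i j
  rw [hessianMatrix, Matrix.of_apply, iteratedFDeriv_two_apply, h1, h2.fderiv]
  rw [opM_apply]
  rfl

lemma sub_conv {F : Mat n → ℝ} {pp pm q s P : ℝ} (hpp : 0 ≤ pp) (hpm : 0 ≤ pm)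
    (hP1 : pp ≤ P) (hP2 : pm ≤ P) {a b : En n → ℝ} {ξ : En n} {c : ℝ} (hc : 0 ≤ c)
    (ha : ∀ x ∈ ball (0 : En n) 1, 0 ≤ a x) (hb : ∀ x ∈ ball (0 : En n) 1, 0 ≤ b x) {u : En n → ℝ}
    (h : ViscSubOn (ball 0 1) (minOp F pp pm q s a b ξ fun _ => c) u) :
    SubV (Deg P ξ c (fun A => F (opM A))) (ball 0 1) u := by
  intro x hx p A hA ht
  have h1 := h (quadT x p A) (quadT_contDiff _ _ _) x hx (by
    refine Filter.Eventually.filter_mono nhdsWithin_le_nhds ?_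
    filter_upwards [ht] with z hz
    simp only [quadT, sub_self, inner_zero_right, map_zero]
    linarith)
  rw [quadT_gradient x p hA, quadT_hessian x p hA, minOp] at h1
  refine scalar_deg (norm_nonneg _) hpp hpm hP1 hP2 (Hq := Hfun pp q a ξ x p)
    (Hs := Hfun pm s b ξ x p) ?_ ?_ hc (by linarith)
  · have := mul_nonneg (ha x hx) (Real.rpow_nonneg (norm_nonneg (ξ + p)) q)
    rw [Hfun]; linarith
  · have := mul_nonneg (hb x hx) (Real.rpow_nonneg (norm_nonneg (ξ + p)) s)
    rw [Hfun]; linarith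

lemma sup_conv {F : Mat n → ℝ} {pp pm q s P : ℝ} (hpp : 0 ≤ pp) (hpm : 0 ≤ pm)
    (hP1 : pp ≤ P) (hP2 : pm ≤ P) {a b : En n → ℝ} {ξ : En n} {c : ℝ} (hc : 0 ≤ c)
    (ha : ∀ x ∈ ball (0 : En n) 1, 0 ≤ a x) (hb : ∀ x ∈ ball (0 : En n) 1, 0 ≤ b x) {u : En n → ℝ}
    (h : ViscSupOn (ball 0 1) (maxOp F pp pm q s a b ξ fun _ => -c) u) :
    SubV (Deg P (-ξ) c (dualF (fun A => F (opM A)))) (ball 0 1) (fun x => - u x) := by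
  intro x hx p A hA ht
  have h1 := h (quadT x (-p) (-A)) (quadT_contDiff _ _ _) x hx (by
    refine Filter.Eventually.filter_mono nhdsWithin_le_nhds ?_
    filter_upwards [ht] with z hz
    simp only [quadT, sub_self, inner_zero_right, neg_apply, inner_neg_left]
    linarith)
  rw [quadT_gradient x (-p) hA.neg, quadT_hessian x (-p) hA.neg, maxOp] at h1
  have hn : ‖ξ + -p‖ = ‖-ξ + p‖ := by
    rw [← norm_neg]; congr 1; abel
  refine scalar_deg (norm_nonneg _) hpp hpm hP1 hP2 (Hq := Hfun pp q a ξ x (-p))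
    (Hs := Hfun pm s b ξ x (-p)) ?_ ?_ hc ?_
  · have := mul_nonneg (ha x hx) (Real.rpow_nonneg (norm_nonneg (ξ + -p)) q)
    rw [Hfun, ← hn]; linarith
  · have := mul_nonneg (hb x hx) (Real.rpow_nonneg (norm_nonneg (ξ + -p)) s)
    rw [Hfun, ← hn]; linarith
  · have e : ∀ f g k : ℝ, min (-f) (min (g * -f) (k * -f)) = - max f (max (g * f) (k * f)) := by
      intro f g k
      rw [mul_neg, mul_neg, min_neg_neg, min_neg_neg]
    rw [dualF, e]
    linarith

end KS15

/-- harmonic approximation — an `ε₀`-normalized viscosity solution of the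
switched differential inequalities on `B₁(0)` is, on `B_σ(0)`, within `σ/2` (in
oscillation) of an affine function. -/
theorem harmonic_approximation
    {n : ℕ} (hn : 2 ≤ n) (lam Lam : ℝ) (hlam : 0 < lam) (hlL : lam ≤ Lam) :
    ∃ σ ∈ Set.Ioo (0:ℝ) 1,
      ∀ pp pm q s : ℝ, 0 ≤ pp → pp ≤ q → 0 ≤ pm → pm ≤ s →
        ∃ ε₀ ∈ Set.Ioo (0:ℝ) 1,
          ∀ F : Mat n → ℝ, UniformlyElliptic lam Lam F → F 0 = 0 →
          ∀ a b : En n → ℝ, ContinuousOn a (ball 0 1) → (∀ x ∈ ball (0 : En n) 1, 0 ≤ a x) →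
            ContinuousOn b (ball 0 1) → (∀ x ∈ ball (0 : En n) 1, 0 ≤ b x) →
          ∀ ξ : En n, ∀ c : ℝ, 0 ≤ c → c ≤ ε₀ →
          ∀ u : En n → ℝ, ContinuousOn u (ball 0 1) →
            (∀ x ∈ ball (0 : En n) 1, |u x| ≤ 1) →
            (∀ x ∈ ball (0 : En n) 1, ∀ y ∈ ball (0 : En n) 1, u x - u y ≤ 1) →
            ViscSubOn (ball 0 1) (minOp F pp pm q s a b ξ fun _ => c) u →
            ViscSupOn (ball 0 1) (maxOp F pp pm q s a b ξ fun _ => -c) u →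
            ∃ ξσ : En n, ∃ m : ℝ, m < σ / 2 ∧
              ∀ x ∈ ball (0 : En n) σ, ∀ y ∈ ball (0 : En n) σ,
                (u x - (inner ℝ ξσ x : ℝ)) - (u y - (inner ℝ ξσ y : ℝ)) ≤ m := by
  obtain ⟨σ, hσ, H⟩ := abstract_approx (E := En n) hlam hlL
  refine ⟨σ, hσ, fun pp pm q s hpp _ hpm _ => ?_⟩
  obtain ⟨ε₀, hε, H⟩ := H (max pp pm) (hpp.trans (le_max_left _ _))
  refine ⟨ε₀, hε, ?_⟩
  intro F hF hF0 a b _ ha _ hb ξ c hc0 hc u hu hub hosc h1 h2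
  exact H _ (opM_ell hF) (by simp only [opM_zero, hF0]) ξ c hc0 hc u hu hub hosc
    (sub_conv hpp hpm (le_max_left _ _) (le_max_right _ _) hc0 ha hb h1)
    (sup_conv hpp hpm (le_max_left _ _) (le_max_right _ _) hc0 ha hb h2)
end
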